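/- For every increasing factorization ρ^• of a reduced word, the weak Edelman–Greene recording tableau Q̂(ρ^•) is a key tableau. -/

import Mathlib

noncomputable section
attribute [local instance] Classical.propDecidable

/-! ### Words, permutations, reduced words -/

/-- The adjacent transposition `s_i` exchanging `i` and `i+1`. -/
def sPerm (i : ℕ) : Equiv.Perm ℕ := Equiv.swap i (i + 1)

/-- The permutation `s_{i_1} ⋯ s_{i_n}` represented by the word `i_1 ⋯ i_n`. -/
def wordPerm (ρ : List ℕ) : Equiv.Perm ℕ := (ρ.map sPerm).prod

/-- A word whose letters are positive integers. -/
def PosWord (ρ : List ℕ) : Prop := ∀ x ∈ ρ, 1 ≤ x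

/-- A reduced word: a word of positive integers of minimal length among all words of
positive integers representing the same permutation. -/
def IsReducedWord (ρ : List ℕ) : Prop :=
  PosWord ρ ∧ ∀ σ : List ℕ, PosWord σ → wordPerm σ = wordPerm ρ → ρ.length ≤ σ.length

/-- `ρ` is a reduced word for the permutation `w`. -/
def IsReducedWordFor (w : Equiv.Perm ℕ) (ρ : List ℕ) : Prop :=
  IsReducedWord ρ ∧ wordPerm ρ = w

/-- A member of `S∞`: a permutation of the positive integers (it fixes `0`)
fixing all but finitely many points. -/
def FinitaryPerm (w : Equiv.Perm ℕ) : Prop := w 0 = 0 ∧ {i : ℕ | w i ≠ i}.Finite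

/-- A flag: a weakly increasing function `φ : ℤ_{>0} → ℤ_{>0}` with `φ(n) ≥ n`. -/
def IsFlag (φ : ℕ → ℕ) : Prop :=
  (∀ m n : ℕ, 1 ≤ m → m ≤ n → φ m ≤ φ n) ∧ ∀ n : ℕ, 1 ≤ n → n ≤ φ n

/-- A weak composition, as a function on the positive integers (value `0` at `0`)
with finitely many nonzero entries. -/
def WeakComp (α : ℕ → ℕ) : Prop := α 0 = 0 ∧ {i : ℕ | α i ≠ 0}.Finite

/-- `φ - e_i`, i.e. `l ↦ φ(l) - δ_{il}`. -/
def subE (φ : ℕ → ℕ) (i : ℕ) : ℕ → ℕ := fun l => if l = i then φ l - 1 else φ l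

/-- The right action of `s_i` on weak compositions, swapping entries `i` and `i+1`. -/
def swapC (α : ℕ → ℕ) (i : ℕ) : ℕ → ℕ := fun j => α (sPerm i j)

/-- `α` has length `k`: `k` is minimal with `α i = 0` for all `i > k`. -/
def HasLen (α : ℕ → ℕ) (k : ℕ) : Prop :=
  (∀ i, k < i → α i = 0) ∧ ∀ m, (∀ i, m < i → α i = 0) → k ≤ m

/-! ### Coxeter–Knuth equivalence -/

/-- One Coxeter–Knuth move. -/
def CKStep (u v : List ℕ) : Prop :=
  (∃ (a b : List ℕ) (x y z : ℕ), y < x ∧ x < z ∧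
      u = a ++ [x, y, z] ++ b ∧ v = a ++ [x, z, y] ++ b) ∨
  (∃ (a b : List ℕ) (x y z : ℕ), y < z ∧ z < x ∧
      u = a ++ [x, y, z] ++ b ∧ v = a ++ [y, x, z] ++ b) ∨
  (∃ (a b : List ℕ) (i : ℕ),
      u = a ++ [i, i + 1, i] ++ b ∧ v = a ++ [i + 1, i, i + 1] ++ b)

/-- Coxeter–Knuth equivalence: the transitive (symmetric, reflexive) closure of `CKStep`. -/
def CKEquiv : List ℕ → List ℕ → Prop := Relation.EqvGen CKStep

/-! ### Run factorizations and weak descent tableaux -/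

/-- The run factorization of a word into maximal strictly increasing blocks
(listed from left to right). -/
def runFact : List ℕ → List (List ℕ)
  | [] => []
  | a :: rest =>
    match runFact rest with
    | [] => [[a]]
    | r :: rs => if a < r.headI then (a :: r) :: rs else [a] :: r :: rs

/-- Auxiliary: rows of the remaining blocks, given the row of the previous block. -/
def wdtRowsAux : ℤ → List (List ℕ) → List ℤ
  | _, [] => []
  | prev, b :: bs =>
      min (prev - 1) (b.headI : ℤ) :: wdtRowsAux (min (prev - 1) (b.headI : ℤ)) bs

/-- The row indices assigned to the blocks of a run factorization (blocks listed
left to right): the leftmost block goes to the row indexed by its first letter, and each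
subsequent block goes to the row indexed by its first letter if this is below the previous
block's row, and otherwise directly below the previous block's row. -/
def wdtRows : List (List ℕ) → List ℤ
  | [] => []
  | b :: bs => (b.headI : ℤ) :: wdtRowsAux (b.headI : ℤ) bs

/-- A tableau: rows indexed by `ℤ` (bottom to top), columns indexed by `ℕ` starting at `1`;
the value `0` means that there is no box, a nonzero value is the (positive) entry. -/
abbrev Tableau := ℤ → ℕ → ℕ

/-- The weak descent tableau of a word. -/
def weakDesTab (ρ : List ℕ) : Tableau := fun r c =>
  if c = 0 then 0
  else
    match ((wdtRows (runFact ρ)).zip (runFact ρ)).find? (fun p => decide (p.1 = r)) with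
    | some p => p.2.getD (c - 1) 0
    | none => 0

/-- A word is non-virtual if its weak descent tableau only occupies rows of positive index. -/
def NonVirtual (ρ : List ℕ) : Prop := ∀ r ∈ wdtRows (runFact ρ), 1 ≤ r

/-- The shape of a tableau: the number of boxes in each (positively indexed) row. -/
def shapeOf (T : Tableau) : ℕ → ℕ := fun i => Set.ncard {c : ℕ | T (i : ℤ) c ≠ 0}

/-- The weak descent composition of a word: the shape of its weak descent tableau. -/
def desComp (ρ : List ℕ) : ℕ → ℕ := shapeOf (weakDesTab ρ)

/-- Partial-sum (dominance) order on weak compositions. -/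
def compLE (μ ν : ℕ → ℕ) : Prop :=
  ∀ k : ℕ, ∑ i ∈ Finset.Icc 1 k, μ i ≤ ∑ i ∈ Finset.Icc 1 k, ν i

/-- A Yamanouchi reduced word: a non-virtual reduced word that is minimal in its
Coxeter–Knuth class among non-virtual words, for the order
`ρ ≤ τ ↔ ρ ~ τ ∧ des ρ ≤ des τ`. -/
def Yamanouchi (ρ : List ℕ) : Prop :=
  IsReducedWord ρ ∧ NonVirtual ρ ∧
    ∀ σ : List ℕ, NonVirtual σ → CKEquiv ρ σ → compLE (desComp ρ) (desComp σ)

/-- The (unique) Yamanouchi reduced word Coxeter–Knuth equivalent to `ρ`. -/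
def hatRho (ρ : List ℕ) : List ℕ :=
  if h : ∃ σ, Yamanouchi σ ∧ CKEquiv ρ σ then h.choose else []

/-- The weak Edelman–Greene insertion tableau of a word: the weak descent tableau of the
unique Yamanouchi reduced word Coxeter–Knuth equivalent to it. -/
def hatP (ρ : List ℕ) : Tableau := weakDesTab (hatRho ρ)

/-! ### Factorizations -/

/-- The factorization `f : ℕ → List ℕ` stores the block `ρ^{(i)}` at index `i ≥ 1`
(blocks indexed from the right); the largest index of a nonempty block. -/
def topIdx (f : ℕ → List ℕ) : ℕ := sSup {i : ℕ | f i ≠ []}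

/-- The concatenation `ρ^{(top)} ⋯ ρ^{(i+1)} ρ^{(i)}` of the blocks of `f` with index `≥ i`. -/
def factWordGe (f : ℕ → List ℕ) (i : ℕ) : List ℕ :=
  ((((List.range (topIdx f + 1)).reverse).filter (fun j => decide (i ≤ j))).map f).foldr
    (· ++ ·) []

/-- The underlying word of a factorization. -/
def factWord (f : ℕ → List ℕ) : List ℕ := factWordGe f 0

/-- The weak Edelman–Greene recording tableau of a factorization: it has the same shape as
the weak EG insertion tableau of the underlying word, and has entry `i` in all boxes of
`P̂(ρ^{(k)}|⋯|ρ^{(i)})` that are not in `P̂(ρ^{(k)}|⋯|ρ^{(i+1)})`. -/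
def hatQfact (f : ℕ → List ℕ) : Tableau := fun r c =>
  sSup {i : ℕ | 1 ≤ i ∧ hatP (factWordGe f i) r c ≠ 0 ∧ hatP (factWordGe f (i + 1)) r c = 0}

/-- Every block is strictly increasing. -/
def IncreasingFact (f : ℕ → List ℕ) : Prop := ∀ i, List.Chain' (· < ·) (f i)

/-- The factorization is `φ`-flagged: every nonempty block `ρ^{(i)}` has first letter
`ρ^{(i)}_1` with `φ(ρ^{(i)}_1) ≥ i`. -/
def FlaggedFact (φ : ℕ → ℕ) (f : ℕ → List ℕ) : Prop :=
  ∀ i, f i ≠ [] → i ≤ φ ((f i).headI)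

/-- `RFC(w, φ)`: all `φ`-flagged increasing factorizations of reduced words for `w`. -/
def RFCset (w : Equiv.Perm ℕ) (φ : ℕ → ℕ) : Set (ℕ → List ℕ) :=
  {f | f 0 = [] ∧ {i : ℕ | f i ≠ []}.Finite ∧ IncreasingFact f ∧ FlaggedFact φ f ∧
       IsReducedWordFor w (factWord f)}

/-- `RF_n(w)`: increasing factorizations of reduced words for `w` with exactly `n` blocks
(indexed `1, …, n`, possibly empty). -/
def RFn (n : ℕ) (w : Equiv.Perm ℕ) : Set (ℕ → List ℕ) :=
  {f | f 0 = [] ∧ (∀ j, n < j → f j = []) ∧ IncreasingFact f ∧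
       IsReducedWordFor w (factWord f)}

/-- `RFC_n(w, φ)`: the `φ`-flagged elements of `RF_n(w)`. -/
def RFCn (n : ℕ) (w : Equiv.Perm ℕ) (φ : ℕ → ℕ) : Set (ℕ → List ℕ) :=
  {f | f ∈ RFn n w ∧ FlaggedFact φ f}

/-! ### Morse–Schilling crystal operators -/

/-- Pairing procedure: first argument is the block `r^{(i)}` in *decreasing* order, second is
the not-yet-paired part of the block `r^{(i+1)}` (in increasing order). Each letter `b` of
`r^{(i)}`, from largest to smallest, is paired with the smallest still unpaired letter of
`r^{(i+1)}` strictly larger than `b`. Returns the unpaired letters of `r^{(i+1)}`. -/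
def unpairedUpper : List ℕ → List ℕ → List ℕ
  | [], A => A
  | b :: bs, A =>
    match A.find? (fun a => decide (b < a)) with
    | some a => unpairedUpper bs (A.erase a)
    | none => unpairedUpper bs A

/-- As in `unpairedUpper`, but returns the unpaired letters of `r^{(i)}`. -/
def unpairedLower : List ℕ → List ℕ → List ℕ
  | [], _ => []
  | b :: bs, A =>
    match A.find? (fun a => decide (b < a)) with
    | some a => unpairedLower bs (A.erase a)
    | none => b :: unpairedLower bs A

/-- Insert a letter into a weakly increasing list, keeping it increasing. -/
def insAsc (x : ℕ) : List ℕ → List ℕ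
  | [] => [x]
  | y :: ys => if x ≤ y then x :: y :: ys else y :: insAsc x ys

/-- The Morse–Schilling raising operator `e_i`: if every letter of block `i+1` is paired,
the result is `none` (i.e. `0`); otherwise the largest unpaired letter `a` of block `i+1` is
removed and `a + s` is added to block `i`, where `s = min {j ≥ 0 | a+j+1 ∉ r^{(i+1)}}`. -/
def msE (i : ℕ) (f : ℕ → List ℕ) : Option (ℕ → List ℕ) :=
  let B := f i
  let A := f (i + 1)
  let L := unpairedUpper B.reverse A
  if L = [] then none
  else
    let a := L.foldr max 0
    let s := sInf {j : ℕ | (a + j + 1) ∉ A}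
    some (Function.update (Function.update f (i + 1) (A.erase a)) i (insAsc (a + s) B))

/-- The Morse–Schilling lowering operator `f_i`: if every letter of block `i` is paired,
the result is `none`; otherwise the smallest unpaired letter `b` of block `i` is removed and
`b - t` is added to block `i+1`, where `t = min {j ≥ 0 | b-j-1 ∉ r^{(i)}}`. -/
def msF (i : ℕ) (f : ℕ → List ℕ) : Option (ℕ → List ℕ) :=
  let B := f i
  let A := f (i + 1)
  let R := unpairedLower B.reverse A
  if R = [] then none
  else
    let b := R.foldr min R.headI
    let t := sInf {j : ℕ | (b - j - 1) ∉ B}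
    some (Function.update (Function.update f i (B.erase b)) (i + 1) (insAsc (b - t) A))

/-- Iteration `e_j^k` of the raising operator. -/
def msEIter (j : ℕ) : ℕ → (ℕ → List ℕ) → Option (ℕ → List ℕ)
  | 0, f => some f
  | k + 1, f => (msE j f).bind (msEIter j k)

/-- The Demazure operator `𝔇_j` on subsets of the crystal `RF_n(w)`:
`𝔇_j X = {b ∈ RF_n(w) | e_j^k(b) ∈ X for some k ≥ 0}`. -/
def demOp (n : ℕ) (w : Equiv.Perm ℕ) (j : ℕ) (X : Set (ℕ → List ℕ)) : Set (ℕ → List ℕ) :=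
  {b | b ∈ RFn n w ∧ ∃ (k : ℕ) (c : ℕ → List ℕ), msEIter j k b = some c ∧ c ∈ X}

/-- `𝔇_{i_1} 𝔇_{i_2} ⋯ 𝔇_{i_k} X` for a word `i_1 i_2 ⋯ i_k` (the head is applied last). -/
def demWord (n : ℕ) (w : Equiv.Perm ℕ) : List ℕ → Set (ℕ → List ℕ) → Set (ℕ → List ℕ)
  | [], X => X
  | j :: rest, X => demOp n w j (demWord n w rest X)

/-- `𝔇_{b↓a} = 𝔇_{b-1} 𝔇_{b-2} ⋯ 𝔇_a` (the identity when `b ≤ a`). -/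
def demDown (n : ℕ) (w : Equiv.Perm ℕ) (b a : ℕ) (X : Set (ℕ → List ℕ)) :
    Set (ℕ → List ℕ) :=
  demWord n w ((List.range' a (b - a)).reverse) X

/-! ### Key tableaux -/

/-- A key tableau: a filling of a left-justified diagram in the positively indexed rows,
with positive entries, weakly decreasing rows, distinct column entries, and the key
condition (c) of Assaf–Schilling. -/
def IsKeyTableau (T : Tableau) : Prop :=
  (∀ (r : ℤ) (c : ℕ), r ≤ 0 → T r c = 0) ∧
  (∀ r : ℤ, T r 0 = 0) ∧
  {p : ℤ × ℕ | T p.1 p.2 ≠ 0}.Finite ∧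
  (∀ (r : ℤ) (c : ℕ), 1 ≤ c → T r (c + 1) ≠ 0 → T r c ≠ 0) ∧
  (∀ (r : ℤ) (c : ℕ), 1 ≤ c → T r (c + 1) ≠ 0 → T r (c + 1) ≤ T r c) ∧
  (∀ (r r' : ℤ) (c : ℕ), r ≠ r' → T r c ≠ 0 → T r' c ≠ 0 → T r c ≠ T r' c) ∧
  (∀ (r r' : ℤ) (c : ℕ), r < r' → T r c ≠ 0 → T r' c ≠ 0 → T r' c < T r c →
      T r (c + 1) ≠ 0 ∧ T r' c < T r (c + 1))

/-- The tableau is `φ`-flagged: every entry in row `i` is at most `φ(i)`. -/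
def FlaggedTab (φ : ℕ → ℕ) (T : Tableau) : Prop := ∀ (i c : ℕ), T (i : ℤ) c ≤ φ i

/-- `SSKT(α, φ)`: the `φ`-flagged key tableaux of shape `α`. -/
def SSKT (α φ : ℕ → ℕ) : Set Tableau :=
  {T | IsKeyTableau T ∧ shapeOf T = α ∧ FlaggedTab φ T}

/-- The weight of a tableau: `wt(T)_v` is the number of entries equal to `v`. -/
def wtTab (T : Tableau) : ℕ → ℕ := fun v =>
  if v = 0 then 0 else Set.ncard {p : ℤ × ℕ | T p.1 p.2 = v}

/-- The weight of a word: the multiplicity of each positive letter. -/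
def wtWord (u : List ℕ) : ℕ → ℕ := fun v => if v = 0 then 0 else u.count v

/-- The statistic `m_i(col(T), j)` where position `j` of the reverse column reading word
(entries read down columns, from right to left) is the box in row `r`, column `c`:
the number of entries `i+1` weakly after this box minus the number of entries `i`. -/
def mi (T : Tableau) (i : ℕ) (r : ℤ) (c : ℕ) : ℤ :=
  (Set.ncard {p : ℤ × ℕ | T p.1 p.2 = i + 1 ∧ (p.2 < c ∨ (p.2 = c ∧ p.1 ≤ r))} : ℤ) -
  (Set.ncard {p : ℤ × ℕ | T p.1 p.2 = i ∧ (p.2 < c ∨ (p.2 = c ∧ p.1 ≤ r))} : ℤ)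

/-- The box `(r, c)` maximizes `m_i` among all boxes of `T`. -/
def isMaxBox (T : Tableau) (i : ℕ) (r : ℤ) (c : ℕ) : Prop :=
  T r c ≠ 0 ∧ ∀ (r' : ℤ) (c' : ℕ), T r' c' ≠ 0 → mi T i r' c' ≤ mi T i r c

/-- The Assaf–Schilling raising operator `e_i` on key tableaux.  If `m_i(col(T)) ≤ 0` the
result is `none` (i.e. `0`); otherwise, with `q` the largest position of the reverse column
reading word achieving the maximum (i.e. the maximizing box with the smallest column index,
and the smallest row index in that column), all entries `i+1` in the row of `q` weakly to its
right are changed to `i`, and all entries `i` in the same columns as these entries are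
changed to `i+1`. -/
def keyE (i : ℕ) (T : Tableau) : Option Tableau :=
  if h : ∃ (r : ℤ) (c : ℕ), isMaxBox T i r c ∧ 1 ≤ mi T i r c then
    let cq := sInf {c : ℕ | ∃ r : ℤ, isMaxBox T i r c}
    let rq : ℤ := ((sInf {m : ℕ | isMaxBox T i ((m : ℕ) : ℤ) cq} : ℕ) : ℤ)
    some (fun r c =>
      if cq ≤ c ∧ T rq c = i + 1 then
        (if T r c = i + 1 then i else if T r c = i then i + 1 else T r c)
      else T r c)
  else none

/-- The Assaf–Schilling lowering operator `f_i`: the (unique) inverse of `e_i`. -/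
def keyF (i : ℕ) (T : Tableau) : Option Tableau :=
  if h : ∃ T', keyE i T' = some T then some h.choose else none

/-- Restriction of a partially defined crystal operator to a subset: the operator returns
`none` (i.e. `0`) whenever it would leave the subset. -/
def restrictOp {β : Type} (S : Set β) (op : β → Option β) (x : β) : Option β :=
  (op x).bind fun y => if y ∈ S then some y else none

/-! ### Polynomials: divided differences and key polynomials -/

/-- The divided difference operator `∂_i f = (f - s_i · f) / (x_i - x_{i+1})`. -/
def divDiff (i : ℕ) (fp : MvPolynomial ℕ ℤ) : MvPolynomial ℕ ℤ :=
  if h : ∃ g : MvPolynomial ℕ ℤ,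
      g * (MvPolynomial.X i - MvPolynomial.X (i + 1)) =
        fp - MvPolynomial.rename (fun j => sPerm i j) fp
  then h.choose else 0

/-- The isobaric divided difference operator `π_i f = ∂_i (x_i f)`. -/
def piOp (i : ℕ) (fp : MvPolynomial ℕ ℤ) : MvPolynomial ℕ ℤ :=
  divDiff i (MvPolynomial.X i * fp)

/-- `π_{i_1} π_{i_2} ⋯ π_{i_k} f` for a word `i_1 i_2 ⋯ i_k` (the head is applied last). -/
def piWord : List ℕ → MvPolynomial ℕ ℤ → MvPolynomial ℕ ℤ
  | [], fp => fp
  | i :: rest, fp => piOp i (piWord rest fp)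

/-- `π_{b↓a} = π_{b-1} π_{b-2} ⋯ π_a` (the identity when `b ≤ a`). -/
def piDown (b a : ℕ) (fp : MvPolynomial ℕ ℤ) : MvPolynomial ℕ ℤ :=
  piWord ((List.range' a (b - a)).reverse) fp

/-- The conjugate of a weak composition: `conjC α t = #{j ≥ 1 | α_j ≥ t}` for `t ≥ 1`. -/
def conjC (α : ℕ → ℕ) (t : ℕ) : ℕ :=
  Set.ncard {j : ℕ | 1 ≤ j ∧ 1 ≤ t ∧ t ≤ α j}

/-- The partition rearrangement of a weak composition (the conjugate of its conjugate). -/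
def sortC (α : ℕ → ℕ) : ℕ → ℕ := conjC (conjC α)

/-- The length of a permutation: the common length of its reduced words. -/
def permLength (w : Equiv.Perm ℕ) : ℕ :=
  sInf {n : ℕ | ∃ ρ : List ℕ, PosWord ρ ∧ wordPerm ρ = w ∧ ρ.length = n}

/-- The monomial `x^β = x_1^{β_1} x_2^{β_2} ⋯`. -/
def xExp (β : ℕ → ℕ) : MvPolynomial ℕ ℤ :=
  ∏ i ∈ Finset.range (sSup {n : ℕ | β n ≠ 0} + 1), MvPolynomial.X i ^ β i

/-- The key polynomial `κ_α = π_w x^λ` where `λ` is the partition rearrangement of `α` and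
`w` is the minimal-length permutation of `S∞` with `α · w = λ`. -/
def keyPoly (α : ℕ → ℕ) : MvPolynomial ℕ ℤ :=
  if h : ∃ (ρ : List ℕ) (w : Equiv.Perm ℕ), IsReducedWordFor w ρ ∧
      (∀ i, α (w i) = sortC α i) ∧
      (∀ v : Equiv.Perm ℕ, (∃ τ, IsReducedWordFor v τ) → (∀ i, α (v i) = sortC α i) →
        permLength w ≤ permLength v)
  then piWord h.choose (xExp (sortC α)) else 0

/-- The `φ`-flagged key polynomial `κ_{(α,φ)} = Σ_{T ∈ SSKT(α,φ)} x^{wt(T)}`. -/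
def flaggedKeyPoly (α φ : ℕ → ℕ) : MvPolynomial ℕ ℤ :=
  ∑ᶠ T ∈ SSKT α φ, xExp (wtTab T)

/-! ### Column insertion, keys, standardization -/

/-- The number of boxes in column `c` of a tableau. -/
def colHeightN (T : Tableau) (c : ℕ) : ℕ := Set.ncard {r : ℤ | T r c ≠ 0}

/-- One pass of column insertion: insert the value `x` starting at column `c`
(`fuel` bounds the number of columns visited). -/
def colInsertAux : ℕ → Tableau → ℕ → ℕ → Tableau
  | 0, T, _, _ => T
  | fuel + 1, T, c, x =>
    if ∀ r : ℤ, T r c ≠ 0 → T r c < x then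
      -- x is greater than every entry of column c: place it at the end of the column
      fun r c' => if c' = c ∧ r = (colHeightN T c + 1 : ℤ) then x else T r c'
    else if ∃ r : ℤ, T r c = x then
      -- column c contains x: move on to the next column with the same value
      colInsertAux fuel T (c + 1) x
    else
      -- bump the smallest entry of column c that is larger than x
      let y := sInf {v : ℕ | x < v ∧ ∃ r : ℤ, T r c = v}
      colInsertAux fuel (fun r c' => if c' = c ∧ T r c' = y then x else T r c') (c + 1) y

/-- Column insertion of `x` into the semistandard Young tableau `T`. -/
def colInsert (T : Tableau) (x : ℕ) : Tableau :=
  colInsertAux (sSup {c : ℕ | ∃ r : ℤ, T r c ≠ 0} + 2) T 1 x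

/-- The insertion tableau `P` of `(v → ∅)`: successively column insert
`v_n, v_{n-1}, …, v_1` into the empty tableau. -/
def insertP (v : List ℕ) : Tableau :=
  v.reverse.foldl colInsert (fun _ _ => 0)

/-- The recording tableau `Q` of `(v → ∅)`: the standard Young tableau whose restriction to
`{1, …, j}` has the same shape as the insertion tableau of the last `j` letters of `v`. -/
def insertQ (v : List ℕ) : Tableau := fun r c =>
  sInf {j : ℕ | insertP (v.drop (v.length - j)) r c ≠ 0}

/-- The key `key(α)`: the unique semistandard Young tableau of weight `α` such that the set
of entries of column `i+1` is a subset of the entries of column `i`; its column `c` consists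
of the elements of `{x ≥ 1 | α_x ≥ c}` in increasing order from bottom to top. -/
def keyTab (α : ℕ → ℕ) : Tableau := fun r c =>
  if c = 0 then 0
  else sInf {x : ℕ | 1 ≤ x ∧ c ≤ α x ∧
    ((Set.ncard {y : ℕ | 1 ≤ y ∧ c ≤ α y ∧ y ≤ x} : ℕ) : ℤ) = r}

/-- The standardization of a semistandard Young tableau: the `1`'s are replaced from left to
right by `1, …, β_1`, the `2`'s by `β_1 + 1, …, β_1 + β_2`, and so on. -/
def stdTab (T : Tableau) : Tableau := fun r c =>
  if T r c = 0 then 0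
  else Set.ncard {p : ℤ × ℕ |
    T p.1 p.2 ≠ 0 ∧ (T p.1 p.2 < T r c ∨ (T p.1 p.2 = T r c ∧ p.2 ≤ c))}

/-! ### Maximal factorizations (Reiner–Shimozono) -/

/-- Every block is weakly increasing. -/
def WeaklyIncrFact (g : ℕ → List ℕ) : Prop := ∀ i, List.Chain' (· ≤ ·) (g i)

/-- Maximality: the nonempty blocks have maximal length, i.e. there is a strict descent
between any two consecutive nonempty blocks (no letter can be moved from the end of a block
to the front of the next one to the right). -/
def MaxFact (g : ℕ → List ℕ) : Prop :=
  ∀ i j : ℕ, 1 ≤ i → i < j → g i ≠ [] → g j ≠ [] → (∀ m, i < m → m < j → g m = []) →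
    (g i).headI < (g j).getLastD 0

/-- Reiner–Shimozono's set `𝒲(α, φ)` of `φ`-flagged maximal factorizations
`u^• = u^n ⋯ u^2 u^1` with `ℓ(u^i) = α_i` and `(u → ∅) = (P, std(key(α)))`. -/
def Wset (α φ : ℕ → ℕ) : Set (ℕ → List ℕ) :=
  {g | g 0 = [] ∧ (∀ i, (g i).length = α i) ∧ (∀ i, ∀ x ∈ g i, 1 ≤ x) ∧
       WeaklyIncrFact g ∧ MaxFact g ∧ (∀ i, ∀ x ∈ g i, x ≤ φ i) ∧
       insertQ (factWord g) = stdTab (keyTab α)}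

/-! ### Shifts and highest weight key tableaux -/

/-- `shift_N`: add `N` to every letter of every block. -/
def shiftFact (N : ℕ) (f : ℕ → List ℕ) : ℕ → List ℕ := fun i => (f i).map (· + N)

/-- The tableau of shape `α` whose column `i` is filled by `1, 2, …, λ^T_i` in increasing
order from bottom to top (where `λ^T` is the conjugate of the partition rearrangement `λ`
of `α`): the box of column `c` in row `m` (where `α_m ≥ c`) contains the number of indices
`m' ≤ m` with `α_{m'} ≥ c`. -/
def highKeyTab (α : ℕ → ℕ) : Tableau := fun r c =>
  if c = 0 then 0
  else if ∃ m : ℕ, (m : ℤ) = r ∧ 1 ≤ m ∧ c ≤ α m then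
    Set.ncard {m : ℕ | 1 ≤ m ∧ c ≤ α m ∧ (m : ℤ) ≤ r}
  else 0


/-- A `gl_n`-crystal isomorphism between two sets of key tableaux, both equipped with the
Assaf–Schilling operators (restricted to the sets): a weight-preserving bijection commuting
with all raising and lowering operators `e_i, f_i` for `1 ≤ i < n`. -/
def SSKTIso (n : ℕ) (S₁ S₂ : Set Tableau) : Prop :=
  ∃ g : Tableau → Tableau, Set.BijOn g S₁ S₂ ∧
    (∀ T ∈ S₁, wtTab T = wtTab (g T)) ∧
    ∀ T ∈ S₁, ∀ i : ℕ, 1 ≤ i → i < n →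
      Option.map g (restrictOp S₁ (keyE i) T) = restrictOp S₂ (keyE i) (g T) ∧
      Option.map g (restrictOp S₁ (keyF i) T) = restrictOp S₂ (keyF i) (g T)

end

/-! ### Reduced words and Coxeter–Knuth moves -/

lemma wordPerm_append (u v : List ℕ) : wordPerm (u ++ v) = wordPerm u * wordPerm v := by
  simp [wordPerm]

lemma sPerm_mul_self (i : ℕ) : sPerm i * sPerm i = 1 := by simp [sPerm]

lemma sPerm_comm {i j : ℕ} (h : i + 1 < j) : sPerm i * sPerm j = sPerm j * sPerm i := by
  ext k
  simp only [sPerm, Equiv.Perm.mul_apply, Equiv.swap_apply_def]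
  split_ifs <;> omega

lemma sPerm_braid (i : ℕ) :
    sPerm i * (sPerm (i + 1) * sPerm i) = sPerm (i + 1) * (sPerm i * sPerm (i + 1)) := by
  ext k
  simp only [sPerm, Equiv.Perm.mul_apply, Equiv.swap_apply_def]
  split_ifs <;> omega

lemma posWord_append {u v : List ℕ} : PosWord (u ++ v) ↔ PosWord u ∧ PosWord v := by
  simp [PosWord, or_imp, forall_and]

lemma posWord_cons {a : ℕ} {v : List ℕ} : PosWord (a :: v) ↔ 1 ≤ a ∧ PosWord v := by
  simp [PosWord]

lemma posWord_nil : PosWord [] := by simp [PosWord]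

/-- Two words of the same length, positivity and permutation. -/
def PermEquiv (u v : List ℕ) : Prop :=
  wordPerm u = wordPerm v ∧ u.length = v.length ∧ (PosWord u ↔ PosWord v)

lemma PermEquiv.refl (u : List ℕ) : PermEquiv u u := ⟨rfl, rfl, Iff.rfl⟩

lemma PermEquiv.symm {u v : List ℕ} (h : PermEquiv u v) : PermEquiv v u :=
  ⟨h.1.symm, h.2.1.symm, h.2.2.symm⟩

lemma PermEquiv.trans {u v w : List ℕ} (h : PermEquiv u v) (h' : PermEquiv v w) :
    PermEquiv u w :=
  ⟨h.1.trans h'.1, h.2.1.trans h'.2.1, h.2.2.trans h'.2.2⟩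

lemma PermEquiv.append {u v u' v' : List ℕ} (h : PermEquiv u v) (h' : PermEquiv u' v') :
    PermEquiv (u ++ u') (v ++ v') := by
  refine ⟨?_, ?_, ?_⟩
  · rw [wordPerm_append, wordPerm_append, h.1, h'.1]
  · simp [h.2.1, h'.2.1]
  · rw [posWord_append, posWord_append, h.2.2, h'.2.2]

lemma PermEquiv.isReducedWord {u v : List ℕ} (h : PermEquiv u v) (hu : IsReducedWord u) :
    IsReducedWord v :=
  ⟨h.2.2.1 hu.1, fun σ hσ e => h.2.1 ▸ hu.2 σ hσ (e.trans h.1.symm)⟩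

lemma permEquiv_comm {i j : ℕ} (h : i + 1 < j ∨ j + 1 < i) : PermEquiv [i, j] [j, i] := by
  refine ⟨?_, rfl, ?_⟩
  · rcases h with h | h
    · simpa [wordPerm] using sPerm_comm h
    · simpa [wordPerm] using (sPerm_comm h).symm
  · simp [PosWord]; tauto

lemma permEquiv_braid (i : ℕ) : PermEquiv [i, i + 1, i] [i + 1, i, i + 1] ∨ i = 0 := by
  rcases Nat.eq_zero_or_pos i with h | h
  · exact Or.inr h
  · refine Or.inl ⟨by simpa [wordPerm] using sPerm_braid i, rfl, ?_⟩
    simp [PosWord]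

lemma permEquiv_comm_word {a : ℕ} {v : List ℕ} (h : ∀ x ∈ v, x + 1 < a ∨ a + 1 < x) :
    PermEquiv (a :: v) (v ++ [a]) := by
  induction v with
  | nil => exact PermEquiv.refl _
  | cons x v ih =>
    have h1 : PermEquiv ([a, x] ++ v) ([x, a] ++ v) :=
      (permEquiv_comm (h x (by simp)).symm).append (PermEquiv.refl v)
    exact h1.trans ((PermEquiv.refl [x]).append (ih fun y hy => h y (by simp [hy])))

lemma IsReducedWord.middle {a b c : List ℕ} (h : IsReducedWord (a ++ b ++ c)) :
    IsReducedWord b := by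
  have hp := posWord_append.1 h.1
  have hp' := posWord_append.1 hp.1
  refine ⟨hp'.2, fun σ hσ e => ?_⟩
  have := h.2 (a ++ σ ++ c) (posWord_append.2 ⟨posWord_append.2 ⟨hp'.1, hσ⟩, hp.2⟩)
    (by simp only [wordPerm_append, e])
  simp at this
  exact this

lemma IsReducedWord.left {a b : List ℕ} (h : IsReducedWord (a ++ b)) : IsReducedWord a :=
  IsReducedWord.middle (a := []) (c := b) (by simpa using h)

lemma IsReducedWord.right {a b : List ℕ} (h : IsReducedWord (a ++ b)) : IsReducedWord b :=
  IsReducedWord.middle (a := a) (c := []) (by simpa using h)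

lemma IsReducedWord.tail {a : ℕ} {b : List ℕ} (h : IsReducedWord (a :: b)) :
    IsReducedWord b :=
  IsReducedWord.right (a := [a]) h

lemma not_isReducedWord_pair (i : ℕ) : ¬ IsReducedWord [i, i] := by
  intro h
  have := h.2 [] posWord_nil (by simp [wordPerm, sPerm_mul_self])
  simp at this

lemma not_isReducedWord_of_permEquiv {u a b : List ℕ} {i : ℕ}
    (h : PermEquiv u (a ++ [i, i] ++ b)) : ¬ IsReducedWord u := fun hu =>
  not_isReducedWord_pair i (h.isReducedWord hu).middle

/-- No reduced word contains two equal letters separated by letters commuting with them. -/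
lemma not_isReducedWord_of_comm {a : ℕ} {v : List ℕ} (h : ∀ x ∈ v, x + 1 < a ∨ a + 1 < x) :
    ¬ IsReducedWord (a :: v ++ [a]) := by
  have := (permEquiv_comm_word h).append (PermEquiv.refl [a])
  exact not_isReducedWord_of_permEquiv (a := v) (b := []) (i := a) (by simpa using this)

lemma CKStep.isReducedWord_iff {u v : List ℕ} (h : CKStep u v) :
    IsReducedWord u ↔ IsReducedWord v := by
  have key : ∀ {a b u' v' : List ℕ}, PermEquiv u' v' →
      (IsReducedWord (a ++ u' ++ b) ↔ IsReducedWord (a ++ v' ++ b)) := by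
    intro a b u' v' h
    have := ((PermEquiv.refl a).append h).append (PermEquiv.refl b)
    exact ⟨this.isReducedWord, this.symm.isReducedWord⟩
  rcases h with ⟨a, b, x, y, z, h1, h2, rfl, rfl⟩ | ⟨a, b, x, y, z, h1, h2, rfl, rfl⟩ |
    ⟨a, b, i, rfl, rfl⟩
  · exact key ((PermEquiv.refl [x]).append (permEquiv_comm (Or.inl (by omega))))
  · exact key ((permEquiv_comm (Or.inr (by omega))).append (PermEquiv.refl [z]))
  · rcases permEquiv_braid i with h | rfl
    · exact key h
    · constructor <;> intro h <;>
        · have := h.1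
          simp [posWord_append, posWord_cons] at this

lemma CKStep.length_eq {u v : List ℕ} (h : CKStep u v) : u.length = v.length := by
  rcases h with ⟨a, b, x, y, z, h1, h2, rfl, rfl⟩ | ⟨a, b, x, y, z, h1, h2, rfl, rfl⟩ |
    ⟨a, b, i, rfl, rfl⟩ <;> simp

lemma CKEquiv.isReducedWord_iff {u v : List ℕ} (h : CKEquiv u v) :
    IsReducedWord u ↔ IsReducedWord v := by
  induction h with
  | rel _ _ h => exact h.isReducedWord_iff
  | refl => rfl
  | symm _ _ _ ih => exact ih.symm
  | trans _ _ _ _ _ ih ih' => exact ih.trans ih'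

lemma CKEquiv.length_eq {u v : List ℕ} (h : CKEquiv u v) : u.length = v.length := by
  induction h with
  | rel _ _ h => exact h.length_eq
  | refl => rfl
  | symm _ _ _ ih => exact ih.symm
  | trans _ _ _ _ _ ih ih' => exact ih.trans ih'

lemma CKEquiv.refl (u : List ℕ) : CKEquiv u u := Relation.EqvGen.refl u

lemma CKEquiv.symm {u v : List ℕ} (h : CKEquiv u v) : CKEquiv v u := Relation.EqvGen.symm _ _ h

lemma CKEquiv.trans {u v w : List ℕ} (h : CKEquiv u v) (h' : CKEquiv v w) : CKEquiv u w :=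
  Relation.EqvGen.trans _ _ _ h h'

lemma CKStep.congr {u v : List ℕ} (h : CKStep u v) (p q : List ℕ) :
    CKStep (p ++ u ++ q) (p ++ v ++ q) := by
  rcases h with ⟨a, b, x, y, z, h1, h2, rfl, rfl⟩ | ⟨a, b, x, y, z, h1, h2, rfl, rfl⟩ |
    ⟨a, b, i, rfl, rfl⟩
  · exact Or.inl ⟨p ++ a, b ++ q, x, y, z, h1, h2, by simp, by simp⟩
  · exact Or.inr (Or.inl ⟨p ++ a, b ++ q, x, y, z, h1, h2, by simp, by simp⟩)
  · exact Or.inr (Or.inr ⟨p ++ a, b ++ q, i, by simp, by simp⟩)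

lemma CKEquiv.congr {u v : List ℕ} (h : CKEquiv u v) (p q : List ℕ) :
    CKEquiv (p ++ u ++ q) (p ++ v ++ q) := by
  induction h with
  | rel _ _ h => exact Relation.EqvGen.rel _ _ (h.congr p q)
  | refl => exact CKEquiv.refl _
  | symm _ _ _ ih => exact ih.symm
  | trans _ _ _ _ _ ih ih' => exact ih.trans ih'

lemma CKEquiv.append_left {u v : List ℕ} (p : List ℕ) (h : CKEquiv u v) :
    CKEquiv (p ++ u) (p ++ v) := by simpa using h.congr p []

lemma CKEquiv.cons {u v : List ℕ} (p : ℕ) (h : CKEquiv u v) :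
    CKEquiv (p :: u) (p :: v) := by simpa using h.congr [p] []

lemma CKEquiv.append_right {u v : List ℕ} (h : CKEquiv u v) (q : List ℕ) :
    CKEquiv (u ++ q) (v ++ q) := by simpa using h.congr [] q

lemma ckEquiv_left {x y z : ℕ} (h1 : y < z) (h2 : z < x) (b : List ℕ) :
    CKEquiv (x :: y :: z :: b) (y :: x :: z :: b) :=
  Relation.EqvGen.rel _ _ (Or.inr (Or.inl ⟨[], b, x, y, z, h1, h2, by simp, by simp⟩))

lemma ckEquiv_right {x y z : ℕ} (h1 : y < x) (h2 : x < z) (b : List ℕ) :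
    CKEquiv (x :: y :: z :: b) (x :: z :: y :: b) :=
  Relation.EqvGen.rel _ _ (Or.inl ⟨[], b, x, y, z, h1, h2, by simp, by simp⟩)

lemma ckEquiv_braid (i : ℕ) (b : List ℕ) :
    CKEquiv (i :: (i + 1) :: i :: b) ((i + 1) :: i :: (i + 1) :: b) :=
  Relation.EqvGen.rel _ _ (Or.inr (Or.inr ⟨[], b, i, by simp, by simp⟩))

/-! ### Insertion of a letter into a column -/

/-- Column insertion of a letter into a set of letters. -/
def sIns (a : ℕ) (S : Finset ℕ) : Finset ℕ :=
  if h : (S.filter (a < ·)).Nonempty then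
    if a ∈ S then S else insert a (S.erase ((S.filter (a < ·)).min' h))
  else insert a S

/-- The letter bumped by column insertion, as a list of length at most one. -/
def bump (a : ℕ) (S : Finset ℕ) : List ℕ :=
  if h : (S.filter (a < ·)).Nonempty then [(S.filter (a < ·)).min' h] else []

/-- `Ins a S S' l`: inserting `a` into `S` produces `S'` and bumps `l`. -/
def Ins (a : ℕ) (S S' : Finset ℕ) (l : List ℕ) : Prop := sIns a S = S' ∧ bump a S = l

lemma ins_none {a : ℕ} {S : Finset ℕ} (h : ∀ s ∈ S, s ≤ a) : Ins a S (insert a S) [] := by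
  have : ¬ (S.filter (a < ·)).Nonempty := by
    rintro ⟨s, hs⟩
    simp only [Finset.mem_filter] at hs
    have := h s hs.1
    omega
  simp [Ins, sIns, bump, this]

lemma min'_filter_eq {a b : ℕ} {S : Finset ℕ} (hb : b ∈ S) (hab : a < b)
    (h : ∀ s ∈ S, s ≤ a ∨ b ≤ s) (hn : (S.filter (a < ·)).Nonempty) :
    (S.filter (a < ·)).min' hn = b := by
  apply le_antisymm
  · exact Finset.min'_le _ _ (by simp [hb, hab])
  · apply Finset.le_min'
    intro s hs
    simp only [Finset.mem_filter] at hs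
    rcases h s hs.1 with h | h <;> omega

lemma bump_eq {a b : ℕ} {S : Finset ℕ} (hb : b ∈ S) (hab : a < b)
    (h : ∀ s ∈ S, s ≤ a ∨ b ≤ s) : bump a S = [b] := by
  have hn : (S.filter (a < ·)).Nonempty := ⟨b, by simp [hb, hab]⟩
  simp only [bump, hn, dif_pos, min'_filter_eq hb hab h hn]

lemma ins_swap {a b : ℕ} {S : Finset ℕ} (ha : a ∉ S) (hb : b ∈ S) (hab : a < b)
    (h : ∀ s ∈ S, s ≤ a ∨ b ≤ s) : Ins a S (insert a (S.erase b)) [b] := by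
  refine ⟨?_, bump_eq hb hab h⟩
  have hn : (S.filter (a < ·)).Nonempty := ⟨b, by simp [hb, hab]⟩
  simp only [sIns, hn, dif_pos, min'_filter_eq hb hab h hn, ha, if_false]

lemma ins_stay' {a b : ℕ} {S : Finset ℕ} (ha : a ∈ S) (hb : b ∈ S) (hab : a < b)
    (h : ∀ s ∈ S, s ≤ a ∨ b ≤ s) : Ins a S S [b] := by
  refine ⟨?_, bump_eq hb hab h⟩
  have hn : (S.filter (a < ·)).Nonempty := ⟨b, by simp [hb, hab]⟩
  simp only [sIns, hn, dif_pos, ha, if_true]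

lemma ins_stay {a : ℕ} {S : Finset ℕ} (ha : a ∈ S) (hb : a + 1 ∈ S) : Ins a S S [a + 1] :=
  ins_stay' ha hb (by omega) (fun s _ => by omega)

lemma exists_next (a : ℕ) (S : Finset ℕ) :
    (∀ s ∈ S, s ≤ a) ∨ ∃ b ∈ S, a < b ∧ ∀ s ∈ S, s ≤ a ∨ b ≤ s := by
  by_cases hn : (S.filter (a < ·)).Nonempty
  · right
    have hm := Finset.min'_mem _ hn
    simp only [Finset.mem_filter] at hm
    refine ⟨_, hm.1, hm.2, fun s hs => ?_⟩
    by_cases h : s ≤ a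
    · exact Or.inl h
    · exact Or.inr (Finset.min'_le _ _ (by simp [hs]; omega))
  · left
    intro s hs
    by_contra h
    exact hn ⟨s, by simp [hs]; omega⟩

/-- The shape of a valid insertion. -/
lemma ins_cases {a : ℕ} {S : Finset ℕ} (hv : a ∈ S → a + 1 ∈ S) :
    ((∀ s ∈ S, s < a) ∧ Ins a S (insert a S) []) ∨
    (a ∈ S ∧ a + 1 ∈ S ∧ Ins a S S [a + 1]) ∨
    (∃ b, a ∉ S ∧ b ∈ S ∧ a < b ∧ (∀ s ∈ S, s < a ∨ b ≤ s) ∧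
      Ins a S (insert a (S.erase b)) [b]) := by
  by_cases ha : a ∈ S
  · exact Or.inr (Or.inl ⟨ha, hv ha, ins_stay ha (hv ha)⟩)
  · rcases exists_next a S with h | ⟨b, hb, hab, h⟩
    · refine Or.inl ⟨fun s hs => ?_, ins_none h⟩
      have := h s hs
      have : s ≠ a := fun e => ha (e ▸ hs)
      omega
    · refine Or.inr (Or.inr ⟨b, ha, hb, hab, fun s hs => ?_, ins_swap ha hb hab h⟩)
      have := h s hs
      have : s ≠ a := fun e => ha (e ▸ hs)
      omega

/-- Successive column insertion of the letters of a word, from right to left. -/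
def colOn : List ℕ → Finset ℕ → Finset ℕ
  | [], S => S
  | a :: w, S => sIns a (colOn w S)

/-- The word of bumped letters. -/
def bumpOn : List ℕ → Finset ℕ → List ℕ
  | [], _ => []
  | a :: w, S => bump a (colOn w S) ++ bumpOn w S

/-- Admissibility: a letter already present is inserted only if its successor is present. -/
def AdmOn : List ℕ → Finset ℕ → Prop
  | [], _ => True
  | a :: w, S => (a ∈ colOn w S → a + 1 ∈ colOn w S) ∧ AdmOn w S

lemma colOn_append (u v : List ℕ) (S : Finset ℕ) : colOn (u ++ v) S = colOn u (colOn v S) := by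
  induction u with
  | nil => rfl
  | cons a u ih => simp [colOn, ih]

lemma bumpOn_append (u v : List ℕ) (S : Finset ℕ) :
    bumpOn (u ++ v) S = bumpOn u (colOn v S) ++ bumpOn v S := by
  induction u with
  | nil => rfl
  | cons a u ih => simp [bumpOn, ih, colOn_append]

lemma admOn_append (u v : List ℕ) (S : Finset ℕ) :
    AdmOn (u ++ v) S ↔ AdmOn u (colOn v S) ∧ AdmOn v S := by
  induction u with
  | nil => simp [AdmOn]
  | cons a u ih => simp [AdmOn, ih, colOn_append, and_assoc]

lemma ins_three {x y z : ℕ} {S S1 S2 S3 : Finset ℕ} {l1 l2 l3 : List ℕ}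
    (h1 : Ins z S S1 l1) (h2 : Ins y S1 S2 l2) (h3 : Ins x S2 S3 l3) :
    colOn [x, y, z] S = S3 ∧ bumpOn [x, y, z] S = l3 ++ (l2 ++ l1) := by
  obtain ⟨rfl, rfl⟩ := h1
  obtain ⟨rfl, rfl⟩ := h2
  obtain ⟨rfl, rfl⟩ := h3
  simp [colOn, bumpOn]


lemma Ins.congr {a : ℕ} {S S' S'' : Finset ℕ} {l : List ℕ} (h : Ins a S S' l) (e : S' = S'') :
    Ins a S S'' l := e ▸ h

/-- Inserting two letters separated by an element of the column in either order. -/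
lemma ins_commute {y z n : ℕ} {S : Finset ℕ} (hn : n ∈ S) (h1 : y < n) (h2 : n < z)
    (hy : y ∈ S → y + 1 ∈ S) (hz : z ∈ S → z + 1 ∈ S) :
    ∃ ny S1 S2 S12 lz, ny ≤ n ∧ y < ny ∧ Ins y S S1 [ny] ∧ Ins z S1 S12 lz ∧
      Ins z S S2 lz ∧ Ins y S2 S12 [ny] ∧ z ∈ S12 ∧ (ny ∈ S12 → ny = y + 1) ∧
      (∀ s ∈ S12, s = y ∨ s = z ∨ s ∈ S) ∧ (∀ s ∈ S, s ≤ y ∨ ny ≤ s) ∧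
      ((lz = [] ∧ ∀ s ∈ S, s < z) ∨ ∃ nz, nz ∈ S ∧ lz = [nz] ∧ z < nz ∧
        (∀ s ∈ S, s ≤ z ∨ nz ≤ s)) := by
  rcases ins_cases hy with ⟨h, -⟩ | ⟨ya, yb, hyI⟩ | ⟨ny, ya, yb, yl, hyn, hyI⟩
  · have := h n hn; omega
  · rcases ins_cases hz with ⟨h, hzI⟩ | ⟨za, zb, hzI⟩ | ⟨nz, za, zb, zl, hzn, hzI⟩
    · exact ⟨y + 1, S, insert z S, insert z S, [], by omega, by omega, hyI, hzI, hzI,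
        ins_stay (by simp [ya]) (by simp [yb]), by simp, by simp, by grind,
        fun s _ => by omega, Or.inl ⟨rfl, h⟩⟩
    · exact ⟨y + 1, S, S, S, [z + 1], by omega, by omega, hyI, hzI, hzI, hyI, za, by simp,
        by grind, fun s _ => by omega,
        Or.inr ⟨z + 1, zb, rfl, by omega, fun s _ => by omega⟩⟩
    · refine ⟨y + 1, S, insert z (S.erase nz), insert z (S.erase nz), [nz], by omega, by omega,
        hyI, hzI, hzI, ins_stay ?_ ?_, by simp, by simp, by grind,
        fun s _ => by omega, Or.inr ⟨nz, zb, rfl, zl, fun s hs => by have := hzn s hs; omega⟩⟩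
      · simp [ya]; omega
      · simp [yb]; omega
  · have hnn : ny ≤ n := by have := hyn n hn; omega
    have A : ∀ s ∈ S, s ≤ y ∨ ny ≤ s := fun s hs => by have := hyn s hs; omega
    rcases ins_cases hz with ⟨h, hzI⟩ | ⟨za, zb, hzI⟩ | ⟨nz, za, zb, zl, hzn, hzI⟩
    · refine ⟨ny, insert y (S.erase ny), insert z S, insert y ((insert z S).erase ny), [], hnn, yl,
        hyI, (ins_none ?_).congr ?_, hzI, ins_swap ?_ ?_ yl ?_, ?_, ?_, ?_, A, Or.inl ⟨rfl, h⟩⟩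
      all_goals grind
    · refine ⟨ny, insert y (S.erase ny), S, insert y (S.erase ny), [z + 1], hnn, yl,
        hyI, ins_stay ?_ ?_, hzI, hyI, ?_, ?_, ?_, A, Or.inr ⟨z + 1, zb, rfl, by omega, ?_⟩⟩
      all_goals grind
    · refine ⟨ny, insert y (S.erase ny), insert z (S.erase nz),
        insert y ((insert z (S.erase nz)).erase ny), [nz], hnn, yl,
        hyI, (ins_swap (b := nz) ?_ ?_ zl ?_).congr ?_, hzI, ins_swap ?_ ?_ yl ?_, ?_, ?_, ?_, A,
        Or.inr ⟨nz, zb, rfl, by omega, ?_⟩⟩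
      all_goals grind

lemma ckEquiv_of_eq {u v : List ℕ} (h : u = v) : CKEquiv u v := h ▸ CKEquiv.refl u

lemma ckTriple_right {x y z : ℕ} {S : Finset ℕ} (h1 : y < x) (h2 : x < z)
    (ha : AdmOn [x, y, z] S) (hb : AdmOn [x, z, y] S) :
    colOn [x, y, z] S = colOn [x, z, y] S ∧
      CKEquiv (bumpOn [x, y, z] S) (bumpOn [x, z, y] S) := by
  have hz : z ∈ S → z + 1 ∈ S := ha.2.2.1
  have hy : y ∈ S → y + 1 ∈ S := hb.2.2.1
  by_cases h : ∃ n ∈ S, y < n ∧ n < z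
  · obtain ⟨n, hn, hn1, hn2⟩ := h
    obtain ⟨ny, S1, S2, S12, lz, hny, yl, I1, I2, I3, I4, hz12, hny', hS12, hA, hlz⟩ :=
      ins_commute hn hn1 hn2 hy hz
    have hx : x ∈ S12 → x + 1 ∈ S12 := by
      have := ha.1
      simpa [colOn, I3.1, I4.1] using this
    have key : ∃ S3 bx, Ins x S12 S3 [bx] ∧ x < bx ∧ bx ∈ S12 ∧ bx ≤ z := by
      rcases ins_cases hx with ⟨h, -⟩ | ⟨xa, xb, hI⟩ | ⟨b, xa, xb, xl, hxn, hI⟩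
      · have := h z hz12; omega
      · exact ⟨_, _, hI, by omega, xb, by omega⟩
      · exact ⟨_, _, hI, xl, xb, by have := hxn z hz12; omega⟩
    obtain ⟨S3, bx, hI, hbx, hbS, hbz⟩ := key
    obtain ⟨e1, e2⟩ := ins_three I3 I4 hI
    obtain ⟨e3, e4⟩ := ins_three I1 I2 hI
    rw [e1, e2, e3, e4]
    refine ⟨rfl, ?_⟩
    rcases hlz with ⟨rfl, -⟩ | ⟨nz, -, rfl, hnz, -⟩
    · exact CKEquiv.refl _
    · refine ckEquiv_right ?_ (by omega) []
      grind
  · push Not at h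
    have hyS : y ∉ S := fun hh => by have := h _ (hy hh); omega
    by_cases hzS : z ∈ S
    · have e1 := ins_three (ins_stay hzS (hz hzS))
        (ins_swap (a := y) (b := z) hyS hzS (by omega) (by grind))
        (ins_swap (a := x) (b := z + 1) (by grind) (by grind) (by omega) (by grind))
      have e2 := ins_three (ins_swap (a := y) (b := z) hyS hzS (by omega) (by grind))
        (ins_swap (a := z) (b := z + 1) (by grind) (by grind) (by omega) (by grind))
        (ins_swap (a := x) (b := z) (by grind) (by grind) (by omega) (by grind))
      rw [e1.1, e1.2, e2.1, e2.2]
      exact ⟨by grind, (ckEquiv_braid z []).symm⟩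
    · rcases exists_next z S with hm | ⟨n, hn, hzn, hm⟩
      · have e1 := ins_three (ins_none hm)
          (ins_swap (a := y) (b := z) (by grind) (by grind) (by omega) (by grind))
          (ins_none (a := x) (by grind))
        have e2 := ins_three (ins_none (a := y) (S := S) (by grind))
          (ins_none (a := z) (by grind))
          (ins_swap (a := x) (b := z) (by grind) (by grind) (by omega) (by grind))
        rw [e1.1, e1.2, e2.1, e2.2]
        exact ⟨by grind, CKEquiv.refl _⟩
      · rcases exists_next n S with hk | ⟨m, hm', hnm, hk⟩
        · have e1 := ins_three (ins_swap hzS hn hzn hm)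
            (ins_swap (a := y) (b := z) (by grind) (by grind) (by omega) (by grind))
            (ins_none (a := x) (by grind))
          have e2 := ins_three (ins_swap (a := y) (b := n) hyS hn (by omega) (by grind))
            (ins_none (a := z) (by grind))
            (ins_swap (a := x) (b := z) (by grind) (by grind) (by omega) (by grind))
          rw [e1.1, e1.2, e2.1, e2.2]
          exact ⟨by grind, CKEquiv.refl _⟩
        · have e1 := ins_three (ins_swap hzS hn hzn hm)
            (ins_swap (a := y) (b := z) (by grind) (by grind) (by omega) (by grind))
            (ins_swap (a := x) (b := m) (by grind) (by grind) (by omega) (by grind))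
          have e2 := ins_three (ins_swap (a := y) (b := n) hyS hn (by omega) (by grind))
            (ins_swap (a := z) (b := m) (by grind) (by grind) (by omega) (by grind))
            (ins_swap (a := x) (b := z) (by grind) (by grind) (by omega) (by grind))
          rw [e1.1, e1.2, e2.1, e2.2]
          exact ⟨by grind, ckEquiv_left (by omega) (by omega) []⟩

lemma ckTriple_left {x y z : ℕ} {S : Finset ℕ} (h1 : y < z) (h2 : z < x)
    (ha : AdmOn [x, y, z] S) (hb : AdmOn [y, x, z] S) :
    colOn [x, y, z] S = colOn [y, x, z] S ∧
      CKEquiv (bumpOn [x, y, z] S) (bumpOn [y, x, z] S) := by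
  have hz : z ∈ S → z + 1 ∈ S := ha.2.2.1
  have hy : y ∈ sIns z S → y + 1 ∈ sIns z S := ha.2.1
  have hx : x ∈ sIns z S → x + 1 ∈ sIns z S := hb.2.1
  have key : ∃ S0 lz, Ins z S S0 lz ∧ z ∈ S0 ∧
      (lz = [] ∧ (∀ s ∈ S0, s ≤ z) ∨ ∃ nz, lz = [nz] ∧ z < nz ∧
        ∀ s ∈ S0, z < s → nz < s ∨ nz = z + 1) := by
    rcases ins_cases hz with ⟨h, hI⟩ | ⟨za, zb, hI⟩ | ⟨b, za, zb, zl, hzn, hI⟩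
    · exact ⟨_, _, hI, by grind, Or.inl ⟨rfl, by grind⟩⟩
    · exact ⟨_, _, hI, by grind, Or.inr ⟨_, rfl, by grind, by grind⟩⟩
    · exact ⟨_, _, hI, by grind, Or.inr ⟨_, rfl, by grind, by grind⟩⟩
  obtain ⟨S0, lz, I0, hz0, hlz⟩ := key
  rw [I0.1] at hy hx
  obtain ⟨ny, S1, S2, S12, lx, hny, yl, I1, I2, I3, I4, -, -, -, -, hlx⟩ :=
    ins_commute hz0 h1 h2 hy hx
  obtain ⟨e1, e2⟩ := ins_three I0 I1 I2
  obtain ⟨e3, e4⟩ := ins_three I0 I3 I4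
  rw [e1, e2, e3, e4]
  refine ⟨rfl, ?_⟩
  rcases hlz with ⟨rfl, hlz⟩ | ⟨nz, rfl, hnz, hlz⟩
  · rcases hlx with ⟨rfl, -⟩ | ⟨nx, hnx, rfl, hnx', -⟩
    · exact CKEquiv.refl _
    · have := hlz nx hnx
      omega
  · rcases hlx with ⟨rfl, -⟩ | ⟨nx, hnx, rfl, hnx', -⟩
    · exact CKEquiv.refl _
    · have := hlz nx hnx (by omega)
      exact ckEquiv_left (by omega) (by omega) []

lemma ckTriple_braid {i : ℕ} {S : Finset ℕ}
    (ha : AdmOn [i, i + 1, i] S) (hb : AdmOn [i + 1, i, i + 1] S) :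
    colOn [i, i + 1, i] S = colOn [i + 1, i, i + 1] S ∧
      CKEquiv (bumpOn [i, i + 1, i] S) (bumpOn [i + 1, i, i + 1] S) := by
  have hi : i ∈ S → i + 1 ∈ S := ha.2.2.1
  have hi' : i + 1 ∈ S → i + 2 ∈ S := hb.2.2.1
  by_cases h : i ∈ S
  · have h' := hi h
    have h'' := hi' h'
    obtain ⟨e1, e2⟩ := ins_three (ins_stay h h') (ins_stay h' h'') (ins_stay h h')
    obtain ⟨e3, e4⟩ := ins_three (ins_stay h' h'') (ins_stay h h') (ins_stay h' h'')
    rw [e1, e2, e3, e4]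
    exact ⟨rfl, ckEquiv_braid _ _⟩
  · by_cases h' : i + 1 ∈ S
    · have h'' := hi' h'
      have I := ins_swap (a := i) (b := i + 1) h h' (by omega) (by grind)
      obtain ⟨e1, e2⟩ := ins_three I
        (ins_swap (a := i + 1) (b := i + 2) (by grind) (by grind) (by omega) (by grind))
        (ins_stay (a := i) (by grind) (by grind))
      obtain ⟨e3, e4⟩ := ins_three (ins_stay h' h'') I
        (ins_swap (a := i + 1) (b := i + 2) (by grind) (by grind) (by omega) (by grind))
      rw [e1, e2, e3, e4]
      exact ⟨rfl, ckEquiv_braid _ _⟩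
    · rcases exists_next i S with hm | ⟨n, hn, hzn, hm⟩
      · obtain ⟨e1, e2⟩ := ins_three (ins_none hm) (ins_none (a := i + 1) (by grind))
          (ins_stay (a := i) (by grind) (by grind))
        obtain ⟨e3, e4⟩ := ins_three (ins_none (a := i + 1) (S := S) (by grind))
          (ins_swap (a := i) (b := i + 1) (by grind) (by grind) (by omega) (by grind))
          (ins_none (a := i + 1) (by grind))
        rw [e1, e2, e3, e4]
        exact ⟨by grind, CKEquiv.refl _⟩
      · have hne : n ≠ i + 1 := by grind
        rcases exists_next n S with hk | ⟨m, hm', hnm, hk⟩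
        · obtain ⟨e1, e2⟩ := ins_three (ins_swap h hn hzn hm) (ins_none (a := i + 1) (by grind))
            (ins_stay (a := i) (by grind) (by grind))
          obtain ⟨e3, e4⟩ := ins_three (ins_swap (a := i + 1) h' hn (by omega) (by grind))
            (ins_swap (a := i) (b := i + 1) (by grind) (by grind) (by omega) (by grind))
            (ins_none (a := i + 1) (by grind))
          rw [e1, e2, e3, e4]
          exact ⟨by grind, CKEquiv.refl _⟩
        · obtain ⟨e1, e2⟩ := ins_three (ins_swap h hn hzn hm)
            (ins_swap (a := i + 1) (b := m) (by grind) (by grind) (by omega) (by grind))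
            (ins_stay (a := i) (by grind) (by grind))
          obtain ⟨e3, e4⟩ := ins_three (ins_swap (a := i + 1) h' hn (by omega) (by grind))
            (ins_swap (a := i) (b := i + 1) (by grind) (by grind) (by omega) (by grind))
            (ins_swap (a := i + 1) (b := m) (by grind) (by grind) (by omega) (by grind))
          rw [e1, e2, e3, e4]
          exact ⟨by grind, (ckEquiv_left (by omega) (by omega) []).symm⟩

/-- The elements of a finite set in decreasing order. -/
def dec (S : Finset ℕ) : List ℕ := S.sort (· ≥ ·)

lemma mem_dec {S : Finset ℕ} {x : ℕ} : x ∈ dec S ↔ x ∈ S := Finset.mem_sort _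

lemma dec_pairwise (S : Finset ℕ) : (dec S).Pairwise (· > ·) :=
  (Finset.sortedGT_sort S).pairwise

lemma dec_length (S : Finset ℕ) : (dec S).length = S.card := Finset.length_sort _

lemma dec_eq {S : Finset ℕ} {l : List ℕ} (hl : l.Pairwise (· > ·)) (h : ∀ x, x ∈ l ↔ x ∈ S) :
    dec S = l := by
  have hp : (dec S).Perm l :=
    (List.perm_ext_iff_of_nodup ((dec_pairwise S).imp (fun h => by omega))
      (hl.imp (fun h => by omega))).2 fun x => by rw [mem_dec, h]
  exact hp.eq_of_pairwise (fun a b _ _ h h' => by omega) (dec_pairwise S) hl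

lemma dec_split (S : Finset ℕ) {b : ℕ} (hb : b ∈ S) :
    dec S = dec (S.filter (b < ·)) ++ b :: dec (S.filter (· < b)) := by
  apply dec_eq
  · simp only [List.pairwise_append, List.pairwise_cons, dec_pairwise, mem_dec,
      Finset.mem_filter, List.mem_cons, true_and, and_true]
    grind
  · intro x
    simp only [List.mem_append, List.mem_cons, mem_dec, Finset.mem_filter]
    grind

lemma dec_insert_of_lt {S : Finset ℕ} {a : ℕ} (h : ∀ s ∈ S, s < a) :
    dec (insert a S) = a :: dec S := by
  apply dec_eq
  · simpa [dec_pairwise, mem_dec] using h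
  · simp [mem_dec]

lemma ckEquiv_pass_left {a b : ℕ} {P Q : List ℕ} (h : (P ++ b :: Q).Pairwise (· > ·))
    (hab : a < b) : CKEquiv (a :: (P ++ b :: Q)) (P ++ a :: b :: Q) := by
  induction P with
  | nil => exact CKEquiv.refl _
  | cons p P ih =>
    have h' := List.pairwise_cons.1 h
    refine CKEquiv.trans ?_ ((ih h'.2).cons p)
    cases P with
    | nil => exact (ckEquiv_left hab (h'.1 b (by simp)) Q).symm
    | cons n P =>
      have h1 := List.pairwise_cons.1 h'.2
      have h2 := h1.1 b (by simp)
      have h3 := h'.1 n (by simp)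
      exact (ckEquiv_left (by omega) (by omega) _).symm

lemma ckEquiv_pass_right {a b : ℕ} {Q : List ℕ} (h : (a :: Q).Pairwise (· > ·))
    (hab : a < b) : CKEquiv (a :: b :: Q) (a :: (Q ++ [b])) := by
  induction Q generalizing a with
  | nil => exact CKEquiv.refl _
  | cons q Q ih =>
    have h' := List.pairwise_cons.1 h
    have hq := h'.1 q (by simp)
    exact (ckEquiv_right hq hab Q).symm.trans ((ih h'.2 (by omega)).cons a)

lemma ckEquiv_ins {a : ℕ} {S : Finset ℕ} (hv : a ∈ S → a + 1 ∈ S) :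
    CKEquiv (a :: dec S) (dec (sIns a S) ++ bump a S) := by
  rcases ins_cases hv with ⟨h, hI⟩ | ⟨ya, yb, hI⟩ | ⟨b, ha, hb, hab, h, hI⟩
  · rw [hI.1, hI.2, dec_insert_of_lt h]
    exact ckEquiv_of_eq (by simp)
  · rw [hI.1, hI.2]
    have e1 : S.filter (a < ·) = insert (a + 1) (S.filter (a + 1 < ·)) := by grind
    have e2 : dec (S.filter (· < a + 1)) = a :: dec (S.filter (· < a)) := by
      rw [← dec_insert_of_lt (by simp)]
      congr 1
      grind
    have e3 := dec_split S yb
    rw [e2] at e3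
    have hp := dec_pairwise S
    have hd := dec_pairwise (insert a (S.filter (· < a)))
    rw [dec_insert_of_lt (by simp)] at hd
    rw [e3] at hp ⊢
    refine (ckEquiv_pass_left hp (by omega)).trans ?_
    have h4 := (ckEquiv_braid a (dec (S.filter (· < a)))).trans
      ((ckEquiv_pass_right hd (b := a + 1) (by omega)).cons (a + 1))
    simpa using h4.append_left (dec (S.filter (a + 1 < ·)))
  · rw [hI.1, hI.2]
    have e1 := dec_split S hb
    have e2 := dec_split (insert a (S.erase b)) (b := a) (by simp)
    have e3 : (insert a (S.erase b)).filter (a < ·) = S.filter (b < ·) := by grind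
    have e4 : (insert a (S.erase b)).filter (· < a) = S.filter (· < b) := by grind
    rw [e3, e4] at e2
    have hp := dec_pairwise S
    have hd := dec_pairwise (insert a (S.erase b))
    rw [e2] at hd ⊢
    rw [e1] at hp ⊢
    refine (ckEquiv_pass_left hp hab).trans ?_
    have h4 := ckEquiv_pass_right (b := b) (List.pairwise_append.1 hd).2.1 hab
    simpa using h4.append_left (dec (S.filter (b < ·)))

/-- The first column of a word. -/
def col (ρ : List ℕ) : Finset ℕ := colOn ρ ∅

/-- The word bumped out of the first column. -/
def rest (ρ : List ℕ) : List ℕ := bumpOn ρ ∅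

/-- Admissibility of a word inserted into the empty column. -/
def Adm (ρ : List ℕ) : Prop := AdmOn ρ ∅

@[simp] lemma col_nil : col [] = ∅ := rfl
@[simp] lemma rest_nil : rest [] = [] := rfl

lemma col_cons (a : ℕ) (ρ : List ℕ) : col (a :: ρ) = sIns a (col ρ) := rfl

lemma rest_cons (a : ℕ) (ρ : List ℕ) : rest (a :: ρ) = bump a (col ρ) ++ rest ρ := rfl

lemma adm_cons {a : ℕ} {ρ : List ℕ} :
    Adm (a :: ρ) ↔ (a ∈ col ρ → a + 1 ∈ col ρ) ∧ Adm ρ := Iff.rfl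

lemma col_append (u v : List ℕ) : col (u ++ v) = colOn u (col v) := colOn_append u v ∅

lemma rest_append (u v : List ℕ) : rest (u ++ v) = bumpOn u (col v) ++ rest v :=
  bumpOn_append u v ∅

lemma adm_append {u v : List ℕ} : Adm (u ++ v) ↔ AdmOn u (col v) ∧ Adm v := admOn_append u v ∅

lemma Adm.ckEquiv {ρ : List ℕ} (h : Adm ρ) : CKEquiv ρ (dec (col ρ) ++ rest ρ) := by
  induction ρ with
  | nil => exact ckEquiv_of_eq (by simp [dec])
  | cons a ρ ih =>
    have h' := adm_cons.1 h
    refine ((ih h'.2).cons a).trans ?_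
    have := (ckEquiv_ins h'.1).append_right (rest ρ)
    simpa [col_cons, rest_cons] using this

/-- A decreasing word containing `a` but not `a + 1` cannot be preceded by `a`. -/
lemma mem_succ_of_isReducedWord {a : ℕ} {S : Finset ℕ} {r : List ℕ}
    (h : IsReducedWord (a :: (dec S ++ r))) (ha : a ∈ S) : a + 1 ∈ S := by
  by_contra hn
  rw [dec_split S ha] at h
  have h' : IsReducedWord ((a :: dec (S.filter (a < ·)) ++ [a]) ++
      (dec (S.filter (· < a)) ++ r)) := by simpa using h
  refine not_isReducedWord_of_comm ?_ h'.left
  intro x hx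
  simp only [mem_dec, Finset.mem_filter] at hx
  have : x ≠ a + 1 := fun e => hn (e ▸ hx.1)
  omega

lemma IsReducedWord.adm {ρ : List ℕ} (h : IsReducedWord ρ) : Adm ρ := by
  induction ρ with
  | nil => trivial
  | cons a ρ ih =>
    have ih' := ih h.tail
    refine adm_cons.2 ⟨fun ha => ?_, ih'⟩
    exact mem_succ_of_isReducedWord ((ih'.ckEquiv.cons a).isReducedWord_iff.1 h) ha

lemma IsReducedWord.ckEquiv {ρ : List ℕ} (h : IsReducedWord ρ) :
    CKEquiv ρ (dec (col ρ) ++ rest ρ) := h.adm.ckEquiv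

lemma IsReducedWord.rest {ρ : List ℕ} (h : IsReducedWord ρ) : IsReducedWord (rest ρ) :=
  (h.ckEquiv.isReducedWord_iff.1 h).right

lemma length_col_add_rest {ρ : List ℕ} (h : Adm ρ) :
    (col ρ).card + (rest ρ).length = ρ.length := by
  rw [h.ckEquiv.length_eq, List.length_append, dec_length]

lemma CKStep.col_rest {u v : List ℕ} (h : CKStep u v) (hu : Adm u) (hv : Adm v) :
    col u = col v ∧ CKEquiv (rest u) (rest v) := by
  have key : ∀ (a b m m' : List ℕ), Adm (a ++ m ++ b) → Adm (a ++ m' ++ b) →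
      (AdmOn m (col b) → AdmOn m' (col b) → colOn m (col b) = colOn m' (col b) ∧
        CKEquiv (bumpOn m (col b)) (bumpOn m' (col b))) →
      col (a ++ m ++ b) = col (a ++ m' ++ b) ∧
        CKEquiv (rest (a ++ m ++ b)) (rest (a ++ m' ++ b)) := by
    intro a b m m' h1 h2 h3
    rw [List.append_assoc, adm_append, adm_append] at h1 h2
    obtain ⟨h4, h5⟩ := h3 h1.2.1 h2.2.1
    simp only [List.append_assoc, col_append, rest_append, h4, true_and]
    exact (h5.append_right _).append_left _
  rcases h with ⟨a, b, x, y, z, h1, h2, rfl, rfl⟩ | ⟨a, b, x, y, z, h1, h2, rfl, rfl⟩ |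
    ⟨a, b, i, rfl, rfl⟩
  · exact key a b _ _ hu hv (ckTriple_right h1 h2)
  · exact key a b _ _ hu hv (ckTriple_left h1 h2)
  · exact key a b _ _ hu hv ckTriple_braid

/-- The first column is a Coxeter–Knuth invariant, and so is the class of the bumped word. -/
lemma CKEquiv.col_rest {u v : List ℕ} (h : CKEquiv u v) (hu : IsReducedWord u) :
    col u = col v ∧ CKEquiv (rest u) (rest v) := by
  induction h with
  | rel _ _ h => exact h.col_rest hu.adm (h.isReducedWord_iff.1 hu).adm
  | refl => exact ⟨rfl, CKEquiv.refl _⟩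
  | symm _ _ h ih =>
    have := ih ((CKEquiv.isReducedWord_iff h).2 hu)
    exact ⟨this.1.symm, this.2.symm⟩
  | trans _ _ _ h _ ih ih' =>
    have h1 := ih hu
    have h2 := ih' ((CKEquiv.isReducedWord_iff h).1 hu)
    exact ⟨h1.1.trans h2.1, h1.2.trans h2.2⟩

/-! ### Counting functions of finite sets and matchings of columns -/

/-- The number of elements smaller than `t`. -/
def cnt (S : Finset ℕ) (t : ℕ) : ℕ := (S.filter (· < t)).card

@[simp] lemma cnt_zero (S : Finset ℕ) : cnt S 0 = 0 := by simp [cnt]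

lemma cnt_succ (S : Finset ℕ) (t : ℕ) : cnt S (t + 1) = cnt S t + if t ∈ S then 1 else 0 := by
  unfold cnt
  split_ifs with h
  · rw [← Finset.card_insert_of_notMem (a := t) (by simp)]
    congr 1
    grind
  · congr 1
    grind

lemma cnt_succ_of_mem {S : Finset ℕ} {t : ℕ} (h : t ∈ S) : cnt S (t + 1) = cnt S t + 1 := by
  simp [cnt_succ, h]

lemma cnt_succ_of_notMem {S : Finset ℕ} {t : ℕ} (h : t ∉ S) : cnt S (t + 1) = cnt S t := by
  simp [cnt_succ, h]

lemma cnt_diff_le {A B : Finset ℕ} {s t : ℕ} (hst : s ≤ t)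
    (h : ∀ k, s ≤ k → k < t → k ∈ A → k ∈ B) : cnt A t + cnt B s ≤ cnt B t + cnt A s := by
  induction t, hst using Nat.le_induction with
  | base => omega
  | succ t hst ih =>
    have := ih fun k h1 h2 => h k h1 (by omega)
    rw [cnt_succ, cnt_succ]
    have := h t hst (by omega)
    split_ifs <;> first | omega | tauto

lemma cnt_diff_eq {A B : Finset ℕ} {s t : ℕ} (hst : s ≤ t)
    (h : ∀ k, s ≤ k → k < t → (k ∈ A ↔ k ∈ B)) : cnt A t + cnt B s = cnt B t + cnt A s :=
  le_antisymm (cnt_diff_le hst fun k h1 h2 => (h k h1 h2).1)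
    (cnt_diff_le hst fun k h1 h2 => (h k h1 h2).2)

lemma cnt_mono (S : Finset ℕ) {s t : ℕ} (h : s ≤ t) : cnt S s ≤ cnt S t := by
  have := cnt_diff_le (A := ∅) (B := S) h (by simp)
  simpa [cnt] using this

lemma cnt_le_of_subset {A B : Finset ℕ} (h : A ⊆ B) (t : ℕ) : cnt A t ≤ cnt B t := by
  simpa using cnt_diff_le (A := A) (B := B) (Nat.zero_le t) fun k _ _ hk => h hk

lemma cnt_le_card (S : Finset ℕ) (t : ℕ) : cnt S t ≤ S.card :=
  Finset.card_le_card (Finset.filter_subset _ _)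

lemma cnt_eq_card {S : Finset ℕ} {t : ℕ} (h : ∀ s ∈ S, s < t) : cnt S t = S.card := by
  rw [cnt, Finset.filter_true_of_mem h]

lemma exists_bound (S : Finset ℕ) : ∃ n, ∀ s ∈ S, s < n :=
  ⟨S.sup id + 1, fun _ hs => Nat.lt_succ_of_le (Finset.le_sup (f := id) hs)⟩

lemma cnt_insert {S : Finset ℕ} {a : ℕ} (h : a ∉ S) (t : ℕ) :
    cnt (insert a S) t = cnt S t + if a < t then 1 else 0 := by
  induction t with
  | zero => simp
  | succ t ih =>
    rw [cnt_succ, cnt_succ, ih]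
    grind

lemma cnt_erase {S : Finset ℕ} {a : ℕ} (h : a ∈ S) (t : ℕ) :
    cnt S t = cnt (S.erase a) t + if a < t then 1 else 0 := by
  conv_lhs => rw [← Finset.insert_erase h]
  exact cnt_insert (by simp) t

lemma exists_insert_of_card {S T : Finset ℕ} (h : S ⊆ T) (hc : T.card = S.card + 1) :
    ∃ m, m ∉ S ∧ T = insert m S := by
  have h1 : (T \ S).card = 1 := by rw [Finset.card_sdiff_of_subset h]; omega
  obtain ⟨m, hm⟩ := Finset.card_eq_one.1 h1
  have : m ∈ T \ S := by simp [hm]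
  refine ⟨m, (Finset.mem_sdiff.1 this).2, ?_⟩
  ext s
  have := Finset.ext_iff.1 hm s
  simp only [Finset.mem_sdiff, Finset.mem_singleton] at this
  have := @h s
  grind

/-- `Dom C A`: every element of `A` can be matched with a smaller element of `C`. -/
def Dom (C A : Finset ℕ) : Prop := ∀ t, cnt A (t + 1) ≤ cnt C t

open Classical in
/-- The elements of `C` that are matched with larger elements of `A`. -/
noncomputable def matched (C A : Finset ℕ) : Finset ℕ :=
  C.filter fun c => ∃ t, c < t ∧ cnt C t + cnt A (c + 1) < cnt A (t + 1) + cnt C (c + 1)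

lemma mem_matched {C A : Finset ℕ} {c : ℕ} : c ∈ matched C A ↔
    c ∈ C ∧ ∃ t, c < t ∧ cnt C t + cnt A (c + 1) < cnt A (t + 1) + cnt C (c + 1) := by
  simp [matched]

lemma matched_subset (C A : Finset ℕ) : matched C A ⊆ C := fun _ h => (mem_matched.1 h).1

lemma matched_mono {C A B : Finset ℕ} (h : A ⊆ B) : matched C A ⊆ matched C B := by
  intro c hc
  obtain ⟨h1, t, h2, h3⟩ := mem_matched.1 hc
  refine mem_matched.2 ⟨h1, t, h2, ?_⟩
  have := cnt_diff_le (A := A) (B := B) (s := c + 1) (t := t + 1) (by omega) fun k _ _ hk => h hk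
  omega

lemma Dom.subset {C A B : Finset ℕ} (h : Dom C A) (hB : B ⊆ A) : Dom C B := fun t =>
  (cnt_le_of_subset hB _).trans (h t)

lemma Dom.superset {C C' A : Finset ℕ} (h : Dom C A) (hB : C ⊆ C') : Dom C' A := fun t =>
  (h t).trans (cnt_le_of_subset hB _)

lemma Dom.card_le {C A : Finset ℕ} (h : Dom C A) : A.card ≤ C.card := by
  obtain ⟨n, hn⟩ := exists_bound A
  have := h n
  rw [cnt_eq_card fun s hs => (hn s hs).trans (by omega)] at this
  exact this.trans (cnt_le_card _ _)

/-- The counting function of the set of matched elements. -/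
lemma Dom.cnt_matched {C A : Finset ℕ} (h : Dom C A) (s : ℕ) :
    (∀ t, s ≤ t → cnt A (t + 1) + cnt C s ≤ cnt (matched C A) s + cnt C t) ∧
    ∃ t, s ≤ t ∧ cnt A (t + 1) + cnt C s = cnt (matched C A) s + cnt C t := by
  induction s with
  | zero =>
    refine ⟨fun t _ => by simpa using h t, 0, le_rfl, ?_⟩
    have := h 0
    simp at this ⊢
    exact this
  | succ s ih =>
    obtain ⟨ih1, t0, ih2, ih3⟩ := ih
    have h0 := ih1 s le_rfl
    by_cases hs : s ∈ C
    · have e1 := cnt_succ_of_mem hs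
      by_cases hm : s ∈ matched C A
      · have e2 := cnt_succ_of_mem hm
        obtain ⟨-, t1, h2, h3⟩ := mem_matched.1 hm
        refine ⟨fun t ht => ?_, ?_⟩
        · have := ih1 t (by omega)
          omega
        · have := ih1 t1 (by omega)
          rcases eq_or_ne t0 s with rfl | hne
          · exact ⟨t1, by omega, by omega⟩
          · exact ⟨t0, by omega, by omega⟩
      · have e2 := cnt_succ_of_notMem hm
        have h1 : ∀ t, s < t → cnt A (t + 1) + cnt C (s + 1) ≤ cnt C t + cnt A (s + 1) := by
          intro t ht
          by_contra hc
          exact hm (mem_matched.2 ⟨hs, t, ht, by omega⟩)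
        have e3 : cnt A (s + 1) = cnt (matched C A) s := by
          rcases eq_or_ne t0 s with rfl | hne
          · omega
          · have := h1 t0 (by omega)
            omega
        refine ⟨fun t ht => by have := h1 t (by omega); omega, s + 1, le_rfl, ?_⟩
        have := h1 (s + 1) (by omega)
        have := cnt_mono A (show s + 1 ≤ s + 1 + 1 by omega)
        omega
    · have hm : s ∉ matched C A := fun hh => hs (matched_subset _ _ hh)
      rw [cnt_succ_of_notMem hs, cnt_succ_of_notMem hm]
      refine ⟨fun t ht => ih1 t (by omega), ?_⟩
      rcases eq_or_ne t0 s with rfl | hne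
      · refine ⟨t0 + 1, le_rfl, ?_⟩
        have := ih1 (t0 + 1) (by omega)
        have := cnt_mono A (show t0 + 1 ≤ t0 + 1 + 1 by omega)
        have := cnt_succ_of_notMem hs
        omega
      · exact ⟨t0, by omega, by omega⟩

lemma Dom.card_matched {C A : Finset ℕ} (h : Dom C A) : (matched C A).card = A.card := by
  obtain ⟨n, hn⟩ := exists_bound (C ∪ A)
  have hC : ∀ t, n ≤ t → cnt C t = C.card := fun t ht =>
    cnt_eq_card fun s hs => lt_of_lt_of_le (hn s (by simp [hs])) ht
  have hA : ∀ t, n ≤ t → cnt A t = A.card := fun t ht =>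
    cnt_eq_card fun s hs => lt_of_lt_of_le (hn s (by simp [hs])) ht
  have hM : cnt (matched C A) n = (matched C A).card :=
    cnt_eq_card fun s hs => hn s (by simp [matched_subset _ _ hs])
  obtain ⟨-, t, h1, h2⟩ := h.cnt_matched n
  rw [hC n le_rfl, hC t h1, hA _ (by omega), hM] at h2
  omega

lemma Dom.matched_insert {C A : Finset ℕ} {r : ℕ} (hr : r ∉ A) (h : Dom C (insert r A)) :
    ∃ m, m ∉ matched C A ∧ matched C (insert r A) = insert m (matched C A) := by
  apply exists_insert_of_card (matched_mono (Finset.subset_insert _ _))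
  rw [h.card_matched, (h.subset (Finset.subset_insert _ _)).card_matched,
    Finset.card_insert_of_notMem hr]

/-- A new matched element is smaller than those matched elements whose partners exceed the
new letter. -/
lemma lt_of_matched_insert {C A B : Finset ℕ} {r m : ℕ} (hr : r ∉ A)
    (hB : B ⊆ A) (hlt : ∀ a ∈ A, a ∉ B → r < a) (hm : m ∉ matched C A)
    (e : matched C (insert r A) = insert m (matched C A)) {c : ℕ} (hc : c ∈ matched C A)
    (hcB : c ∉ matched C B) : m < c := by
  by_contra hmc
  have hne : m ≠ c := fun e => hm (e ▸ hc)
  have hcm : c < m := by omega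
  have hmi : m ∈ matched C (insert r A) := by simp [e]
  obtain ⟨hmC, t', ht', h1⟩ := mem_matched.1 hmi
  obtain ⟨hcC, t, ht, h2⟩ := mem_matched.1 hc
  have h3 : ∀ u, m < u → cnt A (u + 1) + cnt C (m + 1) ≤ cnt C u + cnt A (m + 1) := by
    intro u hu
    by_contra hh
    exact hm (mem_matched.2 ⟨hmC, u, hu, by omega⟩)
  have h4 : ∀ u, c < u → cnt B (u + 1) + cnt C (c + 1) ≤ cnt C u + cnt B (c + 1) := by
    intro u hu
    by_contra hh
    exact hcB (mem_matched.2 ⟨hcC, u, hu, by omega⟩)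
  rw [cnt_insert hr, cnt_insert hr] at h1
  have h5 := h3 t' ht'
  have hmr : m < r := by
    by_contra hh
    rw [if_pos (by omega), if_pos (by omega)] at h1
    omega
  have hAB : ∀ s t, s ≤ t → t ≤ r + 1 → cnt A t + cnt B s = cnt B t + cnt A s := by
    intro s t hs ht
    refine cnt_diff_eq hs fun k hk1 hk2 => ⟨fun hk => ?_, fun hk => hB hk⟩
    by_contra hkB
    have := hlt k hk hkB
    omega
  have e1 := cnt_succ_of_mem hmC
  have h6 := hAB (c + 1) (m + 1) (by omega) (by omega)
  have h7 := h4 m hcm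
  by_cases htm : t ≤ m
  · have h8 := hAB (c + 1) (t + 1) (by omega) (by omega)
    have h9 := h4 t ht
    omega
  · have h8 := h3 t (by omega)
    omega

/-- Removing an element from the larger column replaces at most one matched element. -/
lemma matched_erase {E B : Finset ℕ} {x : ℕ} (hx : x ∈ E) (h : Dom (E.erase x) B) :
    (x ∉ matched E B ∧ matched (E.erase x) B = matched E B) ∨
    (x ∈ matched E B ∧ ∃ w, w ∈ E ∧ w ∉ matched E B ∧ w < x ∧
      matched (E.erase x) B = insert w ((matched E B).erase x) ∧
      ∀ e ∈ E, w < e → e < x → e ∈ matched E B) := by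
  have hE : Dom E B := h.superset (Finset.erase_subset _ _)
  have hsub : (matched E B).erase x ⊆ matched (E.erase x) B := by
    intro c hc
    obtain ⟨hcx, hc⟩ := Finset.mem_erase.1 hc
    obtain ⟨h1, t, h2, h3⟩ := mem_matched.1 hc
    refine mem_matched.2 ⟨by simp [hcx, h1], t, h2, ?_⟩
    have := cnt_diff_le (A := E.erase x) (B := E) (s := c + 1) (t := t) (by omega)
      fun k _ _ hk => Finset.mem_of_mem_erase hk
    omega
  have hcard := h.card_matched.trans hE.card_matched.symm
  by_cases hxF : x ∈ matched E B
  · right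
    have hc1 := Finset.card_erase_of_mem hxF
    have hc2 := Finset.card_pos.2 ⟨x, hxF⟩
    obtain ⟨w, hw, e⟩ := exists_insert_of_card hsub (by omega)
    have hwF' : w ∈ matched (E.erase x) B := by simp [e]
    obtain ⟨hwE, t, h2, h3⟩ := mem_matched.1 hwF'
    obtain ⟨hwx, hwE'⟩ := Finset.mem_erase.1 hwE
    have hwF : w ∉ matched E B := fun hh => hw (by simp [hwx, hh])
    have hnF : ∀ c ∈ E, c ∉ matched E B → ∀ u, c < u →
        cnt B (u + 1) + cnt E (c + 1) ≤ cnt E u + cnt B (c + 1) := by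
      intro c hcE hc u hu
      by_contra hh
      exact hc (mem_matched.2 ⟨hcE, u, hu, by omega⟩)
    have h4 := hnF w hwE' hwF t h2
    have h5 := cnt_erase hx t
    have h6 := cnt_erase hx (w + 1)
    have hxt : w < x ∧ x < t := by
      constructor <;> by_contra hh <;> split_ifs at h5 h6 <;> omega
    refine ⟨hxF, w, hwE', hwF, hxt.1, e, fun c hc hwc hcx => ?_⟩
    by_contra hcF
    have hcF' : c ∉ matched (E.erase x) B := by
      rw [e]
      simp only [Finset.mem_insert, Finset.mem_erase]
      rintro (rfl | hh)
      · omega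
      · exact hcF hh.2
    have h7 : cnt B (t + 1) + cnt (E.erase x) (c + 1) ≤ cnt (E.erase x) t + cnt B (c + 1) := by
      by_contra hh
      exact hcF' (mem_matched.2 ⟨by simp [hc]; omega, t, by omega, by omega⟩)
    have h8 := hnF w hwE' hwF c hwc
    have h9 := cnt_erase hx (c + 1)
    have h10 := cnt_succ_of_mem hc
    split_ifs at h6 h9 <;> omega
  · left
    rw [Finset.erase_eq_of_notMem hxF] at hsub
    exact ⟨hxF, (Finset.eq_of_subset_of_card_le hsub (by omega)).symm⟩

/-- Inserting `y` in the smaller column and moving one element down in the larger column does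
not change the set of matched elements. -/
lemma matched_exchange {C E F F' : Finset ℕ} {x y : ℕ} (hFE : F ⊆ E)
    (hF : (x ∉ F ∧ F' = F) ∨ (x ∈ F ∧ ∃ w, w ∈ E ∧ w ∉ F ∧ w < x ∧ F' = insert w (F.erase x) ∧
      ∀ e ∈ E, w < e → e < x → e ∈ F))
    (hy : y ∉ C) (hxy : x ≤ y)
    (H1 : ∀ t, y < t → cnt E (t + 1) + cnt C (y + 1) ≤ cnt C t + cnt E (y + 1))
    (H2 : ∀ t, t < x → cnt E (t + 1) ≤ cnt C t) (H3 : cnt E x = cnt C x) :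
    matched (insert y C) F' = matched C F := by
  have hFF : ∀ s t, x < s → s ≤ t → cnt F' t + cnt F s = cnt F t + cnt F' s := by
    intro s t h1 h2
    refine cnt_diff_eq h2 fun k hk1 hk2 => ?_
    rcases hF with ⟨-, rfl⟩ | ⟨-, w, -, -, hw, rfl, -⟩
    · rfl
    · simp only [Finset.mem_insert, Finset.mem_erase]
      constructor
      · rintro (h | h)
        · omega
        · exact h.2
      · exact fun h => Or.inr ⟨by omega, h⟩
  have hH : ∀ t, y < t → cnt F (t + 1) + cnt C (y + 1) ≤ cnt C t + cnt F (y + 1) := by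
    intro t ht
    have h1 := H1 t ht
    have h2 := cnt_diff_le (A := F) (B := E) (s := y + 1) (t := t + 1) (by omega)
      fun k _ _ hk => hFE hk
    omega
  have hCy := cnt_succ_of_notMem hy
  have hyF' : y ∉ matched (insert y C) F' := by
    intro hh
    obtain ⟨-, t, ht, h⟩ := mem_matched.1 hh
    rw [cnt_insert hy, cnt_insert hy, if_pos (by omega), if_pos (by omega)] at h
    have h1 := hFF (y + 1) (t + 1) (by omega) (by omega)
    have h2 := hH t ht
    omega
  have hbelow : ∀ c, c < y → c ∈ C → (c ∈ matched C F ↔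
      ∃ t, c < t ∧ t ≤ y ∧ cnt C t + cnt F (c + 1) < cnt F (t + 1) + cnt C (c + 1)) := by
    intro c hcy hcC
    constructor
    · intro hh
      obtain ⟨-, t, ht, h⟩ := mem_matched.1 hh
      by_cases hty : t ≤ y
      · exact ⟨t, ht, hty, h⟩
      · have := hH t (by omega)
        exact ⟨y, hcy, le_rfl, by omega⟩
    · rintro ⟨t, ht, -, h⟩
      exact mem_matched.2 ⟨hcC, t, ht, h⟩
  have hbelow' : ∀ c, c < y → c ∈ C → (c ∈ matched (insert y C) F' ↔
      ∃ t, c < t ∧ t ≤ y ∧ cnt C t + cnt F' (c + 1) < cnt F' (t + 1) + cnt C (c + 1)) := by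
    intro c hcy hcC
    constructor
    · intro hh
      obtain ⟨-, t, ht, h⟩ := mem_matched.1 hh
      rw [cnt_insert hy, cnt_insert hy, if_neg (by omega : ¬ y < c + 1)] at h
      by_cases hty : t ≤ y
      · rw [if_neg (by omega)] at h
        exact ⟨t, ht, hty, by omega⟩
      · rw [if_pos (by omega)] at h
        have h1 := hH t (by omega)
        have h2 := hFF (y + 1) (t + 1) (by omega) (by omega)
        exact ⟨y, hcy, le_rfl, by omega⟩
    · rintro ⟨t, ht, hty, h⟩
      refine mem_matched.2 ⟨by simp [hcC], t, ht, ?_⟩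
      rw [cnt_insert hy, cnt_insert hy, if_neg (by omega), if_neg (by omega)]
      omega
  ext c
  by_cases hcC : c ∈ C
  swap
  · have h1 : c ∉ matched C F := fun hh => hcC (matched_subset _ _ hh)
    refine ⟨fun hh => ?_, fun hh => absurd hh h1⟩
    rcases Finset.mem_insert.1 (matched_subset _ _ hh) with rfl | hh'
    · exact absurd hh hyF'
    · exact absurd hh' hcC
  have hne : c ≠ y := fun e => hy (e ▸ hcC)
  rcases lt_or_gt_of_ne hne with hcy | hcy
  swap
  · have : ∀ t, c < t → (cnt (insert y C) t + cnt F' (c + 1) < cnt F' (t + 1) +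
        cnt (insert y C) (c + 1) ↔ cnt C t + cnt F (c + 1) < cnt F (t + 1) + cnt C (c + 1)) := by
      intro t ht
      rw [cnt_insert hy, cnt_insert hy, if_pos (by omega), if_pos (by omega)]
      have := hFF (c + 1) (t + 1) (by omega) (by omega)
      omega
    rw [mem_matched, mem_matched]
    constructor
    · rintro ⟨-, t, ht, h⟩
      exact ⟨hcC, t, ht, (this t ht).1 h⟩
    · rintro ⟨-, t, ht, h⟩
      exact ⟨by simp [hcC], t, ht, (this t ht).2 h⟩
  rw [hbelow c hcy hcC, hbelow' c hcy hcC]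
  rcases hF with ⟨hxF, rfl⟩ | ⟨hxF, w, hwE, hwF, hwx, e, hwF2⟩
  · rfl
  have hw' : w ∉ F.erase x := fun hh => hwF (Finset.mem_of_mem_erase hh)
  have hF'c : ∀ t, (cnt F' t = cnt F t ∧ (t ≤ w ∨ x < t)) ∨
      (cnt F' t = cnt F t + 1 ∧ w < t ∧ t ≤ x) := by
    intro t
    have h1 := cnt_insert hw' t
    have h2 := cnt_erase hxF t
    rw [← e] at h1
    split_ifs at h1 h2 <;> omega
  have hFEc : ∀ t, w < t → t ≤ x → cnt F x + cnt E t = cnt E x + cnt F t := by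
    intro t h1 h2
    exact cnt_diff_eq h2 fun k hk1 hk2 => ⟨fun h => hFE h, fun h => hwF2 k h (by omega) hk2⟩
  have hx1 := cnt_succ_of_mem hxF
  rcases le_or_gt x c with hxc | hxc
  · have h1 := hF'c (c + 1)
    constructor <;>
      · rintro ⟨t, ht1, ht2, ht3⟩
        have h2 := hF'c (t + 1)
        exact ⟨t, ht1, ht2, by omega⟩
  rcases le_or_gt w c with hwc | hwc
  · have h1 := H2 c hxc
    have h2 := cnt_succ_of_mem hcC
    have h3 := hFEc (c + 1) (by omega) (by omega)
    have h4 : c + 1 ≠ x := by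
      rintro rfl
      omega
    obtain ⟨z, rfl⟩ : ∃ z, x = z + 1 := ⟨x - 1, by omega⟩
    have h5 := hF'c (z + 1)
    have h6 := hF'c (c + 1)
    have h7 := cnt_mono C (show z ≤ z + 1 by omega)
    constructor <;> intro _ <;> exact ⟨z, by omega, by omega, by omega⟩
  · have h1 := hF'c (c + 1)
    constructor
    · rintro ⟨t, ht1, ht2, ht3⟩
      have h2 := hF'c (t + 1)
      by_cases h3 : w ≤ t ∧ t < x
      · have h4 := H2 t h3.2
        have h5 := hFEc (t + 1) (by omega) (by omega)
        exact ⟨x, by omega, hxy, by omega⟩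
      · exact ⟨t, ht1, ht2, by omega⟩
    · rintro ⟨t, ht1, ht2, ht3⟩
      have h2 := hF'c (t + 1)
      exact ⟨t, ht1, ht2, by omega⟩

lemma cnt_interval {S : Finset ℕ} {s t : ℕ} (hst : s ≤ t)
    (h : ∀ k, s ≤ k → k < t → k ∈ S) : cnt S t = cnt S s + (t - s) := by
  induction t, hst using Nat.le_induction with
  | base => omega
  | succ t hst ih =>
    rw [cnt_succ_of_mem (h t hst (by omega)), ih fun k h1 h2 => h k h1 (by omega)]
    omega

lemma cnt_toFinset_cons {c : ℕ} {cs : List ℕ} (h : (c :: cs).Pairwise (· > ·)) (t : ℕ) :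
    cnt (c :: cs).toFinset t = cnt cs.toFinset t + if c < t then 1 else 0 := by
  rw [List.toFinset_cons, cnt_insert]
  intro hc
  have := (List.pairwise_cons.1 h).1 c (by simpa using hc)
  omega

lemma dec_toFinset (S : Finset ℕ) : (dec S).toFinset = S := by
  ext x
  simp [mem_dec]

lemma dec_union {S T : Finset ℕ} (h : ∀ s ∈ S, ∀ t ∈ T, t < s) :
    dec (S ∪ T) = dec S ++ dec T := by
  apply dec_eq
  · rw [List.pairwise_append]
    exact ⟨dec_pairwise S, dec_pairwise T, fun a ha b hb => h a (mem_dec.1 ha) b (mem_dec.1 hb)⟩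
  · simp [mem_dec]

/-- The effect on counting functions of inserting a letter. -/
lemma cnt_sIns (b : ℕ) (D : Finset ℕ) (t : ℕ) : cnt (sIns b D) t = cnt D t ∨
    (b < t ∧ cnt (sIns b D) t = cnt D t + 1 ∧ cnt D t = cnt D b) := by
  rcases exists_next b D with h | ⟨d, hd, hbd, h⟩
  · rw [(ins_none h).1]
    by_cases hb : b ∈ D
    · rw [Finset.insert_eq_of_mem hb]
      exact Or.inl rfl
    · rw [cnt_insert hb]
      split_ifs with hbt
      · refine Or.inr ⟨hbt, rfl, ?_⟩
        have := cnt_diff_eq (A := D) (B := ∅) hbt.le fun k h1 _ => ⟨fun hk => by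
          have := h k hk
          have : k ≠ b := fun e => hb (e ▸ hk)
          omega, by simp⟩
        simpa [cnt] using this
      · exact Or.inl rfl
  · by_cases hb : b ∈ D
    · rw [(ins_stay' hb hd hbd h).1]
      exact Or.inl rfl
    · rw [(ins_swap hb hd hbd h).1]
      have h1 := cnt_insert (S := D.erase d) (a := b) (by simp [hb]) t
      have h2 := cnt_erase hd t
      by_cases h3 : b < t ∧ t ≤ d
      · refine Or.inr ⟨h3.1, ?_, ?_⟩
        · split_ifs at h1 h2 <;> omega
        · have := cnt_diff_eq (A := D) (B := ∅) h3.1.le fun k h4 _ => ⟨fun hk => by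
            have := h k hk
            have : k ≠ b := fun e => hb (e ▸ hk)
            omega, by simp⟩
          simpa [cnt] using this
      · left
        split_ifs at h1 h2 <;> omega

lemma Dom.sIns {a : ℕ} {S D : Finset ℕ} (h : Dom S D) (hv : a ∈ S → a + 1 ∈ S) :
    Dom (sIns a S) (colOn (bump a S) D) := by
  rcases ins_cases hv with ⟨-, hI⟩ | ⟨ha, hb, hI⟩ | ⟨b, ha, hb, hab, -, hI⟩
  · rw [hI.1, hI.2]
    exact h.superset (Finset.subset_insert _ _)
  · rw [hI.1, hI.2]
    intro t
    rcases cnt_sIns (a + 1) D (t + 1) with e | ⟨h1, h2, h3⟩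
    · exact (le_of_eq e).trans (h t)
    · have h4 := h a
      have h5 := cnt_succ_of_mem ha
      have h6 := cnt_mono S (show a + 1 ≤ t by omega)
      change cnt (_root_.sIns (a + 1) D) (t + 1) ≤ _
      omega
  · rw [hI.1, hI.2]
    intro t
    change cnt (_root_.sIns b D) (t + 1) ≤ _
    have e1 := cnt_insert (S := S.erase b) (a := a) (by simp [ha]) t
    have e2 := cnt_erase hb t
    have h0 := h t
    rcases cnt_sIns b D (t + 1) with e | ⟨h1, h2, h3⟩
    · split_ifs at e1 e2 <;> omega
    · obtain ⟨k, rfl⟩ : ∃ k, b = k + 1 := ⟨b - 1, by omega⟩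
      have h4 := h k
      have h5 := cnt_succ_of_mem hb
      have h6 := cnt_mono S (show k + 1 ≤ t by omega)
      have h7 := cnt_mono S (show k ≤ k + 1 by omega)
      by_cases h8 : k + 1 < t
      · have h9 := cnt_mono S (show k + 1 + 1 ≤ t by omega)
        split_ifs at e1 e2 <;> omega
      · split_ifs at e1 e2 <;> omega

lemma Adm.dom {ρ : List ℕ} (h : Adm ρ) : Dom (col ρ) (col (rest ρ)) := by
  induction ρ with
  | nil => exact fun t => by simp [cnt]
  | cons a ρ ih =>
    have h' := adm_cons.1 h
    rw [rest_cons, col_append, col_cons]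
    exact (ih h'.2).sIns h'.1

/-- Inserting a decreasing word whose letters replace larger elements one by one. -/
lemma insert_dec_word {cs : List ℕ} (hcs : cs.Pairwise (· > ·)) {L E H : Finset ℕ}
    (hL : ∀ l ∈ L, ∀ x ∈ cs, l < x) (hH : ∀ h ∈ H, ∀ e ∈ E, e < h)
    (hD : Dom cs.toFinset E) (hc : E.card = cs.length ∨ H = ∅) :
    colOn cs (L ∪ E ∪ H) = L ∪ cs.toFinset ∪ H ∧ bumpOn cs (L ∪ E ∪ H) = dec E ∧
      AdmOn cs (L ∪ E ∪ H) := by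
  induction cs generalizing E H with
  | nil =>
    have hE : E = ∅ := by
      have := hD.card_le
      simpa using this
    subst hE
    simp [colOn, bumpOn, AdmOn, dec]
  | cons c cs ih =>
    have hp := List.pairwise_cons.1 hcs
    have hcard : (c :: cs).toFinset.card = cs.length + 1 := by
      rw [List.toFinset_card_of_nodup (hcs.imp (fun h => by omega))]
      simp
    have hcard' : cs.toFinset.card = cs.length :=
      List.toFinset_card_of_nodup (hp.2.imp (fun h => by omega))
    have hle := hD.card_le
    have hcntc : ∀ t, c < t → cnt cs.toFinset t = cs.length := by
      intro t ht
      rw [← hcard']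
      refine cnt_eq_card fun s hs => ?_
      have := hp.1 s (by simpa using hs)
      omega
    have hL' : ∀ l ∈ L, ∀ x ∈ cs, l < x := fun l hl x hx => hL l hl x (by simp [hx])
    by_cases hE : E.card = cs.length + 1
    · have hne : E.Nonempty := Finset.card_pos.1 (by omega)
      set e := E.max' hne with he
      have heE : e ∈ E := Finset.max'_mem _ _
      have hmax : ∀ k ∈ E, k ≤ e := fun k hk => Finset.le_max' _ _ hk
      have hce : c < e := by
        by_contra hh
        have h1 := hD e
        rw [cnt_eq_card fun s hs => Nat.lt_succ_of_le (hmax s hs), cnt_toFinset_cons hcs,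
          if_neg (by omega)] at h1
        have h2 := cnt_le_card cs.toFinset e
        omega
      have hEc : (E.erase e).card = cs.length := by rw [Finset.card_erase_of_mem heE]; omega
      have hD' : Dom cs.toFinset (E.erase e) := by
        intro t
        by_cases ht : c < t
        · rw [hcntc t ht, ← hEc]
          exact cnt_le_card _ _
        · have h1 := hD t
          rw [cnt_toFinset_cons hcs, if_neg ht] at h1
          exact (cnt_le_of_subset (Finset.erase_subset _ _) _).trans h1
      have hset : L ∪ E ∪ H = L ∪ E.erase e ∪ insert e H := by
        ext k
        grind
      obtain ⟨h1, h2, h3⟩ := ih hp.2 hL' (E := E.erase e) (H := insert e H) (by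
        intro h hh k hk
        obtain ⟨hk1, hk2⟩ := Finset.mem_erase.1 hk
        have := hmax k hk2
        rcases Finset.mem_insert.1 hh with rfl | hh
        · omega
        · exact hH h hh k hk2) hD' (Or.inl hEc)
      have hI : Ins c (L ∪ cs.toFinset ∪ insert e H)
          (insert c ((L ∪ cs.toFinset ∪ insert e H).erase e)) [e] := by
        have hall : ∀ s ∈ L ∪ cs.toFinset ∪ insert e H, s < c ∨ e ≤ s := by
          intro s hs
          simp only [Finset.mem_union, Finset.mem_insert, List.mem_toFinset] at hs
          rcases hs with (hs | hs) | hs | hs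
          · exact Or.inl (hL s hs c (by simp))
          · exact Or.inl (hp.1 s hs)
          · exact Or.inr hs.ge
          · exact Or.inr (hH s hs e heE).le
        refine ins_swap (fun hh => ?_) (by simp) hce fun s hs => ?_
        · have := hall c hh; omega
        · have := hall s hs; omega
      rw [hset]
      refine ⟨?_, ?_, ?_, h3⟩
      · rw [colOn, h1, hI.1]
        ext k
        have h4 : e ∉ L := fun hh => by have := hL e hh c (by simp); omega
        have h5 : e ∉ cs := fun hh => by have := hp.1 e hh; omega
        have h6 : e ∉ H := fun hh => by have := hH e hh e heE; omega
        simp only [Finset.mem_insert, Finset.mem_erase, Finset.mem_union, List.mem_toFinset,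
          List.mem_cons]
        grind
      · rw [bumpOn, h1, h2, hI.2, List.singleton_append, ← dec_insert_of_lt,
          Finset.insert_erase heE]
        intro s hs
        obtain ⟨hk1, hk2⟩ := Finset.mem_erase.1 hs
        have := hmax s hk2
        omega
      · rw [h1]
        intro hh
        simp only [Finset.mem_union, Finset.mem_insert, List.mem_toFinset] at hh
        rcases hh with (hs | hs) | hs | hs
        · have := hL c hs c (by simp); omega
        · have := hp.1 c hs; omega
        · omega
        · have := hH c hs e heE; omega
    · have hH0 : H = ∅ := by
        rcases hc with h | h
        · simp at h; omega
        · exact h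
      subst hH0
      have hD' : Dom cs.toFinset E := by
        intro t
        by_cases ht : c < t
        · rw [hcntc t ht]
          exact (cnt_le_card _ _).trans (by omega)
        · have h1 := hD t
          rw [cnt_toFinset_cons hcs, if_neg ht] at h1
          exact h1
      obtain ⟨h1, h2, h3⟩ := ih hp.2 hL' (by simp) hD' (Or.inr rfl)
      have hlt : ∀ s ∈ L ∪ cs.toFinset ∪ ∅, s < c := by
        intro s hs
        simp only [Finset.mem_union, List.mem_toFinset, Finset.notMem_empty, or_false] at hs
        rcases hs with hs | hs
        · exact hL s hs c (by simp)
        · exact hp.1 s hs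
      have hI := ins_none fun s hs => (hlt s hs).le
      refine ⟨?_, ?_, ?_, h3⟩
      · rw [colOn, h1, hI.1]
        ext k
        simp only [Finset.mem_insert, Finset.mem_union, List.mem_toFinset, List.mem_cons]
        tauto
      · rw [bumpOn, h1, h2, hI.2, List.nil_append]
      · rw [h1]
        intro hh
        have := hlt c hh
        omega

lemma insert_dec_of_dom {C : Finset ℕ} {ρ : List ℕ} (h : Dom C (col ρ)) :
    col (dec C ++ ρ) = C ∧ rest (dec C ++ ρ) = dec (col ρ) ++ rest ρ ∧
      AdmOn (dec C) (col ρ) := by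
  have := insert_dec_word (dec_pairwise C) (L := ∅) (E := col ρ) (H := ∅) (by simp) (by simp)
    (by rwa [dec_toFinset]) (Or.inr rfl)
  simp only [Finset.empty_union, Finset.union_empty, dec_toFinset] at this
  rw [col_append, rest_append, this.1, this.2.1]
  exact ⟨rfl, rfl, this.2.2⟩

section Overflow

variable {C E : Finset ℕ} {x y : ℕ}

/-- The letters below the first overflow replace elements one by one, the consecutive letters
from there on stay. -/
lemma insert_dec_lt (H2 : ∀ t, t < x → cnt E (t + 1) ≤ cnt C t) (H3 : cnt E x = cnt C x)
    (hxy : x ≤ y) (hC : ∀ k, x ≤ k → k < y → k ∈ C) (hE : ∀ k, x ≤ k → k ≤ y → k ∈ E) :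
    colOn (dec (C.filter (· < y))) E = C.filter (· < x) ∪ E.filter (x ≤ ·) ∧
      bumpOn (dec (C.filter (· < y))) E = dec ((E.filter (· ≤ y)).erase x) ∧
      AdmOn (dec (C.filter (· < y))) E := by
  induction y, hxy using Nat.le_induction with
  | base =>
    have hE' : ∅ ∪ E.filter (· < x) ∪ E.filter (x ≤ ·) = E := by
      ext k
      grind
    have hfc : ∀ (S : Finset ℕ) (t : ℕ), cnt (S.filter (· < x)) t = cnt S (min t x) := by
      intro S t
      simp [cnt, Finset.filter_filter, and_comm]
    have := insert_dec_word (dec_pairwise (C.filter (· < x))) (L := ∅) (E := E.filter (· < x))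
      (H := E.filter (x ≤ ·)) (by simp) (by simp; intros; omega) (by
        intro t
        rw [dec_toFinset, hfc, hfc]
        by_cases ht : t < x
        · rw [min_eq_left (by omega), min_eq_left (by omega)]
          exact H2 t ht
        · rw [min_eq_right (by omega), min_eq_right (by omega)]
          exact H3.le) (Or.inl (by rw [dec_length]; exact H3))
    rw [hE', dec_toFinset, Finset.empty_union] at this
    refine ⟨this.1, ?_, this.2.2⟩
    rw [this.2.1]
    congr 1
    ext k
    grind
  | succ y hxy ih =>
    obtain ⟨h1, h2, h3⟩ := ih (fun k h1 h2 => hC k h1 (by omega)) fun k h1 h2 => hE k h1 (by omega)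
    have hy := hC y hxy (by omega)
    have e1 : C.filter (· < y + 1) = insert y (C.filter (· < y)) := by grind
    have hI : Ins y (C.filter (· < x) ∪ E.filter (x ≤ ·)) _ _ := ins_stay
      (by have := hE y hxy (by omega); grind)
      (by have := hE (y + 1) (by omega) (by omega); grind)
    rw [e1, dec_insert_of_lt (by simp)]
    refine ⟨?_, ?_, ?_, h3⟩
    · rw [colOn, h1, hI.1]
    · rw [bumpOn, h1, h2, hI.2]
      have e2 : (E.filter (· ≤ y + 1)).erase x = insert (y + 1) ((E.filter (· ≤ y)).erase x) := by
        have := hE (y + 1) (by omega) (by omega)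
        ext k
        simp only [Finset.mem_erase, Finset.mem_filter, Finset.mem_insert]
        constructor
        · rintro ⟨h1, h2, h3⟩
          by_cases h : k = y + 1
          · exact Or.inl h
          · exact Or.inr ⟨h1, h2, by omega⟩
        · rintro (rfl | ⟨h1, h2, h3⟩)
          · exact ⟨by omega, this, le_rfl⟩
          · exact ⟨h1, h2, by omega⟩
      rw [e2, dec_insert_of_lt]
      · rfl
      · intro s hs
        simp only [Finset.mem_erase, Finset.mem_filter] at hs
        omega
    · rw [h1]
      intro _
      have := hE (y + 1) (by omega) (by omega)
      grind

/-- Admissibility forces the letters following an overflow to be present. -/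
lemma mem_of_overflow (H2 : ∀ t, t < x → cnt E (t + 1) ≤ cnt C t) (H3 : cnt E x = cnt C x)
    (hxE : x ∈ E) (hxy : x ≤ y) (hC : ∀ k, x ≤ k → k < y → k ∈ C) (hA : AdmOn (dec C) E) :
    ∀ k, x ≤ k → k ≤ y → k ∈ E := by
  induction y, hxy using Nat.le_induction with
  | base =>
    intro k h1 h2
    rwa [show k = x by omega]
  | succ y hxy ih =>
    have ih' := ih fun k h1 h2 => hC k h1 (by omega)
    intro k h1 h2
    by_cases hk : k ≤ y
    · exact ih' k h1 hk
    have hk' : k = y + 1 := by omega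
    subst hk'
    obtain ⟨h3, -, -⟩ := insert_dec_lt H2 H3 hxy (fun k h1 h2 => hC k h1 (by omega)) ih'
    rw [dec_split C (hC y hxy (by omega)), admOn_append] at hA
    have hA2 := hA.2.1
    rw [h3] at hA2
    have := hA2 (by have := ih' y hxy le_rfl; grind)
    grind

/-- Inserting a decreasing word with an overflow. -/
lemma insert_dec_overflow (hy : y ∉ C) (hxy : x ≤ y)
    (hC : ∀ k, x ≤ k → k < y → k ∈ C) (hE : ∀ k, x ≤ k → k ≤ y → k ∈ E)
    (H1 : ∀ t, y < t → cnt E (t + 1) + cnt C (y + 1) ≤ cnt C t + cnt E (y + 1))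
    (H2 : ∀ t, t < x → cnt E (t + 1) ≤ cnt C t) (H3 : cnt E x = cnt C x) :
    colOn (dec C) E = insert y C ∧ bumpOn (dec C) E = dec (E.erase x) ∧ AdmOn (dec C) E := by
  have hsplit : dec C = dec (C.filter (y < ·)) ++ dec (C.filter (· < y)) := by
    rw [← dec_union]
    · congr 1
      ext k
      simp only [Finset.mem_union, Finset.mem_filter]
      have : k = y → k ∉ C := fun h => h ▸ hy
      grind
    · intro s hs t ht
      simp only [Finset.mem_filter] at hs ht
      omega
  obtain ⟨h1, h2, h3⟩ := insert_dec_lt H2 H3 hxy hC hE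
  have hset : C.filter (· < x) ∪ E.filter (x ≤ ·) =
      (C.filter (· < x) ∪ E.filter (fun k => x ≤ k ∧ k ≤ y)) ∪ E.filter (y < ·) ∪ ∅ := by
    ext k
    simp only [Finset.mem_union, Finset.mem_filter, Finset.notMem_empty]
    grind
  have hfc : ∀ (S : Finset ℕ) (t : ℕ), y < t →
      cnt (S.filter (y < ·)) t + cnt S (y + 1) = cnt S t := by
    intro S t ht
    have := cnt_diff_eq (A := S.filter (y < ·)) (B := S) (s := y + 1) (t := t) (by omega)
      fun k h1 h2 => by simp; omega
    have h0 : cnt (S.filter (y < ·)) (y + 1) = 0 := by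
      simp only [cnt, Finset.card_eq_zero, Finset.filter_eq_empty_iff, Finset.mem_filter]
      intro k hk
      omega
    omega
  have h4 := insert_dec_word (dec_pairwise (C.filter (y < ·)))
    (L := C.filter (· < x) ∪ E.filter (fun k => x ≤ k ∧ k ≤ y)) (E := E.filter (y < ·)) (H := ∅)
    (by
      intro l hl k hk
      simp only [mem_dec, Finset.mem_union, Finset.mem_filter] at hl hk
      omega) (by simp) (by
      intro t
      rw [dec_toFinset]
      by_cases ht : y < t
      · have h5 := hfc E (t + 1) (by omega)
        have h6 := hfc C t ht
        have h7 := H1 t ht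
        omega
      · have h0 : cnt (E.filter (y < ·)) (t + 1) = 0 := by
          simp only [cnt, Finset.card_eq_zero, Finset.filter_eq_empty_iff, Finset.mem_filter]
          intro k hk
          omega
        omega) (Or.inr rfl)
  rw [← hset, dec_toFinset] at h4
  rw [hsplit, colOn_append, bumpOn_append, admOn_append, h1, h2, h4.1, h4.2.1]
  refine ⟨?_, ?_, h4.2.2, h3⟩
  · ext k
    simp only [Finset.mem_union, Finset.mem_filter, Finset.notMem_empty, Finset.mem_insert]
    have a1 := hC k
    have a2 := hE k
    constructor
    · rintro ((((h | h) | h) | h))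
      · exact Or.inr h.1
      · by_cases hky : k = y
        · exact Or.inl hky
        · exact Or.inr (a1 h.2.1 (by omega))
      · exact Or.inr h.1
      · exact h.elim
    · rintro (rfl | h)
      · exact Or.inl (Or.inl (Or.inr ⟨a2 hxy le_rfl, hxy, le_rfl⟩))
      · have : k ≠ y := fun e => hy (e ▸ h)
        by_cases hkx : k < x
        · exact Or.inl (Or.inl (Or.inl ⟨h, hkx⟩))
        · by_cases hky : k < y
          · exact Or.inl (Or.inl (Or.inr ⟨a2 (by omega) hky.le, by omega, hky.le⟩))
          · exact Or.inl (Or.inr ⟨h, by omega⟩)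
  · rw [← dec_union]
    · congr 1
      ext k
      simp only [Finset.mem_union, Finset.mem_filter, Finset.mem_erase]
      constructor
      · rintro (h | h)
        · exact ⟨by omega, h.1⟩
        · exact ⟨h.1, h.2.1⟩
      · rintro ⟨h5, h6⟩
        by_cases hky : k ≤ y
        · exact Or.inr ⟨h5, h6, hky⟩
        · exact Or.inl ⟨h6, by omega⟩
    · intro s hs t ht
      simp only [Finset.mem_erase, Finset.mem_filter] at hs ht
      omega

end Overflow

/-- The rows that reach column `c` of the insertion tableau (columns are counted from `0`). -/
noncomputable def colRows : ℕ → List ℕ → Finset ℕ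
  | 0, ρ => col ρ
  | c + 1, ρ => matched (col ρ) (colRows c (rest ρ))

lemma colRows_zero (ρ : List ℕ) : colRows 0 ρ = col ρ := rfl

lemma colRows_add_one (c : ℕ) (ρ : List ℕ) :
    colRows (c + 1) ρ = matched (col ρ) (colRows c (rest ρ)) := rfl

lemma matched_empty (C : Finset ℕ) : matched C ∅ = ∅ := by
  ext c
  simp only [mem_matched, Finset.notMem_empty, iff_false, not_and, not_exists]
  intro _ t ht h
  have := cnt_mono C (show c + 1 ≤ t by omega)
  simp only [cnt, Finset.filter_empty, Finset.card_empty] at h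
  simp only [cnt] at this
  omega

@[simp] lemma colRows_nil (c : ℕ) : colRows c [] = ∅ := by
  induction c with
  | zero => rfl
  | succ c ih => rw [colRows_add_one, rest_nil, ih, matched_empty]

lemma colRows_succ_subset (c : ℕ) (ρ : List ℕ) : colRows (c + 1) ρ ⊆ colRows c ρ := by
  induction c generalizing ρ with
  | zero => exact matched_subset _ _
  | succ c ih => exact matched_mono (ih _)

lemma colRows_subset {c d : ℕ} (h : c ≤ d) (ρ : List ℕ) : colRows d ρ ⊆ colRows c ρ := by
  induction d, h using Nat.le_induction with
  | base => exact Finset.Subset.refl _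
  | succ d _ ih => exact (colRows_succ_subset d ρ).trans ih

lemma colRows_subset_col (c : ℕ) (ρ : List ℕ) : colRows c ρ ⊆ col ρ :=
  colRows_subset (Nat.zero_le c) ρ

lemma CKEquiv.colRows_eq {u v : List ℕ} (h : CKEquiv u v) (hu : IsReducedWord u) (c : ℕ) :
    colRows c u = colRows c v := by
  induction c generalizing u v with
  | zero => exact (h.col_rest hu).1
  | succ c ih =>
    obtain ⟨h1, h2⟩ := h.col_rest hu
    rw [colRows_add_one, colRows_add_one, h1, ih h2 hu.rest]

lemma Adm.dom_colRows {ρ : List ℕ} (h : Adm ρ) (c : ℕ) : Dom (col ρ) (colRows c (rest ρ)) :=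
  h.dom.subset (colRows_subset_col _ _)

lemma colRows_dec_of_dom {C : Finset ℕ} {ρ : List ℕ} (h : Dom C (col ρ)) (hρ : IsReducedWord ρ)
    (c : ℕ) : colRows (c + 1) (dec C ++ ρ) = matched C (colRows c ρ) := by
  obtain ⟨h1, h2, -⟩ := insert_dec_of_dom h
  rw [colRows_add_one, h1, h2, hρ.ckEquiv.colRows_eq hρ]

/-- Appending the letter `x` to `ρ` adds the box in row `y` and column `j`. -/
def Grows (ρ : List ℕ) (x j y : ℕ) : Prop :=
  y ∉ colRows j ρ ∧ colRows j (ρ ++ [x]) = insert y (colRows j ρ) ∧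
    (∀ c, c ≠ j → colRows c (ρ ++ [x]) = colRows c ρ) ∧
    ∀ r ∈ colRows j ρ, r ∉ colRows (j + 1) ρ → y < r

lemma grows_nil (x : ℕ) : Grows [] x 0 x := by
  have h0 : col [x] = {x} := by
    rw [col_cons, col_nil, (ins_none (by simp)).1]; rfl
  have h1 : rest [x] = [] := by
    rw [rest_cons, col_nil, (ins_none (by simp)).2]; rfl
  refine ⟨by simp, by simp [colRows_zero, h0], fun c hc => ?_, by simp⟩
  obtain ⟨c, rfl⟩ : ∃ d, c = d + 1 := ⟨c - 1, by omega⟩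
  simp [colRows_add_one, h1, matched_empty]

/-- The first place where two columns fail to be compatible. -/
lemma exists_overflow {C E : Finset ℕ} (h : ¬ Dom C E) :
    ∃ p q, p ∈ E ∧ (∀ t, t < p → cnt E (t + 1) ≤ cnt C t) ∧ cnt E p = cnt C p ∧ p ≤ q ∧
      q ∉ C ∧ ∀ k, p ≤ k → k < q → k ∈ C := by
  classical
  have hex : ∃ t, cnt C t < cnt E (t + 1) := by
    by_contra hh
    push Not at hh
    exact h hh
  obtain ⟨p, hp, hmin⟩ : ∃ p, cnt C p < cnt E (p + 1) ∧ ∀ t, t < p → cnt E (t + 1) ≤ cnt C t :=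
    ⟨Nat.find hex, Nat.find_spec hex, fun t ht => not_lt.1 (Nat.find_min hex ht)⟩
  have hex2 : ∃ q, p ≤ q ∧ q ∉ C := by
    obtain ⟨n, hn⟩ := exists_bound C
    exact ⟨max n p, by omega, fun hh => by have := hn _ hh; omega⟩
  obtain ⟨q, hq, hq2⟩ : ∃ q, (p ≤ q ∧ q ∉ C) ∧ ∀ k, k < q → ¬ (p ≤ k ∧ k ∉ C) :=
    ⟨Nat.find hex2, Nat.find_spec hex2, fun k hk => Nat.find_min hex2 hk⟩
  have h1 : cnt E p ≤ cnt C p := by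
    rcases p with _ | k
    · simp
    · exact (hmin k (by omega)).trans (cnt_mono C (by omega))
  have hpE : p ∈ E := by
    by_contra hh
    rw [cnt_succ_of_notMem hh] at hp
    omega
  have h2 := cnt_succ_of_mem hpE
  refine ⟨p, q, hpE, hmin, by omega, hq.1, hq.2, fun k h3 h4 => ?_⟩
  by_contra hh
  exact hq2 k h4 ⟨h3, hh⟩

lemma append_rest_ckEquiv {ρ : List ℕ} {u : List ℕ} (h : IsReducedWord (ρ ++ u)) :
    CKEquiv (ρ ++ u) (dec (col ρ) ++ (rest ρ ++ u)) := by
  rw [← List.append_assoc]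
  exact h.left.ckEquiv.append_right u

lemma col_append_eq {ρ u : List ℕ} (h : IsReducedWord (ρ ++ u))
    (hd : Dom (col ρ) (col (rest ρ ++ u))) : col (ρ ++ u) = col ρ ∧
      CKEquiv (rest (ρ ++ u)) (rest ρ ++ u) := by
  obtain ⟨h1, h2⟩ := (append_rest_ckEquiv h).col_rest h
  obtain ⟨h3, h4, -⟩ := insert_dec_of_dom hd
  have h5 := ((append_rest_ckEquiv h).isReducedWord_iff.1 h).right
  rw [h4] at h2
  exact ⟨h1.trans h3, h2.trans h5.ckEquiv.symm⟩

lemma Adm.col_nonempty {ρ : List ℕ} (h : Adm ρ) (hne : ρ ≠ []) : (col ρ).Nonempty := by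
  cases ρ with
  | nil => exact absurd rfl hne
  | cons a ρ =>
    rw [col_cons]
    rcases ins_cases (adm_cons.1 h).1 with ⟨-, h⟩ | ⟨ha, -, h⟩ | ⟨b, -, -, -, -, h⟩
    · rw [h.1]; exact Finset.insert_nonempty _ _
    · rw [h.1]; exact ⟨a, ha⟩
    · rw [h.1]; exact Finset.insert_nonempty _ _

lemma length_rest_lt {ρ : List ℕ} (h : IsReducedWord ρ) (hne : ρ ≠ []) :
    (rest ρ).length < ρ.length := by
  have h1 := length_col_add_rest h.adm
  have := Finset.card_pos.2 (h.adm.col_nonempty hne)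
  omega

/-- Appending a letter to a reduced word adds exactly one box to the tableau. -/
theorem exists_grows_rest {ρ : List ℕ} {x : ℕ} (h : IsReducedWord (ρ ++ [x])) :
    ∃ j y, Grows ρ x j y ∧ (j = 0 ∨ ∃ i z, j = i + 1 ∧ Grows (rest ρ) x i z ∧
      CKEquiv (rest (ρ ++ [x])) (rest ρ ++ [x])) := by
  induction hn : ρ.length using Nat.strong_induction_on generalizing ρ with
  | _ n ih =>
  by_cases hne : ρ = []
  · subst hne
    exact ⟨0, x, grows_nil x, Or.inl rfl⟩
  have hck := (append_rest_ckEquiv h)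
  have hred := hck.isReducedWord_iff.1 h
  have hvx : IsReducedWord (rest ρ ++ [x]) := hred.right
  obtain ⟨j', z, hg, -⟩ := ih _ (hn ▸ length_rest_lt h.left hne) hvx rfl
  obtain ⟨hz, hz1, hz2, hz3⟩ := id hg
  by_cases hdom : Dom (col ρ) (col (rest ρ ++ [x]))
  · obtain ⟨h1, h2⟩ := col_append_eq h hdom
    have hR : ∀ c, colRows (c + 1) (ρ ++ [x]) =
        matched (col ρ) (colRows c (rest ρ ++ [x])) := by
      intro c
      rw [colRows_add_one, h1, h2.colRows_eq h.rest]
    have hd' : Dom (col ρ) (insert z (colRows j' (rest ρ))) := by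
      rw [← hz1]
      exact hdom.subset (colRows_subset_col _ _)
    obtain ⟨m, hm, e⟩ := hd'.matched_insert hz
    refine ⟨j' + 1, m, ⟨hm, by rw [hR, hz1, e]; rfl, fun c hc => ?_, fun r hr hr' => ?_⟩,
      Or.inr ⟨j', z, rfl, hg, h2⟩⟩
    · rcases c with _ | c
      · exact h1
      · rw [hR, hz2 c (by omega)]; rfl
    · exact lt_of_matched_insert hz (colRows_succ_subset j' _) hz3 hm e hr hr'
  · have hj : j' = 0 := by
      by_contra hj
      refine hdom ?_
      have := hz2 0 (Ne.symm hj)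
      rw [colRows_zero, colRows_zero] at this
      rw [this]
      exact h.left.adm.dom
    subst hj
    rw [colRows_zero, colRows_zero] at hz1
    rw [colRows_zero] at hz hz3
    have hR1 := hz2 1 (by omega)
    obtain ⟨hckc, hckr⟩ := hck.col_rest h
    set C := col ρ with hC
    set D := col (rest ρ) with hD
    set E := col (rest ρ ++ [x]) with hE
    set u := rest (rest ρ ++ [x]) with hu
    have hCD : Dom C D := h.left.adm.dom
    obtain ⟨p, q, hpE, H2, H3, hpq, hqC, hpqC⟩ := exists_overflow hdom
    have hcntE := cnt_insert hz
    rw [← hz1] at hcntE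
    have hzp : z ≤ p := by
      by_contra hh
      have h1 := hcntE (p + 1)
      have h2 := hCD p
      have h3 := cnt_succ_of_mem hpE
      rw [if_neg (by omega)] at h1
      omega
    have hpqE := mem_of_overflow H2 H3 hpE hpq hpqC (adm_append.1 hred.adm).1
    have hEq : cnt E (q + 1) = cnt E p + (q + 1 - p) :=
      cnt_interval (by omega) fun k h1 h2 => hpqE k h1 (by omega)
    have hCq : cnt C q = cnt C p + (q - p) := cnt_interval hpq hpqC
    have hCq' := cnt_succ_of_notMem hqC
    have H1 : ∀ t, q < t → cnt E (t + 1) + cnt C (q + 1) ≤ cnt C t + cnt E (q + 1) := by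
      intro t ht
      have h1 := hcntE (t + 1)
      have h2 := hCD t
      split_ifs at h1 <;> omega
    obtain ⟨hc1, hc2, -⟩ := insert_dec_overflow hqC hpq hpqC hpqE H1 H2 H3
    rw [col_append (dec C), hc1] at hckc
    rw [rest_append (dec C), hc2] at hckr
    have hured : IsReducedWord u := hvx.rest
    have hmE : matched E (col u) ⊆ D := by
      change colRows 1 (rest ρ ++ [x]) ⊆ D
      rw [hR1]
      exact colRows_succ_subset 0 (rest ρ)
    have hdu : Dom (E.erase p) (col u) := by
      intro t
      have h1 := (hvx.adm.dom.cnt_matched t).1 t le_rfl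
      have h2 := cnt_le_of_subset hmE t
      have h3 := hcntE t
      have h4 := cnt_erase hpE t
      change cnt (col u) (t + 1) + cnt E t ≤ cnt (matched E (col u)) t + cnt E t at h1
      split_ifs at h3 h4 <;> omega
    have hR : ∀ c, colRows (c + 1) (ρ ++ [x]) =
        matched (insert q C) (colRows c (dec (E.erase p) ++ u)) := by
      intro c
      rw [colRows_add_one, hckc, hckr.colRows_eq h.rest]
    refine ⟨0, q, ⟨hqC, hckc, fun c hc => ?_, fun r hr hr' => ?_⟩, Or.inl rfl⟩
    · obtain ⟨c, rfl⟩ : ∃ d, c = d + 1 := ⟨c - 1, by omega⟩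
      rw [hR]
      change _ = matched C (colRows c (rest ρ))
      rcases c with _ | c
      · rw [colRows_zero, colRows_zero, (insert_dec_of_dom hdu).1]
        refine matched_exchange (E := E) (x := p) (by rw [hz1]; exact Finset.subset_insert _ _) ?_
          hqC hpq H1 H2 H3
        rcases eq_or_lt_of_le hzp with rfl | hlt
        · exact Or.inl ⟨hz, by rw [hz1, Finset.erase_insert hz]⟩
        · refine Or.inr ⟨by grind, z, by grind, hz, hlt, ?_, by grind⟩
          rw [hz1, Finset.erase_insert_of_ne (by omega)]
      · rw [colRows_dec_of_dom hdu hured, ← hz2 (c + 1) (by omega)]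
        exact matched_exchange (matched_subset _ _)
          (matched_erase hpE (hdu.subset (colRows_subset_col c u))) hqC hpq H1 H2 H3
    · by_contra hrq
      have hne : r ≠ q := fun e => hqC (e ▸ hr)
      refine hr' (mem_matched.2 ⟨hr, q, by omega, ?_⟩)
      change cnt C q + cnt D (r + 1) < cnt D (q + 1) + cnt C (r + 1)
      have h1 := hCD r
      have h2 := cnt_succ_of_mem (S := C) hr
      have h3 := hcntE (q + 1)
      rw [if_pos (by omega)] at h3
      omega

lemma exists_grows {ρ : List ℕ} {x : ℕ} (h : IsReducedWord (ρ ++ [x])) :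
    ∃ j y, Grows ρ x j y := by
  obtain ⟨j, y, h, -⟩ := exists_grows_rest h
  exact ⟨j, y, h⟩

lemma Grows.ne {ρ : List ℕ} {x j y : ℕ} (h : Grows ρ x j y) :
    colRows j (ρ ++ [x]) ≠ colRows j ρ := fun e => h.1 (by rw [← e, h.2.1]; simp)

lemma Grows.subset {ρ : List ℕ} {x j y : ℕ} (h : Grows ρ x j y) (c : ℕ) :
    colRows c ρ ⊆ colRows c (ρ ++ [x]) := by
  by_cases hc : c = j
  · rw [hc, h.2.1]
    exact Finset.subset_insert _ _
  · rw [h.2.2.1 c hc]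

lemma Grows.eq_column {ρ : List ℕ} {x j y c : ℕ} (h : Grows ρ x j y)
    (hc : colRows c (ρ ++ [x]) ≠ colRows c ρ) : c = j := by
  by_contra hne
  exact hc (h.2.2.1 c hne)

lemma Grows.congr {ρ σ : List ℕ} {x j y : ℕ} (h : Grows ρ x j y) (hr : IsReducedWord (ρ ++ [x]))
    (e : CKEquiv ρ σ) : Grows σ x j y := by
  have h1 := e.colRows_eq hr.left
  have h2 := (e.append_right [x]).colRows_eq hr
  unfold Grows
  simp only [← h1, ← h2]
  exact h

lemma Grows.rest_ckEquiv {ρ : List ℕ} {x j y : ℕ} (h : Grows ρ x (j + 1) y)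
    (hr : IsReducedWord (ρ ++ [x])) :
    (∃ z, Grows (rest ρ) x j z) ∧ CKEquiv (rest (ρ ++ [x])) (rest ρ ++ [x]) := by
  obtain ⟨j', y', h1, h2⟩ := exists_grows_rest hr
  have := h1.eq_column h.ne
  subst this
  rcases h2 with h2 | ⟨i, z, h2, h3, h4⟩
  · omega
  · obtain rfl : j = i := by omega
    exact ⟨⟨z, h3⟩, h4⟩

lemma col_singleton (x : ℕ) : col [x] = {x} := (ins_none (a := x) (S := ∅) (by simp)).1

lemma col_pair_of_lt {x x' : ℕ} (h : x < x') : col [x, x'] = col [x] := by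
  rw [col_cons, col_singleton, col_singleton,
    (ins_swap (a := x) (S := {x'}) (b := x') (by simp; omega) (by simp) h (by simp)).1]
  simp

lemma col_pair_of_gt {x x' : ℕ} (h : x' < x) : col [x, x'] = {x, x'} := by
  rw [col_cons, col_singleton, (ins_none (a := x) (S := {x'}) (by simp; omega)).1]

/-- Appending an ascent moves strictly to the right. -/
theorem Grows.lt_of_lt {ρ : List ℕ} {x x' j j' y y' : ℕ} (hr : IsReducedWord (ρ ++ [x] ++ [x']))
    (hx : x < x') (h : Grows ρ x j y) (h' : Grows (ρ ++ [x]) x' j' y') : j < j' := by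
  induction j generalizing ρ j' y y' with
  | zero =>
    by_contra hj
    obtain rfl : j' = 0 := by omega
    refine h'.ne ?_
    rw [colRows_zero, colRows_zero, List.append_assoc, col_append ρ, col_append ρ]
    exact congrArg _ (col_pair_of_lt hx)
  | succ j ih =>
    rcases j' with _ | j'
    · refine absurd ?_ h'.ne
      rw [colRows_zero, colRows_zero, List.append_assoc, col_append ρ, col_append ρ]
      exact congrArg _ (col_pair_of_lt hx)
    · obtain ⟨⟨z, h1⟩, h2⟩ := h.rest_ckEquiv hr.left
      obtain ⟨⟨z', h3⟩, h4⟩ := h'.rest_ckEquiv hr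
      have h5 := h4.isReducedWord_iff.1 hr.rest
      have := ih ((h2.append_right [x']).isReducedWord_iff.1 h5) h1 (h3.congr h5 h2)
      omega

/-- `A` is contained in `A₁ = A ∪ {y}` and `A₂ = A ∪ {y, y'}` for some `y' < y`. -/
def AddsDescent (A A₁ A₂ : Finset ℕ) : Prop :=
  ∃ y y', y' < y ∧ y ∉ A ∧ y' ∉ A ∧ A₁ = insert y A ∧ A₂ = insert y' (insert y A)

lemma addsDescent_sIns {a : ℕ} {A A₁ A₂ : Finset ℕ} (h : AddsDescent A A₁ A₂)
    (h0 : a ∈ A → a + 1 ∈ A) (h1 : a ∈ A₁ → a + 1 ∈ A₁) (h2 : a ∈ A₂ → a + 1 ∈ A₂) :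
    sIns a A = sIns a A₁ ∨ AddsDescent (sIns a A) (sIns a A₁) (sIns a A₂) := by
  obtain ⟨y, y', hlt, hy, hy', rfl, rfl⟩ := h
  by_cases ha : a ∈ A
  · have hb := h0 ha
    right
    rw [(ins_stay ha hb).1, (ins_stay (by simp [ha]) (by simp [hb])).1,
      (ins_stay (by simp [ha]) (by simp [hb])).1]
    exact ⟨y, y', hlt, hy, hy', rfl, rfl⟩
  by_cases hya : y = a
  · subst hya
    have hb : y + 1 ∈ A := by simpa using h1 (by simp)
    right
    rw [(ins_swap ha hb (by omega) fun s _ => by omega).1,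
      (ins_stay (by simp) (by simp [hb])).1, (ins_stay (by simp) (by simp [hb])).1]
    exact ⟨y + 1, y', by omega, by simp, by grind, by grind, by grind⟩
  by_cases hya' : y' = a
  · subst hya'
    have hb : y' + 1 ∈ insert y A := by simpa using h2 (by simp)
    have e1 := (ins_swap (a := y') (S := insert y A) (b := y' + 1) (by grind) hb (by omega)
      fun s _ => by omega).1
    have e2 := (ins_stay (a := y') (S := insert y' (insert y A)) (by simp) (by grind)).1
    rw [e1, e2]
    by_cases hby : y = y' + 1
    · subst hby
      rcases exists_next y' A with h | ⟨d, hd, hbd, h⟩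
      · left
        rw [(ins_none h).1]
        grind
      · right
        rw [(ins_swap ha hd hbd h).1]
        have : d ≠ y' + 1 := fun e => hy (e ▸ hd)
        exact ⟨d, y' + 1, by omega, by grind, by grind, by grind, by grind⟩
    · have hb' : y' + 1 ∈ A := by grind
      right
      rw [(ins_swap ha hb' (by omega) fun s _ => by omega).1]
      exact ⟨y, y' + 1, by omega, by grind, by grind, by grind, by grind⟩
  rcases exists_next a A with h | ⟨d, hd, hbd, h⟩
  · rw [(ins_none h).1]
    by_cases hy1 : y < a
    · right
      rw [(ins_none (a := a) (S := insert y A) (by grind)).1,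
        (ins_none (a := a) (S := insert y' (insert y A)) (by grind)).1]
      exact ⟨y, y', by omega, by grind, by grind, by grind, by grind⟩
    · left
      rw [(ins_swap (a := a) (S := insert y A) (b := y) (by grind) (by grind) (by omega)
        (by grind)).1]
      grind
  · rw [(ins_swap ha hd hbd h).1]
    have hyd : y ≠ d := fun e => hy (e ▸ hd)
    have hyd' : y' ≠ d := fun e => hy' (e ▸ hd)
    right
    by_cases hy1 : a < y ∧ y < d
    · rw [(ins_swap (a := a) (S := insert y A) (b := y) (by grind) (by grind) (by omega)
        (by grind)).1]
      by_cases hy2 : a < y'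
      · rw [(ins_swap (a := a) (S := insert y' (insert y A)) (b := y') (by grind) (by grind)
          (by omega) (by grind)).1]
        exact ⟨d, y, by omega, by grind, by grind, by grind, by grind⟩
      · rw [(ins_swap (a := a) (S := insert y' (insert y A)) (b := y) (by grind) (by grind)
          (by omega) (by grind)).1]
        exact ⟨d, y', by omega, by grind, by grind, by grind, by grind⟩
    · rw [(ins_swap (a := a) (S := insert y A) (b := d) (by grind) (by grind) (by omega)
        (by grind)).1]
      by_cases hy2 : a < y' ∧ y' < d
      · rw [(ins_swap (a := a) (S := insert y' (insert y A)) (b := y') (by grind) (by grind)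
          (by omega) (by grind)).1]
        exact ⟨y, d, by omega, by grind, by grind, by grind, by grind⟩
      · rw [(ins_swap (a := a) (S := insert y' (insert y A)) (b := d) (by grind) (by grind)
          (by omega) (by grind)).1]
        exact ⟨y, y', by omega, by grind, by grind, by grind, by grind⟩

lemma addsDescent_col {ρ : List ℕ} {x x' : ℕ} (hr : IsReducedWord (ρ ++ [x] ++ [x']))
    (hx : x' < x) : col ρ = col (ρ ++ [x]) ∨
      AddsDescent (col ρ) (col (ρ ++ [x])) (col (ρ ++ [x] ++ [x'])) := by
  induction ρ with
  | nil =>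
    right
    have h0 := (ins_none (a := x) (S := ∅) (by simp)).1
    refine ⟨x, x', hx, by simp, by simp, h0, ?_⟩
    change col [x, x'] = _
    rw [col_pair_of_gt hx, col_nil]
    grind
  | cons a ρ ih =>
    rcases ih hr.tail with h | h
    · left
      rw [List.cons_append, col_cons, col_cons, h]
    · simp only [List.cons_append, col_cons]
      exact addsDescent_sIns h (adm_cons.1 hr.left.left.adm).1 (adm_cons.1 hr.left.adm).1
        (adm_cons.1 hr.adm).1

/-- Appending a descent moves weakly to the left. -/
theorem Grows.le_of_gt {ρ : List ℕ} {x x' j j' y y' : ℕ} (hr : IsReducedWord (ρ ++ [x] ++ [x']))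
    (hx : x' < x) (h : Grows ρ x j y) (h' : Grows (ρ ++ [x]) x' j' y') : j' ≤ j := by
  induction j generalizing ρ j' y y' with
  | zero =>
    rcases addsDescent_col hr hx with h1 | ⟨z, z', hz, hz1, hz2, e1, e2⟩
    · exact absurd h1.symm h.ne
    · have : (0 : ℕ) = j' := h'.eq_column fun e => by
        rw [colRows_zero, colRows_zero, e1, e2] at e
        have : z' ∈ insert z (col ρ) := by rw [← e]; simp
        grind
      omega
  | succ j ih =>
    rcases j' with _ | j'
    · omega
    · obtain ⟨⟨z, h1⟩, h2⟩ := h.rest_ckEquiv hr.left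
      obtain ⟨⟨z', h3⟩, h4⟩ := h'.rest_ckEquiv hr
      have h5 := h4.isReducedWord_iff.1 hr.rest
      have := ih ((h2.append_right [x']).isReducedWord_iff.1 h5) h1 (h3.congr h5 h2)
      omega

lemma permEquiv_comm_words {X W : List ℕ} (h : ∀ x ∈ X, ∀ w ∈ W, w + 1 < x ∨ x + 1 < w) :
    PermEquiv (X ++ W) (W ++ X) := by
  induction X with
  | nil => simpa using PermEquiv.refl W
  | cons x X ih =>
    have h1 : PermEquiv ([x] ++ (X ++ W)) ([x] ++ (W ++ X)) :=
      (PermEquiv.refl [x]).append (ih fun x hx => h x (by simp [hx]))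
    have h2 : PermEquiv ((x :: W) ++ X) ((W ++ [x]) ++ X) :=
      (permEquiv_comm_word (h x (by simp))).append (PermEquiv.refl X)
    have := h1.trans (by simpa using h2)
    simpa using this

lemma dec_Ioc_succ {k y : ℕ} (h : k ≤ y) :
    dec (Finset.Ioc k (y + 1)) = (y + 1) :: dec (Finset.Ioc k y) := by
  rw [← dec_insert_of_lt (by simp)]
  congr 1
  ext t
  simp only [Finset.mem_Ioc, Finset.mem_insert]
  omega

lemma colOn_dec_Ioc {k y : ℕ} {D : Finset ℕ} (hky : k ≤ y)
    (h : ∀ i, k < i → i ≤ y + 1 → i ∈ D) : colOn (dec (Finset.Ioc k y)) D = D := by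
  induction y, hky using Nat.le_induction with
  | base => simp [dec, colOn]
  | succ y hky ih =>
    rw [dec_Ioc_succ hky, colOn, ih fun i h1 h2 => h i h1 (by omega)]
    exact (ins_stay (h _ (by omega) (by omega)) (h _ (by omega) (by omega))).1

lemma mem_succ_of_admOn_dec_Ioc {k y : ℕ} {D : Finset ℕ} (hky : k < y)
    (h : ∀ i, k < i → i ≤ y → i ∈ D) (hA : AdmOn (dec (Finset.Ioc k y)) D) : y + 1 ∈ D := by
  obtain ⟨z, rfl⟩ : ∃ z, y = z + 1 := ⟨y - 1, by omega⟩
  rw [dec_Ioc_succ (by omega)] at hA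
  have := hA.1
  rw [colOn_dec_Ioc (by omega) h] at this
  exact this (h _ hky le_rfl)

/-- If two consecutive columns contain `y` but the second one does not contain `y + 1`, then the
interval of the first one ending in `y` is longer than that of the second one. -/
lemma mem_of_isReducedWord {C D : Finset ℕ} {u : List ℕ} {x y : ℕ}
    (hr : IsReducedWord (dec C ++ (dec D ++ u))) (hDu : Dom D (col u)) (hyC : y ∈ C)
    (hyD : y + 1 ∉ D) (hD : ∀ k, x < k → k ≤ y → k ∈ D) : ∀ k, x ≤ k → k < y → k ∈ C := by
  classical
  by_contra! hh
  obtain ⟨k0, hk0, hk0y, hk0C⟩ := hh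
  obtain ⟨k, hkle, hky, hkC, hk⟩ : ∃ k, k0 ≤ k ∧ k < y ∧ k ∉ C ∧ ∀ i, k < i → i ≤ y → i ∈ C := by
    have hne : ((Finset.range y).filter (· ∉ C)).Nonempty := ⟨k0, by simp [hk0y, hk0C]⟩
    have hm := Finset.max'_mem _ hne
    have hM := Finset.le_max' ((Finset.range y).filter (· ∉ C))
    set k := ((Finset.range y).filter (· ∉ C)).max' hne
    simp only [Finset.mem_filter, Finset.mem_range] at hm hM
    refine ⟨k, hM k0 ⟨hk0y, hk0C⟩, hm.1, hm.2, fun i h1 h2 => ?_⟩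
    by_contra hi
    have hiy : i ≠ y := fun e => hi (e ▸ hyC)
    have := hM i ⟨by omega, hi⟩
    omega
  have hsplit : dec C = dec (C.filter (y < ·)) ++ (dec (Finset.Ioc k y) ++
      dec (C.filter (· < k))) := by
    rw [← dec_union, ← dec_union]
    · congr 1
      ext i
      simp only [Finset.mem_union, Finset.mem_filter, Finset.mem_Ioc]
      have := hk i
      have : i = k → i ∉ C := fun e => e ▸ hkC
      grind
    · intro s hs t ht
      simp only [Finset.mem_union, Finset.mem_filter, Finset.mem_Ioc] at hs ht
      omega
    · intro s hs t ht
      simp only [Finset.mem_filter, Finset.mem_Ioc] at hs ht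
      omega
  rw [hsplit, List.append_assoc] at hr
  have h1 := ((permEquiv_comm_words (X := dec (Finset.Ioc k y)) (W := dec (C.filter (· < k)))
    (by
      intro i hi j hj
      simp only [mem_dec, Finset.mem_filter, Finset.mem_Ioc] at hi hj
      omega)).append (PermEquiv.refl (dec D ++ u))).isReducedWord hr.right
  rw [List.append_assoc] at h1
  have h2 := (adm_append.1 h1.right.adm).1
  rw [(insert_dec_of_dom hDu).1] at h2
  exact hyD (mem_succ_of_admOn_dec_Ioc hky (fun i h3 h4 => hD i (by omega) h4) h2)

/-- Every column that is longer than the next one can be shortened. -/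
theorem exists_grows_of_ne {ρ : List ℕ} {j : ℕ} (hr : IsReducedWord ρ)
    (hj : colRows (j + 1) ρ ≠ colRows j ρ) :
    ∃ ρ₀ x y, CKEquiv (ρ₀ ++ [x]) ρ ∧ Grows ρ₀ x j y := by
  induction hn : ρ.length using Nat.strong_induction_on generalizing ρ j with
  | _ n ih =>
  have hne : ρ ≠ [] := by
    rintro rfl
    simp at hj
  have hlen := length_rest_lt hr hne
  have hck := hr.ckEquiv
  have hCD := hr.adm.dom
  rcases j with _ | j
  · set C := col ρ with hC
    set v := rest ρ with hv
    have hvr : IsReducedWord v := hr.rest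
    set D := col v with hD
    set u := rest v with hu
    have hDu : Dom D (col u) := hvr.adm.dom
    have hMC : matched C D ⊆ C := matched_subset _ _
    have hex : ∃ y, y ∈ C ∧ y ∉ matched C D := by
      by_contra! hh
      exact hj (Finset.Subset.antisymm hMC hh)
    classical
    obtain ⟨y, ⟨hyC, hyM⟩, hymin⟩ : ∃ y, (y ∈ C ∧ y ∉ matched C D) ∧
        ∀ k, k < y → ¬ (k ∈ C ∧ k ∉ matched C D) :=
      ⟨Nat.find hex, Nat.find_spec hex, fun k hk => Nat.find_min hex hk⟩
    have hMy : cnt (matched C D) y = cnt C y := by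
      have := cnt_diff_eq (A := matched C D) (B := C) (Nat.zero_le y) fun k _ hk =>
        ⟨fun h => hMC h, fun h => by by_contra hh; exact hymin k hk ⟨h, hh⟩⟩
      simpa using this
    have hyM' : ∀ t, y < t → cnt D (t + 1) + cnt C (y + 1) ≤ cnt C t + cnt D (y + 1) := by
      intro t ht
      by_contra hh
      exact hyM (mem_matched.2 ⟨hyC, t, ht, by omega⟩)
    have hCy1 := cnt_succ_of_mem hyC
    have hDy : cnt D (y + 1) = cnt C y := by
      obtain ⟨-, t, ht, e⟩ := hCD.cnt_matched y
      have h1 := hCD y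
      rcases eq_or_lt_of_le ht with rfl | ht
      · omega
      · have := hyM' t ht
        omega
    have hyD : y + 1 ∉ D := by
      intro hh
      have h1 := hyM' (y + 1) (by omega)
      have h2 := cnt_succ_of_mem hh
      omega
    have hex2 : ((Finset.range (y + 1)).filter (· ∉ D)).Nonempty := by
      by_contra hh
      rw [Finset.not_nonempty_iff_eq_empty, Finset.filter_eq_empty_iff] at hh
      have h1 := cnt_interval (S := D) (Nat.zero_le (y + 1)) fun k _ hk => by
        simpa using hh (Finset.mem_range.2 hk)
      have h2 := cnt_diff_le (A := C) (B := Finset.range y) (Nat.zero_le y)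
        fun k _ hk _ => Finset.mem_range.2 hk
      have h3 := cnt_le_card (Finset.range y) y
      simp at h1 h2 h3
      omega
    obtain ⟨x, hxy, hxD, hxyD⟩ : ∃ x, x ≤ y ∧ x ∉ D ∧ ∀ k, x < k → k ≤ y → k ∈ D := by
      have hm := Finset.max'_mem _ hex2
      have hM := Finset.le_max' ((Finset.range (y + 1)).filter (· ∉ D))
      set x := ((Finset.range (y + 1)).filter (· ∉ D)).max' hex2
      simp only [Finset.mem_filter, Finset.mem_range] at hm hM
      refine ⟨x, by omega, hm.2, fun k h1 h2 => ?_⟩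
      by_contra hk
      have := hM k ⟨by omega, hk⟩
      omega
    have hred2 : IsReducedWord (dec C ++ v) := hck.isReducedWord_iff.1 hr
    have hck2 : CKEquiv (dec C ++ v) (dec C ++ (dec D ++ u)) := hvr.ckEquiv.append_left _
    have hxyC : ∀ k, x ≤ k → k < y → k ∈ C :=
      mem_of_isReducedWord (hck2.isReducedWord_iff.1 hred2) hDu hyC hyD hxyD
    have hcE := cnt_insert hxD
    have hcC := cnt_erase hyC
    set C₀ := C.erase y with hC₀
    set E := insert x D with hE
    have hDx := cnt_succ_of_notMem hxD
    have hCi : cnt C y = cnt C x + (y - x) := cnt_interval hxy hxyC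
    have hDi : cnt D (y + 1) = cnt D (x + 1) + (y + 1 - (x + 1)) :=
      cnt_interval (by omega) fun k h1 h2 => hxyD k (by omega) (by omega)
    have H1 : ∀ t, y < t → cnt E (t + 1) + cnt C₀ (y + 1) ≤ cnt C₀ t + cnt E (y + 1) := by
      intro t ht
      have h1 := hcE (t + 1)
      have h2 := hcE (y + 1)
      have h3 := hcC t
      have h4 := hcC (y + 1)
      have h5 := hyM' t ht
      split_ifs at h1 h2 h3 h4 <;> omega
    have H2 : ∀ t, t < x → cnt E (t + 1) ≤ cnt C₀ t := by
      intro t ht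
      have h1 := hcE (t + 1)
      have h2 := hcC t
      have h3 := hCD t
      change cnt D (t + 1) ≤ cnt C t at h3
      split_ifs at h1 h2 <;> omega
    have H3 : cnt E x = cnt C₀ x := by
      have h1 := hcE x
      have h2 := hcC x
      split_ifs at h1 h2 <;> omega
    have hEi : ∀ k, x ≤ k → k ≤ y → k ∈ E := by
      intro k h1 h2
      rcases eq_or_lt_of_le h1 with rfl | h1
      · exact Finset.mem_insert_self _ _
      · exact Finset.mem_insert_of_mem (hxyD k h1 h2)
    have hCi₀ : ∀ k, x ≤ k → k < y → k ∈ C₀ := fun k h1 h2 =>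
      Finset.mem_erase.2 ⟨by omega, hxyC k h1 h2⟩
    obtain ⟨ho1, ho2, ho3⟩ := insert_dec_overflow (by simp [hC₀]) hxy hCi₀ hEi H1 H2 H3
    rw [hC₀, Finset.insert_erase hyC, ← hC₀] at ho1
    rw [hE, Finset.erase_insert hxD, ← hE] at ho2
    have hEu : Dom E (col u) := hDu.superset (Finset.subset_insert _ _)
    obtain ⟨hw1, hw2, hw3⟩ := insert_dec_of_dom hEu
    have hur : IsReducedWord u := hvr.rest
    have hWadm : Adm (dec C₀ ++ (dec E ++ u)) := by
      rw [adm_append, adm_append, hw1]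
      exact ⟨ho3, hw3, hur.adm⟩
    have hWck : CKEquiv (dec C₀ ++ (dec E ++ u)) ρ := by
      refine hWadm.ckEquiv.trans ?_
      rw [col_append, rest_append, hw1, hw2, ho1, ho2]
      refine CKEquiv.trans ?_ (hck2.symm.trans hck.symm)
      exact (hur.ckEquiv.symm.append_left _).append_left _
    have hWr := hWck.isReducedWord_iff.2 hr
    have hDC : D.card < C.card := by
      rw [← hCD.card_matched]
      exact Finset.card_lt_card ⟨hMC, fun h => hyM (h hyC)⟩
    by_cases hC₀e : C₀ = ∅
    · have hc : C.card = 1 := by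
        have := Finset.card_erase_of_mem hyC
        rw [← hC₀, hC₀e, Finset.card_empty] at this
        have := Finset.card_pos.2 ⟨y, hyC⟩
        omega
      have hDe : D = ∅ := Finset.card_eq_zero.1 (by omega)
      have hve : v = [] := by
        by_contra h
        have := hvr.adm.col_nonempty h
        rw [← hD, hDe] at this
        exact absurd this Finset.not_nonempty_empty
      refine ⟨[], x, x, ?_, grows_nil x⟩
      rw [hC₀e, hE, hDe, hu, hve] at hWck
      simpa [dec] using hWck
    · have hC₀c := Finset.card_pos.2 (Finset.nonempty_iff_ne_empty.2 hC₀e)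
      have hlenW := hWck.length_eq
      rw [List.length_append, dec_length] at hlenW
      have hwr : IsReducedWord (dec E ++ u) := hWr.right
      have hR1w : colRows 1 (dec E ++ u) = matched E (col u) := colRows_dec_of_dom hEu hur 0
      have hEc : E.card = D.card + 1 := Finset.card_insert_of_notMem hxD
      obtain ⟨v₀, x', z, hv₀, hg⟩ := ih _ (by omega) (ρ := dec E ++ u) (j := 0) hwr (by
        intro e
        have h1 := congrArg Finset.card e
        rw [hR1w, colRows_zero, hw1, hEu.card_matched] at h1
        have := hDu.card_le
        omega) rfl
      have hv₀r := hv₀.isReducedWord_iff.2 hwr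
      have hEz : E = insert z (col v₀) := by
        rw [← hw1, ← colRows_zero, ← hv₀.colRows_eq hv₀r, hg.2.1]
        rfl
      have hz : z ∉ col v₀ := hg.1
      have hR1v : colRows 1 v₀ = matched E (col u) := by
        rw [← hR1w, ← hv₀.colRows_eq hv₀r, hg.2.2.1 1 (by omega)]
      have hcz := cnt_insert hz
      rw [← hEz] at hcz
      have hzx : z ≤ x := by
        by_contra! hzx
        obtain ⟨-, t, ht, e⟩ := hEu.cnt_matched (x + 1)
        have h1 : cnt (matched E (col u)) (x + 1) = cnt E (x + 1) := by
          have := cnt_diff_eq (A := matched E (col u)) (B := E) (Nat.zero_le (x + 1))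
            fun k _ hk => ⟨fun h => matched_subset _ _ h, fun h => by
              by_contra hh
              have := hg.2.2.2 k (by rw [colRows_zero]; rw [hEz] at h; grind)
                (by rw [zero_add, hR1v]; exact hh)
              omega⟩
          simpa using this
        have h2 := hDu t
        have h3 := hcE t
        rw [if_pos (by omega)] at h3
        omega
      have hdom : Dom C₀ (col v₀) := by
        intro t
        have h1 := hcz (t + 1)
        by_cases htx : t < x
        · have := H2 t htx
          split_ifs at h1 <;> omega
        · rw [if_pos (by omega)] at h1
          by_cases hty : t ≤ y
          · have h2 := cnt_interval (S := E) (s := x) (t := t + 1) (by omega)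
              fun k h1 h2 => hEi k h1 (by omega)
            have h3 := cnt_interval (S := C₀) (s := x) (t := t) (by omega)
              fun k h1 h2 => hCi₀ k h1 (by omega)
            omega
          · have h2 := H1 t (by omega)
            have h3 := hcE (y + 1)
            have h4 := hcC (y + 1)
            split_ifs at h3 h4 <;> omega
      have hck3 : CKEquiv (dec C₀ ++ v₀ ++ [x']) ρ := by
        rw [List.append_assoc]
        exact (hv₀.append_left _).trans hWck
      have hr3 := hck3.isReducedWord_iff.2 hr
      obtain ⟨j₁, y₁, hg₁⟩ := exists_grows hr3
      have : (0 : ℕ) = j₁ := hg₁.eq_column fun e => by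
        rw [hck3.colRows_eq hr3, colRows_zero, colRows_zero, (insert_dec_of_dom hdom).1] at e
        have : y ∈ C₀ := by rw [← e]; exact hyC
        simp [hC₀] at this
      exact ⟨_, x', y₁, hck3, this ▸ hg₁⟩
  · obtain ⟨v₀, x, z, hv₀, hg⟩ := ih _ (by omega) (ρ := rest ρ) (j := j) hr.rest (fun e => hj (by
      rw [colRows_add_one, e]; rfl)) rfl
    have hv₀r := hv₀.isReducedWord_iff.2 hr.rest
    have hdom1 : Dom (col ρ) (col (v₀ ++ [x])) := by
      rw [(hv₀.col_rest hv₀r).1]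
      exact hCD
    have hdom0 : Dom (col ρ) (col v₀) := hdom1.subset (hg.subset 0)
    have hck3 : CKEquiv (dec (col ρ) ++ v₀ ++ [x]) ρ := by
      rw [List.append_assoc]
      exact (hv₀.append_left _).trans hck.symm
    have hr3 := hck3.isReducedWord_iff.2 hr
    obtain ⟨j₁, y₁, hg₁⟩ := exists_grows hr3
    have : j + 1 = j₁ := hg₁.eq_column fun e => by
      rw [List.append_assoc, colRows_dec_of_dom hdom1 hv₀r,
        colRows_dec_of_dom hdom0 hv₀r.left] at e
      have := congrArg Finset.card e
      rw [(hdom1.subset (colRows_subset_col _ _)).card_matched,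
        (hdom0.subset (colRows_subset_col _ _)).card_matched, hg.2.1,
        Finset.card_insert_of_notMem hg.1] at this
      omega
    exact ⟨_, x, y₁, hck3, this ▸ hg₁⟩

/-- The blocks of the run factorization of a word together with their rows. -/
def rowBlocks (σ : List ℕ) : List (ℤ × List ℕ) := (wdtRows (runFact σ)).zip (runFact σ)

lemma runFact_flatten (σ : List ℕ) : (runFact σ).flatten = σ := by
  induction σ with
  | nil => rfl
  | cons a σ ih =>
    rw [runFact]
    split
    · next h => rw [h] at ih; simp [← ih]
    · next h =>
      rw [h] at ih
      split_ifs <;> simp [← ih]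

lemma runFact_blocks (σ : List ℕ) : ∀ B ∈ runFact σ, B ≠ [] ∧ B.IsChain (· < ·) := by
  induction σ with
  | nil => simp [runFact]
  | cons a σ ih =>
    rw [runFact]
    split
    · simp
    · next r rs h =>
      rw [h] at ih
      have hr := ih r (by simp)
      split_ifs with ha
      · intro B hB
        rcases List.mem_cons.1 hB with rfl | hB
        · refine ⟨by simp, ?_⟩
          obtain ⟨b, r, rfl⟩ := List.exists_cons_of_ne_nil hr.1
          exact List.isChain_cons_cons.2 ⟨ha, hr.2⟩
        · exact ih B (List.mem_cons_of_mem _ hB)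
      · intro B hB
        rcases List.mem_cons.1 hB with rfl | hB
        · simp
        · exact ih B hB

lemma wdtRowsAux_length (z : ℤ) (bs : List (List ℕ)) : (wdtRowsAux z bs).length = bs.length := by
  induction bs generalizing z with
  | nil => rfl
  | cons b bs ih => simp [wdtRowsAux, ih]

lemma wdtRows_length (bs : List (List ℕ)) : (wdtRows bs).length = bs.length := by
  cases bs with
  | nil => rfl
  | cons b bs => simp [wdtRows, wdtRowsAux_length]

lemma wdtRowsAux_pairwise (z : ℤ) (bs : List (List ℕ)) :
    (z :: wdtRowsAux z bs).Pairwise (· > ·) := by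
  induction bs generalizing z with
  | nil => simp [wdtRowsAux]
  | cons b bs ih =>
    have h := ih (min (z - 1) b.headI)
    rw [wdtRowsAux, List.pairwise_cons]
    refine ⟨fun w hw => ?_, h⟩
    rcases List.mem_cons.1 hw with rfl | hw
    · omega
    · have := (List.pairwise_cons.1 h).1 w hw
      omega

lemma wdtRows_pairwise (bs : List (List ℕ)) : (wdtRows bs).Pairwise (· > ·) := by
  cases bs with
  | nil => simp [wdtRows]
  | cons b bs => exact wdtRowsAux_pairwise _ _

lemma wdtRowsAux_le (z : ℤ) (bs : List (List ℕ)) :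
    ∀ p ∈ (wdtRowsAux z bs).zip bs, p.1 ≤ p.2.headI := by
  induction bs generalizing z with
  | nil => simp [wdtRowsAux]
  | cons b bs ih =>
    intro p hp
    rw [wdtRowsAux, List.zip_cons_cons, List.mem_cons] at hp
    rcases hp with rfl | hp
    · exact min_le_right _ _
    · exact ih _ p hp

lemma rowBlocks_le (σ : List ℕ) : ∀ p ∈ rowBlocks σ, p.1 ≤ p.2.headI := by
  rw [rowBlocks]
  cases runFact σ with
  | nil => simp [wdtRows]
  | cons b bs =>
    intro p hp
    rw [wdtRows, List.zip_cons_cons, List.mem_cons] at hp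
    rcases hp with rfl | hp
    · exact le_rfl
    · exact wdtRowsAux_le _ _ p hp

lemma rowBlocks_map_snd (σ : List ℕ) : (rowBlocks σ).map Prod.snd = runFact σ :=
  List.map_snd_zip (by rw [wdtRows_length])

lemma rowBlocks_map_fst (σ : List ℕ) : (rowBlocks σ).map Prod.fst = wdtRows (runFact σ) :=
  List.map_fst_zip (by rw [wdtRows_length])

lemma rowBlocks_pairwise (σ : List ℕ) : (rowBlocks σ).Pairwise (fun p q => q.1 < p.1) := by
  have := wdtRows_pairwise (runFact σ)
  rwa [← rowBlocks_map_fst, List.pairwise_map] at this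

lemma rowBlocks_snd (σ : List ℕ) {p : ℤ × List ℕ} (hp : p ∈ rowBlocks σ) :
    p.2 ≠ [] ∧ p.2.IsChain (· < ·) ∧ ∀ x ∈ p.2, x ∈ σ := by
  have h1 : p.2 ∈ runFact σ := by
    rw [← rowBlocks_map_snd]
    exact List.mem_map_of_mem hp
  refine ⟨(runFact_blocks σ _ h1).1, (runFact_blocks σ _ h1).2, fun x hx => ?_⟩
  rw [← runFact_flatten σ]
  exact List.mem_flatten_of_mem h1 hx

lemma eq_of_mem_rowBlocks {σ : List ℕ} {p q : ℤ × List ℕ} (hp : p ∈ rowBlocks σ)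
    (hq : q ∈ rowBlocks σ) (h : p.1 = q.1) : p = q := by
  obtain ⟨m, hm, rfl⟩ := List.getElem_of_mem hp
  obtain ⟨n, hn, rfl⟩ := List.getElem_of_mem hq
  have := List.pairwise_iff_getElem.1 (rowBlocks_pairwise σ)
  rcases lt_trichotomy m n with h1 | rfl | h1
  · exact absurd h (this m n hm hn h1).ne'
  · rfl
  · exact absurd h (this n m hn hm h1).ne

lemma weakDesTab_ne_zero {σ : List ℕ} (hσ : PosWord σ) (r : ℤ) (c : ℕ) :
    weakDesTab σ r c ≠ 0 ↔ 1 ≤ c ∧ ∃ p ∈ rowBlocks σ, p.1 = r ∧ c ≤ p.2.length := by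
  rcases c with _ | c
  · simp [weakDesTab]
  rw [weakDesTab, if_neg (by omega)]
  change (match (rowBlocks σ).find? (fun p => decide (p.1 = r)) with
    | some p => p.2.getD c 0
    | none => 0) ≠ 0 ↔ _
  split
  · next p h =>
    have h1 : p.1 = r := by simpa using List.find?_some h
    have h2 := List.mem_of_find?_eq_some h
    constructor
    · intro h3
      refine ⟨by omega, p, h2, h1, ?_⟩
      by_contra h4
      exact h3 (List.getD_eq_default _ _ (by omega))
    · rintro ⟨-, q, hq, hqr, hc⟩
      obtain rfl := eq_of_mem_rowBlocks h2 hq (h1.trans hqr.symm)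
      rw [List.getD_eq_getElem _ _ (show c < p.2.length by omega)]
      have := hσ _ ((rowBlocks_snd σ h2).2.2 _ (List.getElem_mem (show c < p.2.length by omega)))
      omega
  · next h =>
    simp only [ne_eq, not_true_eq_false, false_iff, not_and, not_exists]
    intro _ p hp hpr
    simpa [hpr] using List.find?_eq_none.1 h p hp

lemma ncard_le_length (n : ℕ) : Set.ncard {c : ℕ | 1 ≤ c ∧ c ≤ n} = n := by
  have : {c : ℕ | 1 ≤ c ∧ c ≤ n} = ↑(Finset.Icc 1 n) := by ext; simp
  rw [this, Set.ncard_coe_finset]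
  simp

lemma desComp_eq_length {σ : List ℕ} (hσ : PosWord σ) {i : ℕ} {p : ℤ × List ℕ}
    (hp : p ∈ rowBlocks σ) (hi : p.1 = i) : desComp σ i = p.2.length := by
  rw [desComp, shapeOf, ← ncard_le_length p.2.length]
  congr 1
  ext c
  simp only [Set.mem_ofPred_eq, weakDesTab_ne_zero hσ]
  refine and_congr_right fun _ => ⟨?_, fun h => ⟨p, hp, hi, h⟩⟩
  rintro ⟨q, hq, hqi, hc⟩
  rwa [eq_of_mem_rowBlocks hp hq (hi.trans hqi.symm)]

lemma desComp_eq_zero {σ : List ℕ} (hσ : PosWord σ) {i : ℕ}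
    (h : ∀ p ∈ rowBlocks σ, p.1 ≠ i) : desComp σ i = 0 := by
  rw [desComp, shapeOf]
  convert Set.ncard_empty ℕ
  ext c
  simp only [Set.mem_ofPred_eq, weakDesTab_ne_zero hσ, Set.mem_empty_iff_false, iff_false]
  rintro ⟨-, q, hq, hqi, -⟩
  exact h q hq hqi

/-- The shape of the weak descent tableau of a nonvirtual word determines its boxes. -/
lemma weakDesTab_ne_zero_iff_le_desComp {σ : List ℕ} (hσ : PosWord σ) (hv : NonVirtual σ) (r : ℤ)
    (c : ℕ) : weakDesTab σ r c ≠ 0 ↔ 1 ≤ r ∧ 1 ≤ c ∧ c ≤ desComp σ r.toNat := by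
  rw [weakDesTab_ne_zero hσ]
  constructor
  · rintro ⟨h1, p, hp, rfl, hc⟩
    have h2 : 1 ≤ p.1 := hv _ (by rw [← rowBlocks_map_fst]; exact List.mem_map_of_mem hp)
    refine ⟨h2, h1, ?_⟩
    rwa [desComp_eq_length hσ hp (by omega)]
  · rintro ⟨h1, h2, h3⟩
    refine ⟨h2, ?_⟩
    by_contra! hh
    have : desComp σ r.toNat = 0 := by
      by_cases h : ∃ p ∈ rowBlocks σ, p.1 = r
      · obtain ⟨p, hp, hpr⟩ := h
        have := hh p hp hpr
        rw [← desComp_eq_length hσ hp (i := r.toNat) (by omega)] at this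
        omega
      · push Not at h
        exact desComp_eq_zero hσ fun p hp => by have := h p hp; omega
    omega

/-- The total length of the blocks in rows above `k`. -/
def lengthAbove (k : ℕ) (L : List (ℤ × List ℕ)) : ℕ :=
  ((L.filter fun p => decide ((k : ℤ) < p.1)).map fun p => p.2.length).sum

lemma desComp_eq_sum {σ : List ℕ} (hσ : PosWord σ) (i : ℕ) : desComp σ i =
    (((rowBlocks σ).filter fun p => decide (p.1 = (i : ℤ))).map fun p => p.2.length).sum := by
  by_cases h : ∃ p ∈ rowBlocks σ, p.1 = i
  · obtain ⟨p, hp, hpi⟩ := h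
    rw [desComp_eq_length hσ hp hpi]
    have : (rowBlocks σ).filter (fun p => decide (p.1 = (i : ℤ))) = [p] := by
      have hn : (rowBlocks σ).Nodup :=
        (rowBlocks_pairwise σ).imp fun h e => by rw [e] at h; exact lt_irrefl _ h
      have h2 : List.Perm ((rowBlocks σ).filter (fun p => decide (p.1 = (i : ℤ)))) [p] := by
        refine (List.perm_ext_iff_of_nodup (hn.filter _) (by simp)).2 fun q => ?_
        simp only [List.mem_filter, decide_eq_true_eq, List.mem_singleton]
        exact ⟨fun h => eq_of_mem_rowBlocks h.1 hp (h.2.trans hpi.symm),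
          fun h => h ▸ ⟨hp, hpi⟩⟩
      exact List.perm_singleton.1 h2
    simp [this]
  · push Not at h
    rw [desComp_eq_zero hσ h, List.filter_eq_nil_iff.2 (by simpa using h)]
    rfl

lemma sum_filter_Icc {L : List (ℤ × List ℕ)} (hL : ∀ p ∈ L, 1 ≤ p.1) (k : ℕ) :
    ∑ i ∈ Finset.Icc 1 k, ((L.filter fun p => decide (p.1 = (i : ℤ))).map fun p => p.2.length).sum +
      lengthAbove k L = (L.map Prod.snd).flatten.length := by
  induction L with
  | nil => simp [lengthAbove]
  | cons p L ih =>
    have ih := ih fun q hq => hL q (List.mem_cons_of_mem _ hq)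
    have hp := hL p (by simp)
    have h1 : ∀ i : ℕ,
        (((p :: L).filter fun p => decide (p.1 = (i : ℤ))).map fun p => p.2.length).sum =
        (if p.1.toNat = i then p.2.length else 0) +
          ((L.filter fun p => decide (p.1 = (i : ℤ))).map fun p => p.2.length).sum := by
      intro i
      rw [List.filter_cons]
      by_cases h : p.1 = i
      · simp [h]
      · have : p.1.toNat ≠ i := by omega
        simp [h, this]
    have h2 : lengthAbove k (p :: L) = (if (k : ℤ) < p.1 then p.2.length else 0) +
        lengthAbove k L := by
      rw [lengthAbove, List.filter_cons]
      by_cases h : (k : ℤ) < p.1 <;> simp [h, lengthAbove]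
    simp only [h1, h2, Finset.sum_add_distrib, Finset.sum_ite_eq, Finset.mem_Icc, List.map_cons,
      List.flatten_cons, List.length_append]
    split_ifs <;> omega

/-- Partial sums of the weak descent composition. -/
lemma sum_desComp {σ : List ℕ} (hσ : PosWord σ) (hv : NonVirtual σ) (k : ℕ) :
    ∑ i ∈ Finset.Icc 1 k, desComp σ i + lengthAbove k (rowBlocks σ) = σ.length := by
  simp only [desComp_eq_sum hσ]
  rw [sum_filter_Icc, rowBlocks_map_snd, runFact_flatten]
  exact fun p hp => hv _ (by rw [← rowBlocks_map_fst]; exact List.mem_map_of_mem hp)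

/-- The blocks in rows above `k` form a prefix with letters greater than `k`. -/
lemma exists_prefix_lengthAbove (σ : List ℕ) (k : ℕ) : ∃ τ υ, σ = τ ++ υ ∧
    lengthAbove k (rowBlocks σ) = τ.length ∧ ∀ x ∈ τ, k < x := by
  set L := rowBlocks σ with hL
  have hpre : ∀ L : List (ℤ × List ℕ), L.Pairwise (fun p q => q.1 < p.1) →
      ∃ L', L = (L.filter fun p => decide ((k : ℤ) < p.1)) ++ L' := by
    intro L h
    induction L with
    | nil => exact ⟨[], rfl⟩
    | cons p L ih =>
      rw [List.pairwise_cons] at h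
      by_cases hp : (k : ℤ) < p.1
      · obtain ⟨L', e⟩ := ih h.2
        refine ⟨L', ?_⟩
        rw [List.filter_cons_of_pos (by simpa using hp), List.cons_append, ← e]
      · refine ⟨p :: L, ?_⟩
        rw [List.filter_eq_nil_iff.2, List.nil_append]
        intro q hq
        rcases List.mem_cons.1 hq with rfl | hq
        · simpa using hp
        · have := h.1 q hq
          simp
          omega
  obtain ⟨L', e⟩ := hpre L (rowBlocks_pairwise σ)
  set M := L.filter fun p => decide ((k : ℤ) < p.1) with hM
  refine ⟨(M.map Prod.snd).flatten, (L'.map Prod.snd).flatten, ?_, ?_, ?_⟩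
  · rw [← List.flatten_append, ← List.map_append, ← e, hL, rowBlocks_map_snd, runFact_flatten]
  · rw [List.length_flatten, List.map_map]
    rfl
  · intro x hx
    obtain ⟨B, hB, hx⟩ := List.mem_flatten.1 hx
    obtain ⟨p, hp, rfl⟩ := List.mem_map.1 hB
    rw [hM, List.mem_filter] at hp
    have h1 : (k : ℤ) < p.1 := by simpa using hp.2
    have h2 := rowBlocks_le σ p hp.1
    obtain ⟨h3, h4, -⟩ := rowBlocks_snd σ hp.1
    obtain ⟨b, l, e⟩ := List.exists_cons_of_ne_nil h3
    rw [e] at h2 h4 hx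
    have h5 := List.pairwise_cons.1 (List.isChain_iff_pairwise.1 h4)
    simp only [List.headI_cons] at h2
    rcases List.mem_cons.1 hx with rfl | hx
    · omega
    · have := h5.1 x hx
      omega

lemma runFact_append {B w : List ℕ} (hne : B ≠ []) (hB : B.IsChain (· < ·))
    (hw : w = [] ∨ w.headI ≤ B.headI) : runFact (B ++ w) = B :: runFact w := by
  have hh : ∀ w : List ℕ, w ≠ [] → (runFact w).headI.headI = w.headI ∧ runFact w ≠ [] := by
    intro w hw
    have h1 := runFact_flatten w
    have h2 := runFact_blocks w
    rcases hr : runFact w with _ | ⟨r, rs⟩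
    · rw [hr] at h1
      exact absurd h1.symm hw
    · rw [hr] at h1 h2
      obtain ⟨b, l, e⟩ := List.exists_cons_of_ne_nil (h2 r (by simp)).1
      subst e
      simp [← h1]
  induction B with
  | nil => exact absurd rfl hne
  | cons b B ih =>
    rcases B with _ | ⟨b', B⟩
    · rw [List.singleton_append, runFact]
      rcases hr : runFact w with _ | ⟨r, rs⟩
      · rfl
      · have hwne : w ≠ [] := by rintro rfl; simp [runFact] at hr
        have h1 := (hh w hwne).1
        rw [hr] at h1
        have h2 := hw.resolve_left hwne
        simp only [List.headI_cons] at h1 h2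
        simp only
        rw [if_neg (by omega)]
    · rw [List.isChain_cons_cons] at hB
      rw [List.cons_append, runFact, ih (by simp) hB.2
        (hw.imp_right fun h => h.trans hB.1.le)]
      simp [hB.1]

lemma runFact_flatten_of_pairwise {Bs : List (List ℕ)}
    (hB : ∀ B ∈ Bs, B ≠ [] ∧ B.IsChain (· < ·)) (hh : Bs.Pairwise fun B B' => B'.headI < B.headI) :
    runFact Bs.flatten = Bs := by
  induction Bs with
  | nil => rfl
  | cons B Bs ih =>
    rw [List.pairwise_cons] at hh
    have ih := ih (fun B' h => hB B' (List.mem_cons_of_mem _ h)) hh.2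
    obtain ⟨h1, h2⟩ := hB B (by simp)
    rw [List.flatten_cons, runFact_append h1 h2, ih]
    rcases Bs with _ | ⟨B', Bs⟩
    · exact Or.inl rfl
    · right
      obtain ⟨b, l, e⟩ := List.exists_cons_of_ne_nil (hB B' (by simp)).1
      have := hh.1 B' (by simp)
      rw [e] at this ⊢
      exact this.le

lemma wdtRows_of_pairwise {Bs : List (List ℕ)} (hh : Bs.Pairwise fun B B' => B'.headI < B.headI) :
    wdtRows Bs = Bs.map fun B => (B.headI : ℤ) := by
  have aux : ∀ (Bs : List (List ℕ)) (z : ℤ), (∀ B ∈ Bs, (B.headI : ℤ) < z) →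
      Bs.Pairwise (fun B B' => B'.headI < B.headI) →
      wdtRowsAux z Bs = Bs.map fun B => (B.headI : ℤ) := by
    intro Bs
    induction Bs with
    | nil => intros; rfl
    | cons B Bs ih =>
      intro z hz hh
      rw [List.pairwise_cons] at hh
      have h1 := hz B (by simp)
      have : min (z - 1) (B.headI : ℤ) = B.headI := by omega
      rw [wdtRowsAux, this, ih _ (fun B' h => by exact_mod_cast hh.1 B' h) hh.2]
      rfl
  rcases Bs with _ | ⟨B, Bs⟩
  · rfl
  · rw [List.pairwise_cons] at hh
    rw [wdtRows, aux _ _ (fun B' h => by exact_mod_cast hh.1 B' h) hh.2]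
    rfl

lemma rowBlocks_flatten_of_pairwise {Bs : List (List ℕ)}
    (hB : ∀ B ∈ Bs, B ≠ [] ∧ B.IsChain (· < ·)) (hh : Bs.Pairwise fun B B' => B'.headI < B.headI) :
    rowBlocks Bs.flatten = Bs.map fun B => ((B.headI : ℤ), B) := by
  rw [rowBlocks, runFact_flatten_of_pairwise hB hh, wdtRows_of_pairwise hh]
  clear hB hh
  induction Bs with
  | nil => rfl
  | cons B Bs ih => simp [ih]

lemma mem_of_mem_col {ρ : List ℕ} (h : Adm ρ) {r : ℕ} (hr : r ∈ col ρ) : r ∈ ρ := by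
  induction ρ with
  | nil => simp at hr
  | cons a ρ ih =>
    have ih := ih (adm_cons.1 h).2
    rw [col_cons] at hr
    rcases ins_cases (adm_cons.1 h).1 with ⟨-, h⟩ | ⟨-, -, h⟩ | ⟨b, -, -, -, -, h⟩ <;>
      rw [h.1] at hr <;> grind

lemma exists_mem_col_le {ρ : List ℕ} (h : Adm ρ) {x : ℕ} (hx : x ∈ ρ) : ∃ m ∈ col ρ, m ≤ x := by
  induction ρ generalizing x with
  | nil => simp at hx
  | cons a ρ ih =>
    have ih := fun x hx => ih (adm_cons.1 h).2 (x := x) hx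
    rw [col_cons]
    rcases ins_cases (adm_cons.1 h).1 with ⟨-, h⟩ | ⟨ha, -, h⟩ | ⟨b, -, -, hab, -, h⟩ <;>
      rw [h.1] <;> rcases List.mem_cons.1 hx with rfl | hx
    · exact ⟨x, by simp, le_rfl⟩
    · obtain ⟨m, hm, hmx⟩ := ih x hx
      exact ⟨m, by simp [hm], hmx⟩
    · exact ⟨x, ha, le_rfl⟩
    · exact ih x hx
    · exact ⟨x, by simp, le_rfl⟩
    · obtain ⟨m, hm, hmx⟩ := ih x hx
      by_cases hmb : m = b
      · exact ⟨a, by simp, by omega⟩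
      · exact ⟨m, by simp [hm, hmb], hmx⟩

lemma mem_of_mem_colRows {ρ : List ℕ} (h : IsReducedWord ρ) {c r : ℕ} (hr : r ∈ colRows c ρ) :
    r ∈ ρ := mem_of_mem_col h.adm (colRows_subset_col c ρ hr)

/-- The columns of the insertion tableau have as many boxes as the word has letters. -/
lemma sum_card_colRows {ρ : List ℕ} (h : IsReducedWord ρ) {n : ℕ} (hn : ρ.length ≤ n) :
    ∑ c ∈ Finset.range n, (colRows c ρ).card = ρ.length := by
  induction n generalizing ρ with
  | zero => simpa using hn.antisymm' (Nat.zero_le _)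
  | succ n ih =>
    by_cases hne : ρ = []
    · simp [hne]
    have h1 := length_rest_lt h hne
    have h2 := length_col_add_rest h.adm
    have h3 := ih h.rest (by omega)
    rw [Finset.sum_range_succ', colRows_zero]
    have h4 : ∀ c, (colRows (c + 1) ρ).card = (colRows c (rest ρ)).card := fun c =>
      (h.adm.dom_colRows c).card_matched
    simp only [h4]
    omega

lemma colRows_eq_empty {ρ : List ℕ} (h : IsReducedWord ρ) {c : ℕ} (hc : ρ.length ≤ c) :
    colRows c ρ = ∅ := by
  have h1 := sum_card_colRows h hc
  have h2 := sum_card_colRows h (hc.trans (Nat.le_succ c))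
  rw [Finset.sum_range_succ] at h2
  exact Finset.card_eq_zero.1 (by omega)

lemma colRows_subset_append {ρ u : List ℕ} (h : IsReducedWord (ρ ++ u)) (c : ℕ) :
    colRows c ρ ⊆ colRows c (ρ ++ u) := by
  induction u using List.reverseRecOn with
  | nil => simp
  | append_singleton u x ih =>
    rw [← List.append_assoc] at h ⊢
    obtain ⟨j, y, hg⟩ := exists_grows h
    exact (ih h.left).trans (hg.subset c)

/-- The bottom row of the insertion tableau can be split off as an increasing block. -/
lemma exists_block_of_min {ρ : List ℕ} {m p : ℕ} (h : IsReducedWord ρ)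
    (hm : ∀ r ∈ col ρ, m ≤ r) (hp : ∀ c, m ∈ colRows c ρ ↔ c < p) :
    ∃ ρ₀ F, CKEquiv (ρ₀ ++ F) ρ ∧ F.length = p ∧ F.IsChain (· < ·) ∧
      (∀ c, colRows c ρ₀ = (colRows c ρ).erase m) ∧
      ∀ F' x, F = F' ++ [x] → Grows (ρ₀ ++ F') x (p - 1) m := by
  induction p generalizing ρ with
  | zero =>
    refine ⟨ρ, [], by simpa using CKEquiv.refl ρ, rfl, .nil, fun c => ?_, by simp⟩
    exact (Finset.erase_eq_of_notMem fun h => by simpa using (hp c).1 h).symm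
  | succ p ih =>
    have h1 : m ∈ colRows p ρ := (hp p).2 (by omega)
    have h2 : m ∉ colRows (p + 1) ρ := fun h => by simpa using (hp _).1 h
    obtain ⟨ρ₁, x, y, hck, hg⟩ := exists_grows_of_ne h (j := p) fun e => h2 (e ▸ h1)
    have hr1 := hck.isReducedWord_iff.2 h
    have hc := hck.colRows_eq hr1
    have hy : y = m := by
      by_contra hne
      have h3 : m ∈ colRows p ρ₁ := by
        rw [← hc, hg.2.1] at h1
        exact (Finset.mem_insert.1 h1).resolve_left (Ne.symm hne)
      have h4 := hg.2.2.2 m h3 (by rwa [← hg.2.2.1 _ (by omega), hc])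
      have h5 : y ∈ colRows p ρ := by
        rw [← hc, hg.2.1]
        exact Finset.mem_insert_self _ _
      have := hm y (colRows_subset_col _ _ h5)
      omega
    subst hy
    have hcp : ∀ c, colRows c ρ₁ = if c = p then (colRows c ρ).erase y else colRows c ρ := by
      intro c
      split_ifs with e
      · rw [e, ← hc, hg.2.1, Finset.erase_insert hg.1]
      · rw [← hc, hg.2.2.1 c e]
    obtain ⟨ρ₀, F, hF, hlen, hch, hcol, hlast⟩ := ih hr1.left (fun r hr => hm r (by
      rw [← colRows_zero, ← hc]
      exact hg.subset 0 hr)) (fun c => by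
      rw [hcp]
      have := hp c
      split_ifs with e
      · simp [e]
      · rw [this]; omega)
    have hFx : CKEquiv (ρ₀ ++ F ++ [x]) ρ := (hF.append_right [x]).trans hck
    have hFr := hFx.isReducedWord_iff.2 h
    have hg' : Grows (ρ₀ ++ F) x p y := hg.congr hr1 hF.symm
    refine ⟨ρ₀, F ++ [x], by rwa [← List.append_assoc], by simp [hlen], ?_, fun c => ?_, ?_⟩
    · rcases List.eq_nil_or_concat F with rfl | ⟨F', x', rfl⟩
      · simp
      rw [List.concat_eq_append] at *
      rw [List.isChain_append]
      refine ⟨hch, by simp, ?_⟩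
      simp only [List.getLast?_append, List.getLast?_singleton, List.head?_cons,
        Option.mem_def, Option.some_or, Option.some.injEq, forall_eq']
      have hl := hlast F' x' rfl
      have hp1 : 1 ≤ p := by rw [← hlen]; simp
      rw [← List.append_assoc] at hg' hFr
      rcases lt_trichotomy x' x with h3 | rfl | h3
      · exact h3
      · rw [List.append_assoc] at hFr
        exact absurd hFr.right (not_isReducedWord_pair x')
      · have := hl.le_of_gt hFr h3 hg'
        omega
    · rw [hcol, hcp]
      split_ifs with e
      · simp
      · rfl
    · intro F' z e
      obtain ⟨rfl, e⟩ := List.append_inj' e rfl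
      obtain rfl : x = z := by simpa using e
      exact hg'

/-- Every reduced word is Coxeter-Knuth equivalent to one whose increasing blocks are the rows of
the insertion tableau. -/
theorem exists_row_blocks {ρ : List ℕ} (h : IsReducedWord ρ) :
    ∃ Bs : List (List ℕ), (∀ B ∈ Bs, B ≠ [] ∧ B.IsChain (· < ·)) ∧
      (Bs.Pairwise fun B B' => B'.headI < B.headI) ∧ CKEquiv Bs.flatten ρ ∧
      ∀ r c, r ∈ colRows c ρ ↔ ∃ B ∈ Bs, B.headI = r ∧ c < B.length := by
  induction hn : ρ.length using Nat.strong_induction_on generalizing ρ with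
  | _ n ih =>
  by_cases hne : ρ = []
  · subst hne
    exact ⟨[], by simp, by simp, CKEquiv.refl _, by simp⟩
  have hcne := h.adm.col_nonempty hne
  set m := (col ρ).min' hcne with hmdef
  have hmin : ∀ r ∈ col ρ, m ≤ r := fun r hr => Finset.min'_le _ _ hr
  have hmem : m ∈ col ρ := Finset.min'_mem _ _
  have hex : ∃ p, m ∉ colRows p ρ := ⟨ρ.length, by simp [colRows_eq_empty h le_rfl]⟩
  classical
  obtain ⟨p, hp⟩ : ∃ p, ∀ c, m ∈ colRows c ρ ↔ c < p := by
    refine ⟨Nat.find hex, fun c => ⟨fun h1 => ?_, fun h1 => not_not.1 (Nat.find_min hex h1)⟩⟩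
    by_contra h2
    exact Nat.find_spec hex (colRows_subset (not_lt.1 h2) ρ h1)
  have hp0 : 0 < p := (hp 0).1 hmem
  obtain ⟨ρ₀, F, hck, hlen, hch, hcol, -⟩ := exists_block_of_min h hmin hp
  have hr := hck.isReducedWord_iff.2 h
  have hFne : F ≠ [] := by
    rintro rfl
    simp at hlen
    omega
  have hcol0 : col ρ₀ = (col ρ).erase m := hcol 0
  have hge : ∀ x ∈ ρ₀ ++ F, m ≤ x := by
    intro x hx
    obtain ⟨r, hr1, hr2⟩ := exists_mem_col_le hr.adm hx
    rw [(hck.col_rest hr).1] at hr1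
    exact (hmin r hr1).trans hr2
  have hmF : m ∈ F := by
    have h1 : m ∈ ρ₀ ++ F := mem_of_mem_col hr.adm (by rwa [(hck.col_rest hr).1])
    refine (List.mem_append.1 h1).resolve_left fun h2 => ?_
    obtain ⟨r, hr1, hr2⟩ := exists_mem_col_le hr.left.adm h2
    rw [hcol0, Finset.mem_erase] at hr1
    have := hmin r hr1.2
    omega
  have hhead : F.headI = m := by
    obtain ⟨b, l, rfl⟩ := List.exists_cons_of_ne_nil hFne
    rcases List.mem_cons.1 hmF with h1 | h1
    · exact h1.symm
    · have h2 := (List.pairwise_cons.1 (List.isChain_iff_pairwise.1 hch)).1 m h1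
      have := hge b (by simp)
      omega
  have hl := hck.length_eq
  rw [List.length_append] at hl
  obtain ⟨Bs, hB, hh, hf, hcs⟩ := ih ρ₀.length (by omega) hr.left rfl
  refine ⟨Bs ++ [F], ?_, ?_, ?_, ?_⟩
  · intro B hB'
    rcases List.mem_append.1 hB' with h1 | h1
    · exact hB B h1
    · rw [List.mem_singleton.1 h1]
      exact ⟨hFne, hch⟩
  · rw [List.pairwise_append]
    refine ⟨hh, by simp, fun B hB1 B' hB2 => ?_⟩
    rw [List.mem_singleton.1 hB2, hhead]
    have h1 := (hcs B.headI 0).2 ⟨B, hB1, rfl, List.length_pos_iff.2 (hB B hB1).1⟩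
    rw [colRows_zero, hcol0, Finset.mem_erase] at h1
    have := hmin _ h1.2
    omega
  · rw [List.flatten_append, List.flatten_singleton]
    exact (hf.append_right F).trans hck
  · intro r c
    have h1 := hcs r c
    rw [hcol, Finset.mem_erase] at h1
    simp only [List.mem_append, List.mem_singleton, or_and_right, exists_or, exists_eq_left,
      ← h1, hhead, hlen]
    by_cases hrm : r = m
    · subst hrm
      simp [hp]
    · simp [hrm, Ne.symm hrm]

lemma sum_card_colRows_le_lengthAbove {ρ : List ℕ} {Bs : List (List ℕ)}
    (hc : ∀ r c, r ∈ colRows c ρ ↔ ∃ B ∈ Bs, B.headI = r ∧ c < B.length) (n k : ℕ) :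
    ∑ c ∈ Finset.range n, ((colRows c ρ).filter (k < ·)).card ≤
      lengthAbove k (Bs.map fun B => ((B.headI : ℤ), B)) := by
  have h1 : ∀ c, ((colRows c ρ).filter (k < ·)).card ≤
      (Bs.filter fun B => decide (k < B.headI ∧ c < B.length)).length := by
    intro c
    have : (colRows c ρ).filter (k < ·) ⊆
        ((Bs.filter fun B => decide (k < B.headI ∧ c < B.length)).map List.headI).toFinset := by
      intro r hr
      rw [Finset.mem_filter, hc] at hr
      obtain ⟨⟨B, hB, rfl, hcB⟩, hk⟩ := hr
      rw [List.mem_toFinset, List.mem_map]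
      exact ⟨B, by simp [hB, hcB, hk], rfl⟩
    exact (Finset.card_le_card this).trans ((List.toFinset_card_le _).trans (by simp))
  refine (Finset.sum_le_sum fun c _ => h1 c).trans ?_
  clear hc h1
  induction Bs with
  | nil => simp [lengthAbove]
  | cons B Bs ih =>
    have h2 : lengthAbove k ((B :: Bs).map fun B => ((B.headI : ℤ), B)) =
        (if k < B.headI then B.length else 0) +
          lengthAbove k (Bs.map fun B => ((B.headI : ℤ), B)) := by
      rw [lengthAbove, List.map_cons, List.filter_cons]
      by_cases h : k < B.headI <;> simp [h, lengthAbove]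
    have h3 : ∀ c, ((B :: Bs).filter fun B => decide (k < B.headI ∧ c < B.length)).length =
        (if k < B.headI ∧ c < B.length then 1 else 0) +
          (Bs.filter fun B => decide (k < B.headI ∧ c < B.length)).length := by
      intro c
      rw [List.filter_cons]
      by_cases h : k < B.headI ∧ c < B.length
      · rw [if_pos (by simpa using h), if_pos h, List.length_cons, add_comm]
      · rw [if_neg (by simpa using h), if_neg h, zero_add]
    simp only [h3, Finset.sum_add_distrib]
    rw [h2]
    refine Nat.add_le_add ?_ ih
    by_cases h : k < B.headI
    · simp only [h, true_and, if_true]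
      rw [← Finset.card_filter]
      refine (Finset.card_le_card (t := Finset.range B.length) fun c hc => ?_).trans (by simp)
      simp at hc ⊢
      exact hc.2
    · simp [h]

/-- The row word of the insertion tableau is a Yamanouchi word. -/
theorem yamanouchi_of_row_blocks {ρ : List ℕ} (h : IsReducedWord ρ) {Bs : List (List ℕ)}
    (hB : ∀ B ∈ Bs, B ≠ [] ∧ B.IsChain (· < ·))
    (hh : Bs.Pairwise fun B B' => B'.headI < B.headI) (hck : CKEquiv Bs.flatten ρ)
    (hc : ∀ r c, r ∈ colRows c ρ ↔ ∃ B ∈ Bs, B.headI = r ∧ c < B.length) :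
    Yamanouchi Bs.flatten := by
  have hr := hck.isReducedWord_iff.2 h
  have hrows := rowBlocks_flatten_of_pairwise hB hh
  have hv : NonVirtual Bs.flatten := by
    intro z hz
    rw [← rowBlocks_map_fst, hrows, List.map_map, List.mem_map] at hz
    obtain ⟨B, hB', rfl⟩ := hz
    obtain ⟨b, l, e⟩ := List.exists_cons_of_ne_nil (hB B hB').1
    have := hr.1 b (List.mem_flatten.2 ⟨B, hB', by simp [e]⟩)
    simp [e]
    omega
  refine ⟨hr, hv, fun σ hσv hσ k => ?_⟩
  have hσr := hσ.isReducedWord_iff.1 hr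
  have h1 := sum_desComp hr.1 hv k
  have h2 := sum_desComp hσr.1 hσv k
  have h3 := hσ.length_eq
  obtain ⟨τ, υ, e, h4, h5⟩ := exists_prefix_lengthAbove σ k
  have hτr : IsReducedWord (τ ++ υ) := e ▸ hσr
  have h6 := sum_card_colRows_le_lengthAbove hc τ.length k
  rw [← hrows] at h6
  have h7 := sum_card_colRows hτr.left le_rfl
  have h8 : ∑ c ∈ Finset.range τ.length, (colRows c τ).card ≤
      ∑ c ∈ Finset.range τ.length, ((colRows c ρ).filter (k < ·)).card := by
    refine Finset.sum_le_sum fun c _ => Finset.card_le_card fun r hr' => ?_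
    rw [Finset.mem_filter]
    refine ⟨?_, h5 r (mem_of_mem_colRows hτr.left hr')⟩
    rw [(hck.symm.trans hσ).colRows_eq h, e]
    exact colRows_subset_append hτr c hr'
  omega

lemma compLE.antisymm {μ ν : ℕ → ℕ} (h : compLE μ ν) (h' : compLE ν μ) {i : ℕ} (hi : 1 ≤ i) :
    μ i = ν i := by
  obtain ⟨k, rfl⟩ : ∃ k, i = k + 1 := ⟨i - 1, by omega⟩
  have h1 := (h k).antisymm (h' k)
  have h2 := (h (k + 1)).antisymm (h' (k + 1))
  rw [Finset.sum_Icc_succ_top (by omega), Finset.sum_Icc_succ_top (by omega)] at h2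
  omega

/-- The boxes of the weak Edelman-Greene insertion tableau of a reduced word. -/
theorem hatP_ne_zero {ρ : List ℕ} (h : IsReducedWord ρ) (r : ℤ) (c : ℕ) :
    hatP ρ r c ≠ 0 ↔ 1 ≤ r ∧ 1 ≤ c ∧ r.toNat ∈ colRows (c - 1) ρ := by
  obtain ⟨Bs, hB, hh, hck, hcol⟩ := exists_row_blocks h
  have hY := yamanouchi_of_row_blocks h hB hh hck hcol
  have hex : ∃ σ, Yamanouchi σ ∧ CKEquiv ρ σ := ⟨_, hY, hck.symm⟩
  obtain ⟨hσ, hσρ⟩ := hex.choose_spec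
  rw [hatP, hatRho, dif_pos hex]
  set σ := hex.choose
  rw [weakDesTab_ne_zero_iff_le_desComp hσ.1.1 hσ.2.1]
  refine and_congr_right fun hr => and_congr_right fun hc => ?_
  have e : CKEquiv Bs.flatten σ := hck.trans hσρ
  rw [← (hY.2.2 σ hσ.2.1 e).antisymm (hσ.2.2 _ hY.2.1 e.symm) (i := r.toNat) (by omega)]
  have h1 := weakDesTab_ne_zero_iff_le_desComp hY.1.1 hY.2.1 r c
  rw [weakDesTab_ne_zero hY.1.1, rowBlocks_flatten_of_pairwise hB hh] at h1
  rw [hcol]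
  constructor
  · intro h2
    obtain ⟨-, p, hp, hpr, hcp⟩ := h1.2 ⟨hr, hc, h2⟩
    obtain ⟨B, hB', rfl⟩ := List.mem_map.1 hp
    exact ⟨B, hB', by simp only at hpr; omega, by simp only at hcp; omega⟩
  · rintro ⟨B, hB', hBr, hcB⟩
    exact (h1.1 ⟨hc, _, List.mem_map_of_mem hB', by simp only; omega, by simp only; omega⟩).2.2

/-- The boxes added by an increasing block: there is at most one in every column, and the boxes
below it in that column are followed by a box in their row. -/
theorem boxes_of_increasing {ρ F : List ℕ} (h : IsReducedWord (ρ ++ F))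
    (hF : F.IsChain (· < ·)) (c : ℕ) :
    (∀ r ∈ colRows c (ρ ++ F), ∀ r' ∈ colRows c (ρ ++ F), r ∉ colRows c ρ → r' ∉ colRows c ρ →
      r = r') ∧
    ∀ r' ∈ colRows c (ρ ++ F), r' ∉ colRows c ρ → ∀ r ∈ colRows c ρ, r < r' →
      r ∈ colRows (c + 1) ρ := by
  suffices H : ∃ j, (∀ c, j ≤ c → colRows c (ρ ++ F) = colRows c ρ) ∧
      (j = 0 ∨ ∃ F' x j' y, F = F' ++ [x] ∧ Grows (ρ ++ F') x j' y ∧ j = j' + 1) ∧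
      ∀ c, (∀ r ∈ colRows c (ρ ++ F), ∀ r' ∈ colRows c (ρ ++ F), r ∉ colRows c ρ →
        r' ∉ colRows c ρ → r = r') ∧
      ∀ r' ∈ colRows c (ρ ++ F), r' ∉ colRows c ρ → ∀ r ∈ colRows c ρ, r < r' →
        r ∈ colRows (c + 1) ρ from H.choose_spec.2.2 c
  clear c
  induction F using List.reverseRecOn with
  | nil => exact ⟨0, by simp, by simp, by simp; grind⟩
  | append_singleton F x ih =>
    rw [← List.append_assoc] at h ⊢
    obtain ⟨j, hj, hlast, hc⟩ := ih h.left (List.isChain_append.1 hF).1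
    obtain ⟨j', y, hg⟩ := exists_grows h
    have hjj : j ≤ j' := by
      rcases hlast with rfl | ⟨F', x', j₁, y₁, rfl, hg₁, rfl⟩
      · exact Nat.zero_le _
      · have hx : x' < x := by
          rw [List.isChain_append] at hF
          simpa using hF.2.2
        rw [← List.append_assoc] at hg h
        exact hg₁.lt_of_lt h hx hg
    refine ⟨j' + 1, fun c hc' => ?_, Or.inr ⟨F, x, j', y, rfl, hg, rfl⟩, fun c => ?_⟩
    · rw [hg.2.2.1 c (by omega), hj c (by omega)]
    · by_cases hcj : c = j'
      · subst hcj
        have h1 := hg.2.1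
        have h2 := hg.2.2.2
        rw [hj c hjj] at h1 h2
        rw [hj _ (by omega)] at h2
        rw [h1]
        refine ⟨by grind, fun r' hr' hn r hr hlt => ?_⟩
        obtain rfl : r' = y := by grind
        by_contra hh
        have := h2 r hr hh
        omega
      · rw [hg.2.2.1 c hcj]
        exact hc c

lemma foldr_filter_range (f : ℕ → List ℕ) (p : ℕ → ℕ → Bool) (hp : ∀ i j, p i j = true ↔ i ≤ j)
    (N i : ℕ) :
    (N ≤ i → ((((List.range N).reverse).filter (p i)).map f).foldr (· ++ ·) [] = []) ∧
    (i < N → ((((List.range N).reverse).filter (p i)).map f).foldr (· ++ ·) [] =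
      ((((List.range N).reverse).filter (p (i + 1))).map f).foldr (· ++ ·) [] ++ f i) := by
  have hs : ∀ N i, ((((List.range (N + 1)).reverse).filter (p i)).map f).foldr (· ++ ·) [] =
      (if i ≤ N then f N else []) ++
        ((((List.range N).reverse).filter (p i)).map f).foldr (· ++ ·) [] := by
    intro N i
    rw [List.range_succ, List.reverse_append, List.reverse_singleton, List.singleton_append,
      List.filter_cons]
    by_cases h : i ≤ N
    · rw [if_pos ((hp i N).2 h), if_pos h]
      rfl
    · rw [if_neg (fun hh => h ((hp i N).1 hh)), if_neg h]
      rfl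
  have h0 : ∀ N i, N ≤ i →
      ((((List.range N).reverse).filter (p i)).map f).foldr (· ++ ·) [] = [] := by
    intro N
    induction N with
    | zero => intros; rfl
    | succ N ih =>
      intro i hi
      rw [hs, if_neg (by omega), ih i (by omega)]
      rfl
  refine ⟨h0 N i, ?_⟩
  induction N with
  | zero => omega
  | succ N ih =>
    intro hi
    rw [hs, hs]
    rcases eq_or_lt_of_le (Nat.lt_succ_iff.1 hi) with rfl | hlt
    · rw [h0 i i le_rfl, h0 i (i + 1) (by omega)]
      simp
    · rw [ih hlt, if_pos (by omega), if_pos (by omega), List.append_assoc]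

lemma factWordGe_eq_nil (f : ℕ → List ℕ) {i : ℕ} (hi : topIdx f < i) : factWordGe f i = [] :=
  (foldr_filter_range f (fun i j => decide (i ≤ j))
    (fun _ _ => decide_eq_true_iff) (topIdx f + 1) i).1 hi

lemma factWordGe_eq_append {f : ℕ → List ℕ} (hfin : {i : ℕ | f i ≠ []}.Finite) (i : ℕ) :
    factWordGe f i = factWordGe f (i + 1) ++ f i := by
  by_cases hi : i ≤ topIdx f
  · exact (foldr_filter_range f (fun i j => decide (i ≤ j))
      (fun _ _ => decide_eq_true_iff) (topIdx f + 1) i).2 (Nat.lt_succ_of_le hi)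
  · have h1 : f i = [] := by
      by_contra h
      exact hi (le_csSup hfin.bddAbove h)
    rw [factWordGe_eq_nil f (by omega), factWordGe_eq_nil f (by omega), h1]
    rfl

lemma isReducedWord_factWordGe {f : ℕ → List ℕ} (hfin : {i : ℕ | f i ≠ []}.Finite)
    (hred : IsReducedWord (factWord f)) (i : ℕ) : IsReducedWord (factWordGe f i) := by
  induction i with
  | zero => exact hred
  | succ i ih =>
    rw [factWordGe_eq_append hfin] at ih
    exact ih.left

lemma le_hatQfact_iff {f : ℕ → List ℕ} (hfin : {i : ℕ | f i ≠ []}.Finite)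
    (hred : IsReducedWord (factWord f)) (r : ℤ) (c : ℕ) {i : ℕ} (hi : 1 ≤ i) :
    i ≤ hatQfact f r c ↔ 1 ≤ r ∧ 1 ≤ c ∧ r.toNat ∈ colRows (c - 1) (factWordGe f i) := by
  have hW := isReducedWord_factWordGe hfin hred
  rw [← hatP_ne_zero (hW i)]
  have hanti : ∀ i j, i ≤ j → hatP (factWordGe f j) r c ≠ 0 → hatP (factWordGe f i) r c ≠ 0 := by
    intro i j hij
    induction j, hij using Nat.le_induction with
    | base => exact id
    | succ j _ ih =>
      refine fun h => ih ?_
      rw [hatP_ne_zero (hW _)] at h ⊢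
      refine ⟨h.1, h.2.1, ?_⟩
      rw [factWordGe_eq_append hfin]
      exact colRows_subset_append (factWordGe_eq_append hfin j ▸ hW j) _ h.2.2
  have hbd : ∀ i, hatP (factWordGe f i) r c ≠ 0 → i ≤ topIdx f := by
    intro i h
    by_contra hlt
    rw [hatP_ne_zero (hW _), factWordGe_eq_nil f (by omega), colRows_nil] at h
    simpa using h.2.2
  set S := {i : ℕ | 1 ≤ i ∧ hatP (factWordGe f i) r c ≠ 0 ∧ hatP (factWordGe f (i + 1)) r c = 0}
    with hS
  have hSb : BddAbove S := ⟨topIdx f, fun i h => hbd i h.2.1⟩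
  change i ≤ sSup S ↔ _
  constructor
  · intro h
    have hne : S.Nonempty := by
      by_contra hh
      rw [Set.not_nonempty_iff_eq_empty] at hh
      rw [hh, csSup_empty] at h
      exact absurd h (by simp; omega)
    exact hanti _ _ h (Nat.sSup_mem hne hSb).2.1
  · intro h
    by_contra! hlt
    have hall : ∀ j, i ≤ j → hatP (factWordGe f j) r c ≠ 0 := by
      intro j hij
      induction j, hij using Nat.le_induction with
      | base => exact h
      | succ j hij ih =>
        intro h0
        have : j ≤ sSup S := le_csSup hSb ⟨hi.trans hij, ih, h0⟩
        omega
    have := hbd (max i (topIdx f + 1)) (hall _ (le_max_left _ _))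
    omega

/-- Lemma: `Q̂(ρ^•)` is a key tableau.
For every increasing factorization of a reduced word, the weak Edelman–Greene recording
tableau `Q̂(ρ^•)` is a key tableau. -/
theorem hatQ_is_key_tableau (f : ℕ → List ℕ) (hf0 : f 0 = [])
    (hfin : {i : ℕ | f i ≠ []}.Finite) (hinc : IncreasingFact f)
    (hred : IsReducedWord (factWord f)) :
    IsKeyTableau (hatQfact f) := by
  have hle := fun r c i => le_hatQfact_iff hfin hred r c (i := i)
  have hW := isReducedWord_factWordGe hfin hred
  have hne : ∀ r c, hatQfact f r c ≠ 0 ↔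
      1 ≤ r ∧ 1 ≤ c ∧ r.toNat ∈ colRows (c - 1) (factWordGe f 1) := fun r c => by
    rw [← hle r c 1 le_rfl, Nat.one_le_iff_ne_zero]
  have hbox := fun i c => boxes_of_increasing (ρ := factWordGe f (i + 1)) (F := f i)
    (factWordGe_eq_append hfin i ▸ hW i) (hinc i) c
  simp only [← factWordGe_eq_append hfin] at hbox
  have hnew : ∀ r c, hatQfact f r c ≠ 0 → 1 ≤ r ∧ 1 ≤ c ∧
      r.toNat ∈ colRows (c - 1) (factWordGe f (hatQfact f r c)) ∧
      r.toNat ∉ colRows (c - 1) (factWordGe f (hatQfact f r c + 1)) := by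
    intro r c h
    obtain ⟨h1, h2, h3⟩ := (hle r c _ (Nat.one_le_iff_ne_zero.2 h)).1 le_rfl
    refine ⟨h1, h2, h3, fun h4 => ?_⟩
    have := (hle r c _ (Nat.le_add_left 1 _)).2 ⟨h1, h2, h4⟩
    omega
  have hrow : ∀ r c, 1 ≤ c → hatQfact f r (c + 1) ≤ hatQfact f r c := by
    intro r c hc
    rcases Nat.eq_zero_or_pos (hatQfact f r (c + 1)) with h | h
    · omega
    obtain ⟨h1, h2, h3⟩ := (hle r (c + 1) _ h).1 le_rfl
    exact (hle r c _ h).2 ⟨h1, hc, colRows_subset (by omega) _ h3⟩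
  refine ⟨fun r c hr => ?_, fun r => ?_, ?_, fun r c hc h => ?_, fun r c hc _ => hrow r c hc,
    fun r r' c hrr h h' e => ?_, fun r r' c hrr h h' hlt => ?_⟩
  · by_contra h
    have := ((hne r c).1 h).1
    omega
  · by_contra h
    have := ((hne r 0).1 h).2.1
    omega
  · refine (((col (factWordGe f 1)).image fun r : ℕ => (r : ℤ)) ×ˢ
      Finset.range ((factWordGe f 1).length + 1)).finite_toSet.subset fun p hp => ?_
    obtain ⟨h1, h2, h3⟩ := (hne p.1 p.2).1 hp
    rw [Finset.mem_coe, Finset.mem_product, Finset.mem_image, Finset.mem_range]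
    refine ⟨⟨_, colRows_subset_col _ _ h3, by omega⟩, ?_⟩
    by_contra hlt
    rw [colRows_eq_empty (hW 1) (by omega)] at h3
    simp at h3
  · have := hrow r c hc
    omega
  · obtain ⟨h1, -, h3, h4⟩ := hnew r c h
    obtain ⟨h1', -, h3', h4'⟩ := hnew r' c h'
    rw [← e] at h3' h4'
    have := (hbox _ _).1 _ h3 _ h3' h4 h4'
    omega
  · obtain ⟨h1', h2, h3', h4'⟩ := hnew r' c h'
    obtain ⟨h1, -, h3⟩ := (hle r c _ (Nat.le_add_left 1 _)).1 (Nat.succ_le_of_lt hlt)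
    have h5 := (hbox _ _).2 _ h3' h4' _ h3 (by omega)
    have := (hle r (c + 1) _ (Nat.le_add_left 1 _)).2
      ⟨h1, by omega, by rwa [show c + 1 - 1 = c - 1 + 1 by omega]⟩
    exact ⟨by omega, by omega⟩
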